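/- arXiv:1712.03498 — 3 statements merged into one kernel-verified Lean document; each statement's English description precedes it below -/
import Mathlib

section
/- Let c, f : ℝⁿ → ℝ satisfy |c(x)−c(y)| ≤ L_c|x−y|^β and |f(x)−f(y)| ≤ L_f|x−y|^{β'} for all x,y ∈ ℝⁿ, where L_c, L_f > 0 and β, β' ∈ (0,1], and assume c₀ := inf_{x∈ℝⁿ} c(x) > 0. Assume limsup_{|x|→∞} ( Tr(P(x))/|x|² − c₀/(2Λ) ) ≤ 0. If u : ℝⁿ → ℝ is a bounded, uniformly continuous viscosity solution of F(D²u(x),x) − c(x)u(x) = f(x) on all of ℝⁿ, then there exist α ∈ (0,1] with α ≤ min{β,β'} and a constant L > 0 such that |u(x)−u(y)| ≤ L|x−y|^α for all x, y ∈ ℝⁿ. -/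
open Matrix Filter

/-- The Hessian matrix `D²φ(x)` of a function `φ : ℝⁿ → ℝ` at `x`, with entries the
second partial derivatives in the directions of the standard basis vectors. -/
noncomputable def hessianMatrix {n : ℕ} (φ : EuclideanSpace ℝ (Fin n) → ℝ)
    (x : EuclideanSpace ℝ (Fin n)) : Matrix (Fin n) (Fin n) ℝ :=
  fun i j => fderiv ℝ (fun y => fderiv ℝ φ y (EuclideanSpace.single j 1)) x
    (EuclideanSpace.single i 1)

/-- `u` is a viscosity subsolution of `F(D²u(x), x) − c(x)·u(x) = f(x)` on all of `ℝⁿ`: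
for every `C²` test function `φ` and every local maximum point `x₀` of `u − φ`,
`F(D²φ(x₀), x₀) − c(x₀)·u(x₀) ≥ f(x₀)`. -/
def IsViscositySubsolution {n : ℕ}
    (F : Matrix (Fin n) (Fin n) ℝ → EuclideanSpace ℝ (Fin n) → ℝ)
    (c f u : EuclideanSpace ℝ (Fin n) → ℝ) : Prop :=
  ∀ φ : EuclideanSpace ℝ (Fin n) → ℝ, ContDiff ℝ 2 φ →
    ∀ x₀ : EuclideanSpace ℝ (Fin n), IsLocalMax (fun x => u x - φ x) x₀ →
      f x₀ ≤ F (hessianMatrix φ x₀) x₀ - c x₀ * u x₀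

/-- `u` is a viscosity supersolution of `F(D²u(x), x) − c(x)·u(x) = f(x)` on all of `ℝⁿ`:
for every `C²` test function `φ` and every local minimum point `x₀` of `u − φ`,
`F(D²φ(x₀), x₀) − c(x₀)·u(x₀) ≤ f(x₀)`. -/
def IsViscositySupersolution {n : ℕ}
    (F : Matrix (Fin n) (Fin n) ℝ → EuclideanSpace ℝ (Fin n) → ℝ)
    (c f u : EuclideanSpace ℝ (Fin n) → ℝ) : Prop :=
  ∀ φ : EuclideanSpace ℝ (Fin n) → ℝ, ContDiff ℝ 2 φ →
    ∀ x₀ : EuclideanSpace ℝ (Fin n), IsLocalMin (fun x => u x - φ x) x₀ →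
      F (hessianMatrix φ x₀) x₀ - c x₀ * u x₀ ≤ f x₀

/-- `u` is a viscosity solution: both a viscosity subsolution and supersolution. -/
def IsViscositySolution {n : ℕ}
    (F : Matrix (Fin n) (Fin n) ℝ → EuclideanSpace ℝ (Fin n) → ℝ)
    (c f u : EuclideanSpace ℝ (Fin n) → ℝ) : Prop :=
  IsViscositySubsolution F c f u ∧ IsViscositySupersolution F c f u

open Topology
open scoped RealInnerProductSpace

/-- A real function on an interval lying above parabolas of slope `m t ≤ b + a * t` grows by at most
the integral of `b + a * t`. -/
lemma sub_le_of_slope_le {θ m : ℝ → ℝ} {C a b : ℝ}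
    (h : ∀ s ∈ Set.Icc (0 : ℝ) 1, ∀ t ∈ Set.Icc (0 : ℝ) 1,
      θ t + m t * (s - t) - C * (s - t) ^ 2 ≤ θ s)
    (hm : ∀ t ∈ Set.Icc (0 : ℝ) 1, m t ≤ b + a * t) :
    θ 1 - θ 0 ≤ b + a / 2 := by
  have step : ∀ s ∈ Set.Icc (0 : ℝ) 1, ∀ t ∈ Set.Icc (0 : ℝ) 1, s ≤ t →
      (θ t - b * t - a * t ^ 2 / 2) - (θ s - b * s - a * s ^ 2 / 2)
        ≤ (C + a / 2) * (t - s) ^ 2 := by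
    intro s hs t ht hst
    have h1 := h s hs t ht
    have h2 := mul_nonneg (sub_nonneg.2 (hm t ht)) (sub_nonneg.2 hst)
    nlinarith
  have main : ∀ N : ℕ, 0 < N → θ 1 - θ 0 - b - a / 2 ≤ (C + a / 2) * (1 / (N : ℝ)) := by
    intro N hN
    have hN' : (0 : ℝ) < N := by exact_mod_cast hN
    have ind : ∀ k : ℕ, k ≤ N →
        (θ (k / N) - b * (k / N) - a * (k / N : ℝ) ^ 2 / 2) - θ 0
          ≤ (C + a / 2) * (k * (1 / (N : ℝ)) ^ 2) := by
      intro k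
      induction k with
      | zero => intro _; simp
      | succ k ih =>
        intro hk
        have hk' : ((k : ℝ) + 1) ≤ N := by exact_mod_cast hk
        have := ih (by omega)
        have h3 := step (k / N) ⟨by positivity, by rw [div_le_one hN']; linarith⟩
          (((k + 1 : ℕ) : ℝ) / N)
          ⟨by positivity, by push_cast; rw [div_le_one hN']; linarith⟩
          (by gcongr; simp)
        have h4 : ((k + 1 : ℕ) : ℝ) / N - k / N = 1 / N := by push_cast; ring
        rw [h4] at h3
        push_cast at h3 ⊢
        linarith
    have := ind N le_rfl
    rw [div_self hN'.ne'] at this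
    have h5 : (N : ℝ) * (1 / (N : ℝ)) ^ 2 = 1 / N := by field_simp
    rw [h5] at this
    linarith
  have lim : Tendsto (fun N : ℕ => (C + a / 2) * (1 / (N : ℝ))) atTop (𝓝 ((C + a / 2) * 0)) :=
    tendsto_one_div_atTop_nhds_zero_nat.const_mul _
  have := ge_of_tendsto lim (by filter_upwards [eventually_gt_atTop 0] with N hN using main N hN)
  linarith

lemma le_sub_of_le_slope {θ m : ℝ → ℝ} {C a b : ℝ}
    (h : ∀ s ∈ Set.Icc (0 : ℝ) 1, ∀ t ∈ Set.Icc (0 : ℝ) 1,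
      θ t + m t * (s - t) - C * (s - t) ^ 2 ≤ θ s)
    (hm : ∀ t ∈ Set.Icc (0 : ℝ) 1, b + a * t ≤ m t) :
    b + a / 2 ≤ θ 1 - θ 0 := by
  have mem : ∀ t ∈ Set.Icc (0 : ℝ) 1, 1 - t ∈ Set.Icc (0 : ℝ) 1 := fun t ht =>
    ⟨by linarith [ht.2], by linarith [ht.1]⟩
  have := sub_le_of_slope_le (θ := fun t => θ (1 - t)) (m := fun t => -m (1 - t)) (C := C)
    (a := a) (b := -(b + a))
    (fun s hs t ht => by have := h _ (mem s hs) _ (mem t ht); nlinarith)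
    (fun t ht => by have := hm _ (mem t ht); linarith)
  simp only [sub_self, sub_zero] at this
  linarith

section Semiconvex

variable {E : Type*} [NormedAddCommGroup E] [InnerProductSpace ℝ E]

/-- If the subgradient selection `q` of a semiconvex function `W` is differentiable at `v`, then
`W` has a second order expansion at `v`. -/
lemma second_order_expansion {W : E → ℝ} {q : E → E} {C : ℝ} {v : E} {A : E →L[ℝ] E}
    (hq : ∀ v h, W v + ⟪q v, h⟫ - C * ‖h‖ ^ 2 ≤ W (v + h)) (hA : HasFDerivAt q A v)
    {δ : ℝ} (hδ : 0 < δ) :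
    ∀ᶠ h in 𝓝 (0 : E),
      |W (v + h) - W v - ⟪q v, h⟫ - ⟪A h, h⟫ / 2| ≤ δ * ‖h‖ ^ 2 := by
  have h1 := (hasFDerivAt_iff_isLittleO_nhds_zero.1 hA).def hδ
  obtain ⟨r, hr, hball⟩ := Metric.eventually_nhds_iff_ball.1 h1
  filter_upwards [Metric.ball_mem_nhds (0 : E) hr] with h hh
  have hm : ∀ t ∈ Set.Icc (0 : ℝ) 1,
      |⟪q (v + t • h), h⟫ - (⟪q v, h⟫ + ⟪A h, h⟫ * t)| ≤ δ * ‖h‖ ^ 2 := by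
    intro t ht
    have hth : ‖t • h‖ ≤ ‖h‖ := by
      rw [norm_smul, Real.norm_of_nonneg ht.1]
      exact mul_le_of_le_one_left (norm_nonneg _) ht.2
    have h2 := hball (t • h) (by
      rw [mem_ball_zero_iff] at hh ⊢; exact hth.trans_lt hh)
    have h3 : ⟪q (v + t • h), h⟫ - (⟪q v, h⟫ + ⟪A h, h⟫ * t)
        = ⟪q (v + t • h) - q v - A (t • h), h⟫ := by
      rw [inner_sub_left, inner_sub_left, map_smul, real_inner_smul_left]; ring
    rw [h3]
    calc _ ≤ ‖q (v + t • h) - q v - A (t • h)‖ * ‖h‖ := abs_real_inner_le_norm _ _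
      _ ≤ (δ * ‖h‖) * ‖h‖ := by
        gcongr
        exact h2.trans (by gcongr)
      _ = _ := by ring
  have hθ : ∀ s ∈ Set.Icc (0 : ℝ) 1, ∀ t ∈ Set.Icc (0 : ℝ) 1,
      W (v + t • h) + ⟪q (v + t • h), h⟫ * (s - t) - (C * ‖h‖ ^ 2) * (s - t) ^ 2
        ≤ W (v + s • h) := by
    intro s _ t _
    have h4 := hq (v + t • h) ((s - t) • h)
    rw [add_assoc, ← add_smul, add_sub_cancel, real_inner_smul_right, norm_smul, mul_pow,
      Real.norm_eq_abs, sq_abs] at h4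
    linarith
  have up := sub_le_of_slope_le (θ := fun t => W (v + t • h)) hθ
    (a := ⟪A h, h⟫) (b := ⟪q v, h⟫ + δ * ‖h‖ ^ 2)
    (fun t ht => by linarith [(abs_le.1 (hm t ht)).2])
  have lo := le_sub_of_le_slope (θ := fun t => W (v + t • h)) hθ
    (a := ⟪A h, h⟫) (b := ⟪q v, h⟫ - δ * ‖h‖ ^ 2)
    (fun t ht => by linarith [(abs_le.1 (hm t ht)).1])
  simp only [one_smul, zero_smul, add_zero] at up lo
  rw [abs_le]
  constructor <;> linarith

lemma eq_zero_of_inner_le_sq {a : E} {C : ℝ} (h : ∀ x, ⟪a, x⟫ ≤ C * ‖x‖ ^ 2) : a = 0 := by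
  have hC : 0 < |C| + 1 := by positivity
  have h1 := h ((1 / (|C| + 1)) • a)
  rw [real_inner_smul_right, real_inner_self_eq_norm_sq, norm_smul, mul_pow,
    Real.norm_of_nonneg (by positivity)] at h1
  have h2 : C ≤ |C| := le_abs_self C
  have h3 : 0 ≤ (1 / (|C| + 1)) ^ 2 * ‖a‖ ^ 2 := by positivity
  have h4 : 1 / (|C| + 1) * ‖a‖ ^ 2 = (|C| + 1) * ((1 / (|C| + 1)) ^ 2 * ‖a‖ ^ 2) := by
    field_simp
  have h5 : (1 / (|C| + 1)) ^ 2 * ‖a‖ ^ 2 ≤ 0 := by nlinarith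
  have h6 : ‖a‖ ^ 2 ≤ 0 := by
    by_contra hcon
    push Not at hcon
    have : 0 < (1 / (|C| + 1)) ^ 2 * ‖a‖ ^ 2 := by positivity
    linarith
  exact norm_eq_zero.1 (pow_eq_zero_iff two_ne_zero |>.1 (le_antisymm h6 (by positivity)))

/-- Lipschitz dependence of subgradients at points where the function is also touched from
above by a paraboloid. -/
lemma norm_subgradient_sub_le {f : E → ℝ} {C : ℝ} (hC : 0 < C) {y v q q' : E}
    (hy : ∀ h, f y + ⟪q', h⟫ - C * ‖h‖ ^ 2 ≤ f (y + h))
    (hv : ∀ h, f v + ⟪q, h⟫ - C * ‖h‖ ^ 2 ≤ f (v + h))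
    (hv' : ∀ h, f (v + h) ≤ f v + ⟪q, h⟫ + C * ‖h‖ ^ 2) :
    ‖q' - q‖ ≤ 6 * C * ‖y - v‖ := by
  have key : ∀ h, ⟪q' - q, h⟫ ≤ 3 * C * ‖h‖ ^ 2 + 3 * C * ‖y - v‖ ^ 2 := by
    intro h
    have h1 := hy h
    have h2 := hv (y - v)
    have h3 := hv' (y - v + h)
    rw [show v + (y - v + h) = y + h by abel, inner_add_right] at h3
    rw [show v + (y - v) = y by abel] at h2
    rw [inner_sub_left]
    have h4 : ‖y - v + h‖ ^ 2 ≤ 2 * ‖y - v‖ ^ 2 + 2 * ‖h‖ ^ 2 := by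
      have := norm_add_le (y - v) h
      nlinarith [sq_nonneg (‖y - v‖ - ‖h‖), norm_nonneg (y - v + h), norm_nonneg (y - v),
        norm_nonneg h]
    nlinarith
  have h1 := key ((1 / (6 * C)) • (q' - q))
  rw [real_inner_smul_right, real_inner_self_eq_norm_sq, norm_smul, mul_pow,
    Real.norm_of_nonneg (by positivity)] at h1
  have h2 : ‖q' - q‖ ^ 2 ≤ (6 * C * ‖y - v‖) ^ 2 := by
    have h3 : 3 * C * ((1 / (6 * C)) ^ 2 * ‖q' - q‖ ^ 2) = 1 / (12 * C) * ‖q' - q‖ ^ 2 := by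
      field_simp; ring
    rw [h3] at h1
    have h4 : 1 / (6 * C) * ‖q' - q‖ ^ 2 = 2 * (1 / (12 * C) * ‖q' - q‖ ^ 2) := by
      field_simp; ring
    rw [h4] at h1
    have h5 : 1 / (12 * C) * ‖q' - q‖ ^ 2 ≤ 3 * C * ‖y - v‖ ^ 2 := by linarith
    rw [one_div, inv_mul_le_iff₀ (by positivity)] at h5
    nlinarith
  exact le_of_sq_le_sq h2 (by positivity)

open MeasureTheory in
/-- **Jensen's lemma** combined with a second order differentiability statement: if a semiconvex `W`
minus a semiconcave `Φ` has a maximum after every small linear perturbation, then for one of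
these perturbations there is a maximum point at which the gradient of `W` is differentiable. -/
lemma exists_max_hasFDerivAt_subgradient [FiniteDimensional ℝ E] {W Φ : E → ℝ} {q l : E → E}
    {C δ : ℝ} (hC : 0 < C) (hδ : 0 < δ)
    (hq : ∀ v h, W v + ⟪q v, h⟫ - C * ‖h‖ ^ 2 ≤ W (v + h))
    (hl : ∀ v h, Φ (v + h) ≤ Φ v + ⟪l v, h⟫ + C * ‖h‖ ^ 2)
    (hmax : ∀ p : E, ‖p‖ < δ → ∃ v, ∀ y, W y - Φ y - ⟪p, y⟫ ≤ W v - Φ v - ⟪p, v⟫) :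
    ∃ (p v : E) (A : E →L[ℝ] E), ‖p‖ < δ ∧
      (∀ y, W y - Φ y - ⟪p, y⟫ ≤ W v - Φ v - ⟪p, v⟫) ∧ HasFDerivAt q A v := by
  let : MeasurableSpace E := borel E
  have : BorelSpace E := ⟨rfl⟩
  let μ : Measure E := Measure.hausdorffMeasure (Module.finrank ℝ E)
  let K : Set E := {v | ∃ p : E, ‖p‖ < δ ∧ ∀ y, W y - Φ y - ⟪p, y⟫ ≤ W v - Φ v - ⟪p, v⟫}
  have grad : ∀ v p : E, (∀ y, W y - Φ y - ⟪p, y⟫ ≤ W v - Φ v - ⟪p, v⟫) → p = q v - l v := by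
    intro v p hv
    have : q v - l v - p = 0 := by
      refine eq_zero_of_inner_le_sq (C := 2 * C) fun h => ?_
      have h1 := hv (v + h)
      have h2 := hq v h
      have h3 := hl v h
      rw [inner_add_right] at h1
      rw [inner_sub_left, inner_sub_left]
      linarith
    exact (sub_eq_zero.1 this).symm
  have contact : ∀ v ∈ K, ∀ h, W (v + h) - Φ (v + h) ≤ W v - Φ v + ⟪q v - l v, h⟫ := by
    rintro v ⟨p, _, hv⟩ h
    have h1 := hv (v + h)
    rw [← grad v p hv]
    rw [inner_add_right] at h1
    linarith
  have touchW : ∀ v ∈ K, ∀ h, W (v + h) ≤ W v + ⟪q v, h⟫ + C * ‖h‖ ^ 2 := by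
    intro v hv h
    have h1 := contact v hv h
    have h2 := hl v h
    rw [inner_sub_left] at h1
    linarith
  have lipq : ∀ y, ∀ v ∈ K, ‖q y - q v‖ ≤ 6 * C * ‖y - v‖ := fun y v hv =>
    norm_subgradient_sub_le hC (hq y) (hq v) (touchW v hv)
  have lipp : LipschitzOnWith (Real.toNNReal (12 * C)) (fun v => q v - l v) K := by
    have lower : ∀ v h, (W v - Φ v) + ⟪q v - l v, h⟫ - (2 * C) * ‖h‖ ^ 2
        ≤ W (v + h) - Φ (v + h) := by
      intro v h
      rw [inner_sub_left]
      linarith [hq v h, hl v h]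
    refine LipschitzOnWith.of_dist_le_mul fun y hy v hv => ?_
    rw [dist_eq_norm, dist_eq_norm, Real.coe_toNNReal _ (by positivity)]
    have := norm_subgradient_sub_le (f := fun v => W v - Φ v) (C := 2 * C) (by positivity)
      (lower y) (lower v) (fun h => by
        have := contact v hv h
        have : 0 ≤ 2 * C * ‖h‖ ^ 2 := by positivity
        linarith)
    linarith
  have hK : μ K ≠ 0 := by
    intro h0
    have h1 := lipp.hausdorffMeasure_image_le (d := Module.finrank ℝ E) (by positivity)
    have h2 : Metric.ball (0 : E) δ ⊆ (fun v => q v - l v) '' K := by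
      intro p hp
      rw [mem_ball_zero_iff] at hp
      obtain ⟨v, hv⟩ := hmax p hp
      exact ⟨v, ⟨p, hp, hv⟩, (grad v p hv).symm⟩
    have h3 : μ (Metric.ball (0 : E) δ) ≤ 0 := by
      refine (measure_mono h2).trans (h1.trans ?_)
      change _ * μ K ≤ 0
      rw [h0, mul_zero]
    exact (Metric.measure_ball_pos μ (0 : E) hδ).ne' (le_antisymm h3 bot_le)
  have lipqK : LipschitzOnWith (Real.toNNReal (6 * C)) q K := by
    refine LipschitzOnWith.of_dist_le_mul fun y _ v hv => ?_
    rw [dist_eq_norm, dist_eq_norm, Real.coe_toNNReal _ (by positivity)]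
    exact lipq y v hv
  have ae1 : ∀ᵐ v ∂μ, v ∈ K → DifferentiableWithinAt ℝ q K v :=
    lipqK.ae_differentiableWithinAt_of_mem
  have ae2 : ∀ᵐ v ∂μ, DifferentiableAt ℝ (fun y => Metric.infDist y K) v :=
    (Metric.lipschitz_infDist_pt K).ae_differentiableAt
  obtain ⟨v, hvK, hv1, hv2⟩ : ∃ v ∈ K, DifferentiableWithinAt ℝ q K v ∧
      DifferentiableAt ℝ (fun y => Metric.infDist y K) v := by
    by_contra hcon
    push Not at hcon
    refine hK (measure_mono_null (fun v hv => ?_) (ae_iff.1 (ae1.and ae2)))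
    exact fun h => hcon v hv (h.1 hv) h.2
  obtain ⟨p, hp, hv⟩ := id hvK
  obtain ⟨A, hA⟩ := hv1
  refine ⟨p, v, A, hp, hv, ?_⟩
  have hdist0 : HasFDerivAt (fun y => Metric.infDist y K) (0 : E →L[ℝ] ℝ) v := by
    have hmin : IsLocalMin (fun y => Metric.infDist y K) v := by
      refine Eventually.of_forall fun y => ?_
      change Metric.infDist v K ≤ _
      rw [Metric.infDist_zero_of_mem hvK]
      exact Metric.infDist_nonneg
    have := hv2.hasFDerivAt
    rwa [hmin.fderiv_eq_zero] at this
  rw [hasFDerivAt_iff_isLittleO, Asymptotics.isLittleO_iff]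
  intro e he
  obtain ⟨ϑ, hϑ, hϑ1, hϑe⟩ : ∃ ϑ : ℝ, 0 < ϑ ∧ ϑ ≤ 1 ∧ ϑ * (6 * C + 2 + ‖A‖) ≤ e := by
    refine ⟨min 1 (e / (6 * C + 2 + ‖A‖)), by positivity, min_le_left _ _, ?_⟩
    rw [← le_div_iff₀ (by positivity)]
    exact min_le_right _ _
  have near := (hasFDerivAt_iff_isLittleO.1 hdist0).def (half_pos hϑ)
  have within := (hasFDerivWithinAt_iff_isLittleO.1 hA).def hϑ
  obtain ⟨r, hr, hwithin⟩ := Metric.mem_nhdsWithin_iff.1 within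
  filter_upwards [near, Metric.ball_mem_nhds v (half_pos hr)] with y hy hyr
  rcases eq_or_ne y v with rfl | hne
  · simp
  have hpos : 0 < ‖y - v‖ := norm_pos_iff.2 (sub_ne_zero.2 hne)
  have hy' : Metric.infDist y K < ϑ * ‖y - v‖ := by
    rw [Metric.infDist_zero_of_mem hvK, sub_zero, _root_.zero_apply, sub_zero,
      Real.norm_of_nonneg Metric.infDist_nonneg] at hy
    nlinarith [mul_pos hϑ hpos]
  obtain ⟨k, hkK, hyk⟩ := (Metric.infDist_lt_iff ⟨v, hvK⟩).1 hy'
  rw [dist_eq_norm] at hyk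
  have hkv : ‖k - v‖ ≤ (1 + ϑ) * ‖y - v‖ := by
    have : k - v = (y - v) - (y - k) := by abel
    rw [this]
    linarith [norm_sub_le (y - v) (y - k)]
  rw [Metric.mem_ball, dist_eq_norm] at hyr
  have hk : ‖q k - q v - A (k - v)‖ ≤ ϑ * ‖k - v‖ := by
    refine hwithin ⟨?_, hkK⟩
    rw [Metric.mem_ball, dist_eq_norm]
    nlinarith
  have hyk' := lipq y k hkK
  have hAk : ‖A (k - y)‖ ≤ ‖A‖ * ‖y - k‖ := by
    rw [norm_sub_rev y k]; exact A.le_opNorm _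
  have split : q y - q v - A (y - v) = (q y - q k) + (q k - q v - A (k - v)) + A (k - y) := by
    simp only [map_sub]; abel
  rw [split]
  have h1 := norm_add₃_le (a := q y - q k) (b := q k - q v - A (k - v)) (c := A (k - y))
  have h2 : 6 * C * ‖y - k‖ ≤ 6 * C * (ϑ * ‖y - v‖) := by gcongr
  have h3 : ‖A‖ * ‖y - k‖ ≤ ‖A‖ * (ϑ * ‖y - v‖) := by gcongr
  have h4 : ϑ * ‖k - v‖ ≤ ϑ * (2 * ‖y - v‖) := by
    gcongr
    exact hkv.trans (by gcongr; linarith)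
  have h5 : (ϑ * (6 * C + 2 + ‖A‖)) * ‖y - v‖ ≤ e * ‖y - v‖ := by gcongr
  nlinarith

end Semiconvex

lemma exists_max_of_le_quadratic {E : Type*} [NormedAddCommGroup E] [ProperSpace E]
    {g : E → ℝ} (hg : Continuous g) {M b e : ℝ} (he : 0 < e)
    (h : ∀ v, g v ≤ M + b * ‖v‖ - e * ‖v‖ ^ 2) : ∃ v, ∀ y, g y ≤ g v := by
  refine hg.exists_forall_ge' 0 ?_
  filter_upwards [(tendsto_norm_cocompact_atTop (E := E)).eventually_ge_atTop
    ((|M| + |b| + |g 0|) / e + 1)] with v hv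
  have h1 : 0 ≤ (|M| + |b| + |g 0|) / e := by positivity
  have h2 : (|M| + |b| + |g 0|) / e ≤ ‖v‖ - 1 := by linarith
  rw [div_le_iff₀ he] at h2
  have hv1 : 1 ≤ ‖v‖ := by linarith
  have h3 : (|M| + |b| + |g 0|) * ‖v‖ ≤ (‖v‖ - 1) * e * ‖v‖ := by gcongr
  have h4 := h v
  nlinarith [le_abs_self M, le_abs_self b, neg_abs_le (g 0), abs_nonneg M, abs_nonneg b,
    abs_nonneg (g 0), mul_nonneg (abs_nonneg M) (sub_nonneg.2 hv1),
    mul_nonneg (abs_nonneg (g 0)) (sub_nonneg.2 hv1), mul_nonneg he.le (norm_nonneg v),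
    mul_nonneg (sub_nonneg.2 (le_abs_self b)) (norm_nonneg v)]

section SupConvolution

variable {E : Type*} [NormedAddCommGroup E] [InnerProductSpace ℝ E] [FiniteDimensional ℝ E]

/-- The sup-convolution `U` of a bounded continuous function `u`, with a selection `z` of
maximum points. -/
lemma exists_supConvolution {u : E → ℝ} (hu : Continuous u) {M τ : ℝ} (hM : ∀ x, |u x| ≤ M)
    (hτ : 0 < τ) :
    ∃ (U : E → ℝ) (z : E → E), Continuous U ∧ (∀ x, u x ≤ U x) ∧
      (∀ x, U x = u (z x) - τ * ‖x - z x‖ ^ 2) ∧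
      (∀ x y, u y - τ * ‖x - y‖ ^ 2 ≤ U x) ∧
      (∀ x, τ * ‖x - z x‖ ^ 2 ≤ 2 * M) ∧
      ∀ x h, U x + ⟪(2 * τ) • (z x - x), h⟫ - τ * ‖h‖ ^ 2 ≤ U (x + h) := by
  have ex : ∀ x, ∃ z, ∀ y, u y - τ * ‖x - y‖ ^ 2 ≤ u z - τ * ‖x - z‖ ^ 2 := by
    intro x
    refine exists_max_of_le_quadratic (by fun_prop) (M := M) (b := 2 * τ * ‖x‖) hτ fun v => ?_
    have h1 := (abs_le.1 (hM v)).2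
    have h2 : ‖x - v‖ ^ 2 = ‖x‖ ^ 2 - 2 * ⟪x, v⟫ + ‖v‖ ^ 2 := norm_sub_sq_real x v
    have h3 := real_inner_le_norm x v
    rw [h2]
    nlinarith [mul_nonneg hτ.le (sq_nonneg ‖x‖)]
  choose z hz using ex
  have bound : ∀ x, τ * ‖x - z x‖ ^ 2 ≤ 2 * M := by
    intro x
    have h1 := hz x x
    rw [sub_self, norm_zero] at h1
    linarith [(abs_le.1 (hM x)).1, (abs_le.1 (hM (z x))).2]
  have semi : ∀ x h, u (z x) - τ * ‖x - z x‖ ^ 2 + ⟪(2 * τ) • (z x - x), h⟫ - τ * ‖h‖ ^ 2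
      ≤ u (z (x + h)) - τ * ‖x + h - z (x + h)‖ ^ 2 := by
    intro x h
    refine le_trans (le_of_eq ?_) (hz (x + h) (z x))
    rw [show x + h - z x = (x - z x) + h by abel, norm_add_sq_real, real_inner_smul_left,
      ← neg_sub x (z x), inner_neg_left]
    ring
  refine ⟨fun x => u (z x) - τ * ‖x - z x‖ ^ 2, z, ?_, fun x => ?_, fun _ => rfl, hz, bound, semi⟩
  · have hM0 : 0 ≤ M := (abs_nonneg _).trans (hM 0)
    have slope : ∀ x, ‖(2 * τ) • (z x - x)‖ ≤ 2 * τ + 4 * M := by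
      intro x
      rw [norm_smul, norm_sub_rev, Real.norm_of_nonneg (by positivity)]
      nlinarith [bound x, sq_nonneg (‖x - z x‖ - 1)]
    have lower : ∀ x h, -((2 * τ + 4 * M) * ‖h‖ + τ * ‖h‖ ^ 2)
        ≤ (u (z (x + h)) - τ * ‖x + h - z (x + h)‖ ^ 2) - (u (z x) - τ * ‖x - z x‖ ^ 2) := by
      intro x h
      have h1 := semi x h
      have h2 := (abs_le.1 (abs_real_inner_le_norm ((2 * τ) • (z x - x)) h)).1
      have h3 := mul_le_mul_of_nonneg_right (slope x) (norm_nonneg h)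
      linarith
    rw [continuous_iff_continuousAt]
    intro x
    rw [ContinuousAt, tendsto_iff_norm_sub_tendsto_zero]
    have lim : Tendsto (fun y => (2 * τ + 4 * M) * ‖y - x‖ + τ * ‖y - x‖ ^ 2) (𝓝 x) (𝓝 0) := by
      have : Continuous fun y => (2 * τ + 4 * M) * ‖y - x‖ + τ * ‖y - x‖ ^ 2 := by fun_prop
      simpa using this.tendsto x
    refine squeeze_zero (fun _ => norm_nonneg _) (fun y => ?_) lim
    rw [Real.norm_eq_abs, abs_le]
    have h1 := lower x (y - x)
    have h2 := lower y (x - y)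
    rw [add_sub_cancel] at h1 h2
    rw [norm_sub_rev x y] at h2
    constructor <;> linarith
  · have := hz x x
    rw [sub_self, norm_zero] at this
    simpa using this

end SupConvolution

section Sums

variable {E : Type*} [NormedAddCommGroup E] [InnerProductSpace ℝ E] [FiniteDimensional ℝ E]

/-- A form of the **theorem on sums** for semiconvex functions `U`, `V` and a semiconcave
penalty `g (x - y)`. -/
lemma theorem_on_sums_s0 {U V g : E → ℝ} {qU qV l : E → E} {C M : ℝ} (hC : 0 < C)
    (hUc : Continuous U) (hVc : Continuous V) (hgc : Continuous g) (hg : ∀ v, 0 ≤ g v)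
    (hU : ∀ v h, U v + ⟪qU v, h⟫ - C * ‖h‖ ^ 2 ≤ U (v + h))
    (hV : ∀ v h, V v + ⟪qV v, h⟫ - C * ‖h‖ ^ 2 ≤ V (v + h))
    (hl : ∀ v h, g (v + h) ≤ g v + ⟪l v, h⟫ + C * ‖h‖ ^ 2)
    (hM : ∀ x y, U x + V y ≤ M) {x₀ y₀ : E} (hpos : g (x₀ - y₀) < U x₀ + V y₀)
    {θ : ℝ} (hθ : 0 < θ) :
    ∃ (ε : ℝ) (x y q₁ q₂ : E) (X Y : E →L[ℝ] E), 0 < ε ∧ ε ≤ θ ∧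
      ε * (‖x‖ ^ 2 + ‖y‖ ^ 2) ≤ θ ∧ g (x - y) < U x + V y ∧
      (∀ᶠ h in 𝓝 (0 : E), U (x + h) ≤ U x + ⟪q₁, h⟫ + ⟪X h, h⟫ / 2) ∧
      (∀ᶠ h in 𝓝 (0 : E), V (y + h) ≤ V y + ⟪q₂, h⟫ + ⟪Y h, h⟫ / 2) ∧
      ∀ (B : ℝ) (p : E), (∀ h, g (x - y + h) ≤ g (x - y) + ⟪p, h⟫ + B * ‖h‖ ^ 2) →
        ∀ h k, ⟪X h, h⟫ + ⟪Y k, k⟫ ≤ 2 * B * ‖h - k‖ ^ 2 + 4 * ε * (‖h‖ ^ 2 + ‖k‖ ^ 2) := by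
  let w : WithLp 2 (E × E) → ℝ := fun v => U v.fst + V v.snd - g (v.fst - v.snd)
  have hwc : Continuous w := by
    have h1 : Continuous fun v : WithLp 2 (E × E) => v.fst := (WithLp.fstL 2 ℝ E E).continuous
    have h2 : Continuous fun v : WithLp 2 (E × E) => v.snd := (WithLp.sndL 2 ℝ E E).continuous
    exact ((hUc.comp h1).add (hVc.comp h2)).sub (hgc.comp (h1.sub h2))
  have hwM : ∀ v, w v ≤ M := fun v => by
    have h1 := hM v.fst v.snd
    have h2 := hg (v.fst - v.snd)
    change U v.fst + V v.snd - g (v.fst - v.snd) ≤ M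
    linarith
  let m := U x₀ + V y₀ - g (x₀ - y₀)
  have hm : 0 < m := sub_pos.2 hpos
  obtain ⟨ϑ, hϑ, hϑm, hϑθ⟩ : ∃ ϑ : ℝ, 0 < ϑ ∧ 4 * ϑ ≤ m ∧ 6 * ϑ ≤ θ :=
    ⟨min (m / 4) (θ / 6), by positivity, by linarith [min_le_left (m / 4) (θ / 6)],
      by linarith [min_le_right (m / 4) (θ / 6)]⟩
  have bdd : BddAbove (Set.range w) := ⟨M, by rintro _ ⟨v, rfl⟩; exact hwM v⟩
  obtain ⟨v₁, hv₁⟩ := exists_lt_of_lt_ciSup (sub_lt_self (iSup w) hϑ)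
  have hsup : ∀ v, w v ≤ w v₁ + ϑ := fun v => by linarith [le_ciSup bdd v]
  have hw₁ : 3 * ϑ ≤ w v₁ := by
    have : m ≤ w v₁ + ϑ := hsup (WithLp.toLp 2 (x₀, y₀))
    linarith
  obtain ⟨ε, hε, hεθ, hεv⟩ : ∃ ε : ℝ, 0 < ε ∧ ε ≤ θ ∧ ε * ‖v₁‖ ^ 2 ≤ ϑ := by
    refine ⟨min θ (ϑ / (‖v₁‖ ^ 2 + 1)), by positivity, min_le_left _ _, ?_⟩
    have h1 := min_le_right θ (ϑ / (‖v₁‖ ^ 2 + 1))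
    rw [le_div_iff₀ (by positivity)] at h1
    have : 0 < min θ (ϑ / (‖v₁‖ ^ 2 + 1)) := by positivity
    linarith
  obtain ⟨δ, hδ, hδ1, hδϑ⟩ : ∃ δ : ℝ, 0 < δ ∧ δ ≤ 1 ∧ δ * (1 / (2 * ε) + ‖v₁‖) ≤ ϑ := by
    refine ⟨min 1 (ϑ / (1 / (2 * ε) + ‖v₁‖)), by positivity, min_le_left _ _, ?_⟩
    rw [← le_div_iff₀ (by positivity)]
    exact min_le_right _ _
  have normsq : ∀ v : WithLp 2 (E × E), ‖v‖ ^ 2 = ‖v.fst‖ ^ 2 + ‖v.snd‖ ^ 2 :=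
    WithLp.prod_norm_sq_eq_of_L2
  have parallel : ∀ h k : E, ‖h - k‖ ^ 2 ≤ 2 * (‖h‖ ^ 2 + ‖k‖ ^ 2) := by
    intro h k
    have := parallelogram_law_with_norm ℝ h k
    nlinarith [norm_nonneg (h + k)]
  have hW : ∀ v h : WithLp 2 (E × E), U v.fst + V v.snd +
      ⟪WithLp.toLp 2 (qU v.fst, qV v.snd), h⟫ - (2 * C + ε) * ‖h‖ ^ 2
        ≤ U (v + h).fst + V (v + h).snd := by
    intro v h
    have h1 := hU v.fst h.fst
    have h2 := hV v.snd h.snd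
    rw [WithLp.prod_inner_apply, normsq]
    change U v.fst + V v.snd + (⟪qU v.fst, h.fst⟫ + ⟪qV v.snd, h.snd⟫) - _
      ≤ U (v.fst + h.fst) + V (v.snd + h.snd)
    nlinarith [sq_nonneg ‖h.fst‖, sq_nonneg ‖h.snd‖]
  obtain ⟨p, v, A, hp, hv, hA⟩ := exists_max_hasFDerivAt_subgradient
    (W := fun v : WithLp 2 (E × E) => U v.fst + V v.snd)
    (Φ := fun v => g (v.fst - v.snd) + ε * ‖v‖ ^ 2)
    (q := fun v => WithLp.toLp 2 (qU v.fst, qV v.snd))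
    (l := fun v => WithLp.toLp 2 (l (v.fst - v.snd), -l (v.fst - v.snd)) + (2 * ε) • v)
    (C := 2 * C + ε) (δ := δ) (by positivity) hδ
    hW
    (by
      intro v h
      have h1 := hl (v.fst - v.snd) (h.fst - h.snd)
      have h2 := parallel h.fst h.snd
      rw [inner_add_left, WithLp.prod_inner_apply, norm_add_sq_real, real_inner_smul_left]
      change g (v.fst + h.fst - (v.snd + h.snd)) + _ ≤ g (v.fst - v.snd) + _ +
        (⟪l (v.fst - v.snd), h.fst⟫ + ⟪-l (v.fst - v.snd), h.snd⟫ + _) + _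
      rw [show v.fst + h.fst - (v.snd + h.snd) = v.fst - v.snd + (h.fst - h.snd) by abel,
        inner_neg_left]
      rw [inner_sub_right] at h1
      have h3 := normsq h
      nlinarith)
    (by
      intro p _
      refine exists_max_of_le_quadratic (M := M) (b := ‖p‖) ?_ hε fun v => ?_
      · have : Continuous fun v => w v - ε * ‖v‖ ^ 2 - ⟪p, v⟫ := by fun_prop
        refine this.congr fun v => ?_
        change U v.fst + V v.snd - g (v.fst - v.snd) - _ - _ = _
        ring
      · have h1 := hwM v
        have h2 := (abs_le.1 (abs_real_inner_le_norm p v)).1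
        change U v.fst + V v.snd - g (v.fst - v.snd) ≤ M at h1
        linarith)
  have hmax : ∀ y, w y - ε * ‖y‖ ^ 2 - ⟪p, y⟫ ≤ w v - ε * ‖v‖ ^ 2 - ⟪p, v⟫ := by
    intro y
    have h1 := hv y
    change U y.fst + V y.snd - g (y.fst - y.snd) - _ - _
      ≤ U v.fst + V v.snd - g (v.fst - v.snd) - _ - _
    linarith
  have hwv : w v₁ - 2 * ϑ + ε / 2 * ‖v‖ ^ 2 ≤ w v := by
    have h1 := hmax v₁
    have h2 := (abs_le.1 (abs_real_inner_le_norm p v)).1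
    have h3 := (abs_le.1 (abs_real_inner_le_norm p v₁)).2
    have h4 : ‖p‖ * ‖v‖ ≤ δ * ‖v‖ := by gcongr
    have h5 : ‖p‖ * ‖v₁‖ ≤ δ * ‖v₁‖ := by gcongr
    have h6 : δ * ‖v‖ ≤ ε / 2 * ‖v‖ ^ 2 + δ * (1 / (2 * ε)) := by
      have h7 : ε / 2 * ‖v‖ ^ 2 + δ ^ 2 * (1 / (2 * ε)) - δ * ‖v‖
          = (ε * ‖v‖ - δ) ^ 2 / (2 * ε) := by field_simp; ring
      have h8 : 0 ≤ (ε * ‖v‖ - δ) ^ 2 / (2 * ε) := by positivity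
      have h9 : δ ^ 2 * (1 / (2 * ε)) ≤ δ * (1 / (2 * ε)) := by
        gcongr
        nlinarith
      linarith
    linarith
  have expand := fun {η : ℝ} (hη : 0 < η) => second_order_expansion
    (W := fun v : WithLp 2 (E × E) => U v.fst + V v.snd) (C := 2 * C + ε) hW hA hη
  let i₁ : E →L[ℝ] WithLp 2 (E × E) :=
    ((WithLp.prodContinuousLinearEquiv 2 ℝ E E).symm : E × E →L[ℝ] WithLp 2 (E × E)) ∘L
      ContinuousLinearMap.inl ℝ E E
  let i₂ : E →L[ℝ] WithLp 2 (E × E) :=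
    ((WithLp.prodContinuousLinearEquiv 2 ℝ E E).symm : E × E →L[ℝ] WithLp 2 (E × E)) ∘L
      ContinuousLinearMap.inr ℝ E E
  let A₁ : E →L[ℝ] E := WithLp.fstL 2 ℝ E E ∘L A ∘L i₁
  let A₂ : E →L[ℝ] E := WithLp.sndL 2 ℝ E E ∘L A ∘L i₂
  have expand₁ : ∀ {η : ℝ}, 0 < η → ∀ᶠ h in 𝓝 (0 : E),
      |U (v.fst + h) - U v.fst - ⟪qU v.fst, h⟫ - ⟪A₁ h, h⟫ / 2| ≤ η * ‖h‖ ^ 2 := by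
    intro η hη
    have lim : Tendsto i₁ (𝓝 0) (𝓝 0) := by simpa using i₁.continuous.tendsto 0
    filter_upwards [lim.eventually (expand hη)] with h hh
    rw [normsq, WithLp.prod_inner_apply, WithLp.prod_inner_apply] at hh
    change |U (v.fst + h) + V (v.snd + 0) - (U v.fst + V v.snd) - (⟪qU v.fst, h⟫ +
      ⟪qV v.snd, (0 : E)⟫) - (⟪A₁ h, h⟫ + ⟪_, (0 : E)⟫) / 2| ≤ η * (‖h‖ ^ 2 + ‖(0 : E)‖ ^ 2) at hh
    rw [inner_zero_right, inner_zero_right, norm_zero] at hh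
    convert hh using 2 <;> simp
  have expand₂ : ∀ {η : ℝ}, 0 < η → ∀ᶠ h in 𝓝 (0 : E),
      |V (v.snd + h) - V v.snd - ⟪qV v.snd, h⟫ - ⟪A₂ h, h⟫ / 2| ≤ η * ‖h‖ ^ 2 := by
    intro η hη
    have lim : Tendsto i₂ (𝓝 0) (𝓝 0) := by simpa using i₂.continuous.tendsto 0
    filter_upwards [lim.eventually (expand hη)] with h hh
    rw [normsq, WithLp.prod_inner_apply, WithLp.prod_inner_apply] at hh
    change |U (v.fst + 0) + V (v.snd + h) - (U v.fst + V v.snd) - (⟪qU v.fst, (0 : E)⟫ +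
      ⟪qV v.snd, h⟫) - (⟪_, (0 : E)⟫ + ⟪A₂ h, h⟫) / 2| ≤ η * (‖(0 : E)‖ ^ 2 + ‖h‖ ^ 2) at hh
    rw [inner_zero_right, inner_zero_right, norm_zero] at hh
    convert hh using 2 <;> simp
  have shift : ∀ (B : E →L[ℝ] E) (h : E),
      ⟪(B + (2 * ε) • ContinuousLinearMap.id ℝ E) h, h⟫ = ⟪B h, h⟫ + 2 * ε * ‖h‖ ^ 2 := by
    intro B h
    simp [inner_add_left, real_inner_smul_left]
  refine ⟨ε, v.fst, v.snd, qU v.fst, qV v.snd, A₁ + (2 * ε) • ContinuousLinearMap.id ℝ E,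
    A₂ + (2 * ε) • ContinuousLinearMap.id ℝ E, hε, hεθ, ?_, ?_, ?_, ?_, ?_⟩
  · rw [← normsq]
    linarith [hsup v]
  · have h1 : 0 ≤ ε / 2 * ‖v‖ ^ 2 := by positivity
    have h2 : 0 < U v.fst + V v.snd - g (v.fst - v.snd) := by
      change 0 < w v
      linarith
    linarith
  · filter_upwards [expand₁ hε] with h hh
    rw [shift]
    linarith [(abs_le.1 hh).2]
  · filter_upwards [expand₂ hε] with h hh
    rw [shift]
    linarith [(abs_le.1 hh).2]
  · intro B b hB h k
    rw [shift, shift]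
    suffices hs : ∀ η : ℝ, 0 < η → ⟪A₁ h, h⟫ / 2 + ⟪A₂ k, k⟫ / 2 ≤
        B * ‖h - k‖ ^ 2 + ε * (‖h‖ ^ 2 + ‖k‖ ^ 2) + η * (‖h‖ ^ 2 + ‖k‖ ^ 2) by
      have lim : Tendsto (fun η : ℝ => B * ‖h - k‖ ^ 2 + ε * (‖h‖ ^ 2 + ‖k‖ ^ 2) +
          η * (‖h‖ ^ 2 + ‖k‖ ^ 2)) (𝓝[>] 0) (𝓝 (B * ‖h - k‖ ^ 2 + ε * (‖h‖ ^ 2 + ‖k‖ ^ 2) +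
          0 * (‖h‖ ^ 2 + ‖k‖ ^ 2))) :=
        (Continuous.tendsto (by fun_prop) 0).mono_left nhdsWithin_le_nhds
      have := ge_of_tendsto lim (by filter_upwards [self_mem_nhdsWithin] with η hη using hs η hη)
      linarith
    intro η hη
    have scale : ∀ z : E, Tendsto (fun t : ℝ => t • z) (𝓝 0) (𝓝 0) := by
      intro z
      have : Continuous fun t : ℝ => t • z := by fun_prop
      simpa using this.tendsto 0
    have ev : ∀ᶠ t in 𝓝 (0 : ℝ),
        t * (⟪qU v.fst, h⟫ + ⟪qV v.snd, k⟫ - ⟪b, h - k⟫ - 2 * ε * (⟪v.fst, h⟫ + ⟪v.snd, k⟫)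
          - (⟪p.fst, h⟫ + ⟪p.snd, k⟫)) +
        t ^ 2 * (⟪A₁ h, h⟫ / 2 + ⟪A₂ k, k⟫ / 2 - (B * ‖h - k‖ ^ 2 + ε * (‖h‖ ^ 2 + ‖k‖ ^ 2) +
          η * (‖h‖ ^ 2 + ‖k‖ ^ 2))) ≤ 0 := by
      filter_upwards [(scale h).eventually (expand₁ hη), (scale k).eventually (expand₂ hη)]
        with t h1 h2
      have h3 := hmax (v + WithLp.toLp 2 (t • h, t • k))
      have h4 := hB (t • (h - k))
      have h5 := (abs_le.1 h1).1
      have h6 := (abs_le.1 h2).1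
      rw [inner_add_right, WithLp.prod_inner_apply p (WithLp.toLp 2 (t • h, t • k)), norm_add_sq_real,
        WithLp.prod_inner_apply v, normsq (WithLp.toLp 2 (t • h, t • k))] at h3
      change U (v.fst + t • h) + V (v.snd + t • k) - g (v.fst + t • h - (v.snd + t • k)) -
        ε * (_ + 2 * (⟪v.fst, t • h⟫ + ⟪v.snd, t • k⟫) + (‖t • h‖ ^ 2 + ‖t • k‖ ^ 2)) -
        (_ + (⟪p.fst, t • h⟫ + ⟪p.snd, t • k⟫)) ≤ U v.fst + V v.snd - g (v.fst - v.snd) - _ - _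
        at h3
      rw [show v.fst + t • h - (v.snd + t • k) = v.fst - v.snd + t • (h - k) by
        rw [smul_sub]; abel] at h3
      simp only [map_smul, real_inner_smul_left, real_inner_smul_right, norm_smul, mul_pow,
        Real.norm_eq_abs, sq_abs] at h3 h4 h5 h6
      nlinarith
    have ev' := (continuous_neg.tendsto' (0 : ℝ) 0 neg_zero).eventually ev
    have hne : ∀ᶠ t in 𝓝[>] (0 : ℝ), 0 < t := self_mem_nhdsWithin
    obtain ⟨t, ⟨h1, h2⟩, h3⟩ := (((ev.and ev').filter_mono nhdsWithin_le_nhds).and hne).exists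
    by_contra hcon
    push Not at hcon
    have := mul_pos (pow_pos h3 2) (sub_pos.2 hcon)
    rw [neg_sq] at h2
    linarith

end Sums

lemma rpow_add_le_tangent {s t a : ℝ} (hs : 0 < s) (ht : 0 ≤ s + t) (ha : 0 ≤ a) (ha1 : a ≤ 1) :
    (s + t) ^ a ≤ s ^ a + a * s ^ (a - 1) * t := by
  have h1 : -1 ≤ t / s := by rw [le_div_iff₀ hs]; linarith
  have h2 := rpow_one_add_le_one_add_mul_self h1 ha ha1
  have h3 : s + t = s * (1 + t / s) := by field_simp
  rw [h3, Real.mul_rpow hs.le (by linarith), Real.rpow_sub_one hs.ne']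
  calc s ^ a * (1 + t / s) ^ a ≤ s ^ a * (1 + a * (t / s)) := by gcongr
    _ = _ := by ring

lemma rpow_norm_sq_semiconcave {E : Type*} [NormedAddCommGroup E] [InnerProductSpace ℝ E]
    {κ a : ℝ} (hκ : 0 < κ) (ha : 0 ≤ a) (ha1 : a ≤ 1) (v h : E) :
    (κ + ‖v + h‖ ^ 2) ^ a ≤ (κ + ‖v‖ ^ 2) ^ a +
      ⟪(2 * (a * (κ + ‖v‖ ^ 2) ^ (a - 1))) • v, h⟫ +
        a * (κ + ‖v‖ ^ 2) ^ (a - 1) * ‖h‖ ^ 2 := by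
  have h1 : κ + ‖v + h‖ ^ 2 = (κ + ‖v‖ ^ 2) + (2 * ⟪v, h⟫ + ‖h‖ ^ 2) := by
    rw [norm_add_sq_real]; ring
  have h2 := rpow_add_le_tangent (s := κ + ‖v‖ ^ 2) (t := 2 * ⟪v, h⟫ + ‖h‖ ^ 2) (by positivity)
    (by rw [← h1]; positivity) ha ha1
  rw [h1, real_inner_smul_left]
  linarith

section Quadratic

variable {n : ℕ}

local notation "ℝⁿ" => EuclideanSpace ℝ (Fin n)

/-- The symmetric matrix of the quadratic form `h ↦ ⟪A h, h⟫`. -/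
noncomputable def quadraticFormMatrix (A : ℝⁿ →L[ℝ] ℝⁿ) : Matrix (Fin n) (Fin n) ℝ :=
  fun i j => (⟪A (EuclideanSpace.single i 1), EuclideanSpace.single j 1⟫ +
    ⟪A (EuclideanSpace.single j 1), EuclideanSpace.single i 1⟫) / 2

lemma quadraticFormMatrix_isSymm (A : ℝⁿ →L[ℝ] ℝⁿ) : (quadraticFormMatrix A).IsSymm := by
  ext i j
  simp only [Matrix.transpose_apply, quadraticFormMatrix]
  ring

lemma quadraticFormMatrix_neg (A : ℝⁿ →L[ℝ] ℝⁿ) :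
    quadraticFormMatrix (-A) = -quadraticFormMatrix A := by
  ext i j
  simp only [quadraticFormMatrix, _root_.neg_apply, inner_neg_left, Matrix.neg_apply]
  ring

lemma dotProduct_quadraticFormMatrix (A : ℝⁿ →L[ℝ] ℝⁿ) (h : Fin n → ℝ) :
    h ⬝ᵥ quadraticFormMatrix A *ᵥ h = ⟪A (WithLp.toLp 2 h), WithLp.toLp 2 h⟫ := by
  have hsum : (WithLp.toLp 2 h : ℝⁿ) = ∑ i, h i • EuclideanSpace.single i (1 : ℝ) := by
    ext j
    simp [Finset.sum_apply, Pi.single_apply]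
  have h1 : ⟪A (WithLp.toLp 2 h), WithLp.toLp 2 h⟫ = ∑ i, ∑ j, h i * h j *
      ⟪A (EuclideanSpace.single i 1), EuclideanSpace.single j 1⟫ := by
    rw [hsum, map_sum, sum_inner]
    refine Finset.sum_congr rfl fun i _ => ?_
    rw [inner_sum]
    refine Finset.sum_congr rfl fun j _ => ?_
    rw [map_smul, real_inner_smul_left, real_inner_smul_right]
    ring
  have h2 : h ⬝ᵥ quadraticFormMatrix A *ᵥ h = ((∑ i, ∑ j, h i * h j *
      ⟪A (EuclideanSpace.single i 1), EuclideanSpace.single j 1⟫) +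
      ∑ i, ∑ j, h i * h j *
      ⟪A (EuclideanSpace.single j 1), EuclideanSpace.single i 1⟫) / 2 := by
    simp only [dotProduct, mulVec, quadraticFormMatrix, Finset.mul_sum, ← Finset.sum_add_distrib,
      Finset.sum_div]
    refine Finset.sum_congr rfl fun i _ => Finset.sum_congr rfl fun j _ => ?_
    ring
  have h3 : ∑ i, ∑ j, h i * h j *
      ⟪A (EuclideanSpace.single j 1), EuclideanSpace.single i 1⟫ = ∑ i, ∑ j, h i * h j *
      ⟪A (EuclideanSpace.single i 1), EuclideanSpace.single j 1⟫ := by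
    rw [Finset.sum_comm]
    refine Finset.sum_congr rfl fun i _ => Finset.sum_congr rfl fun j _ => ?_
    ring
  rw [h2, h3, h1]
  ring

lemma contDiff_quadratic (q z : ℝⁿ) (A : ℝⁿ →L[ℝ] ℝⁿ) :
    ContDiff ℝ 2 fun y : ℝⁿ => ⟪q, y - z⟫ + ⟪A (y - z), y - z⟫ / 2 := by
  have h1 : ContDiff ℝ 2 fun y : ℝⁿ => y - z := contDiff_id.sub contDiff_const
  exact (contDiff_const.inner ℝ h1).add (((A.contDiff.comp h1).inner ℝ h1).div_const 2)

lemma hessianMatrix_quadratic (q z : ℝⁿ) (A : ℝⁿ →L[ℝ] ℝⁿ) :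
    hessianMatrix (fun y : ℝⁿ => ⟪q, y - z⟫ + ⟪A (y - z), y - z⟫ / 2) z
      = quadraticFormMatrix A := by
  have grad : ∀ y e : ℝⁿ, fderiv ℝ (fun y : ℝⁿ => ⟪q, y - z⟫ + ⟪A (y - z), y - z⟫ / 2) y e
      = ⟪q, e⟫ + (⟪A (y - z), e⟫ + ⟪A e, y - z⟫) / 2 := by
    intro y e
    have h1 : HasFDerivAt (fun y : ℝⁿ => y - z) (ContinuousLinearMap.id ℝ ℝⁿ) y :=
      (hasFDerivAt_id y).sub_const z
    have h2 := ((hasFDerivAt_const q y).inner ℝ h1).add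
      (((A.hasFDerivAt.comp y h1).inner ℝ h1).mul_const (1 / 2 : ℝ))
    have h3 : HasFDerivAt (fun y : ℝⁿ => ⟪q, y - z⟫ + ⟪A (y - z), y - z⟫ / 2) _ y :=
      h2.congr_of_eventuallyEq (Eventually.of_forall fun y => by
        simp [div_eq_mul_inv])
    rw [h3.fderiv]
    simp
    ring
  ext i j
  simp only [hessianMatrix, grad, quadraticFormMatrix]
  set e : ℝⁿ := EuclideanSpace.single j 1
  set d : ℝⁿ := EuclideanSpace.single i 1
  have h1 : HasFDerivAt (fun y : ℝⁿ => y - z) (ContinuousLinearMap.id ℝ ℝⁿ) z :=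
    (hasFDerivAt_id z).sub_const z
  have h2 := (((A.hasFDerivAt.comp z h1).inner ℝ (hasFDerivAt_const e z)).add
    ((hasFDerivAt_const (A e) z).inner ℝ h1)).mul_const (1 / 2 : ℝ)
  have h3 : HasFDerivAt (fun y : ℝⁿ => ⟪q, e⟫ + (⟪A (y - z), e⟫ + ⟪A e, y - z⟫) / 2) _ z :=
    (h2.const_add ⟪q, e⟫).congr_of_eventuallyEq (Eventually.of_forall fun y => by
        simp [div_eq_mul_inv])
  rw [h3.fderiv]
  simp
  ring

/-- Degenerate ellipticity estimate for a pair of quadratic forms controlled by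
`b * |h - k|² + e * (|h|² + |k|²)`. -/
lemma elliptic_sub_le {m : ℕ} {lam Lam : ℝ} (hlam : 0 < lam)
    {G : Matrix (Fin m) (Fin m) ℝ → ℝ}
    (hG : ∀ A B : Matrix (Fin m) (Fin m) ℝ, A.IsSymm → B.IsSymm → (A - B).PosSemidef →
      lam * (A - B).trace ≤ G A - G B ∧ G A - G B ≤ Lam * (A - B).trace)
    {S T : Matrix (Fin m) (Fin n) ℝ} {X Y : Matrix (Fin n) (Fin n) ℝ} (hX : X.IsSymm)
    (hY : Y.IsSymm) {b e : ℝ} (hb : 0 ≤ b) (he : 0 ≤ e)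
    (h : ∀ h k : Fin n → ℝ, h ⬝ᵥ X *ᵥ h + k ⬝ᵥ Y *ᵥ k ≤
      b * ((h - k) ⬝ᵥ (h - k)) + e * (h ⬝ᵥ h + k ⬝ᵥ k)) :
    G (S * X * Sᵀ) - G (T * (-Y) * Tᵀ) ≤
      Lam * (b * ((S - T) * (S - T)ᵀ).trace + e * ((S * Sᵀ).trace + (T * Tᵀ).trace)) := by
  have symm : ∀ (R : Matrix (Fin m) (Fin n) ℝ) {Z : Matrix (Fin n) (Fin n) ℝ}, Z.IsSymm →
      (R * Z * Rᵀ).IsSymm := by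
    intro R Z hZ
    rw [Matrix.IsSymm, transpose_mul, transpose_mul, transpose_transpose, hZ.eq, Matrix.mul_assoc]
  have gram : ∀ R : Matrix (Fin m) (Fin n) ℝ, (R * Rᵀ).PosSemidef := fun R => by
    simpa using posSemidef_self_mul_conjTranspose R
  have form : ∀ (R : Matrix (Fin m) (Fin n) ℝ) (Z : Matrix (Fin n) (Fin n) ℝ) (ξ : Fin m → ℝ),
      ξ ⬝ᵥ (R * Z * Rᵀ) *ᵥ ξ = (Rᵀ *ᵥ ξ) ⬝ᵥ Z *ᵥ (Rᵀ *ᵥ ξ) := by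
    intro R Z ξ
    rw [← mulVec_mulVec, ← mulVec_mulVec, dotProduct_mulVec, ← mulVec_transpose]
  have form' : ∀ (R : Matrix (Fin m) (Fin n) ℝ) (ξ : Fin m → ℝ),
      ξ ⬝ᵥ (R * Rᵀ) *ᵥ ξ = (Rᵀ *ᵥ ξ) ⬝ᵥ (Rᵀ *ᵥ ξ) := by
    intro R ξ
    have := form R 1 ξ
    rwa [Matrix.mul_one, one_mulVec] at this
  set D : Matrix (Fin m) (Fin m) ℝ :=
    b • ((S - T) * (S - T)ᵀ) + e • (S * Sᵀ + T * Tᵀ) with hD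
  have hDpos : D.PosSemidef :=
    ((gram _).smul hb).add (((gram S).add (gram T)).smul he)
  have hDsymm : D.IsSymm := by simpa using hDpos.isHermitian
  have hTsymm := symm T hY.neg
  have h1 := (hG (T * (-Y) * Tᵀ + D) (T * (-Y) * Tᵀ) (hTsymm.add hDsymm) hTsymm
    (by rwa [add_sub_cancel_left])).2
  rw [add_sub_cancel_left] at h1
  have hpos : (T * (-Y) * Tᵀ + D - S * X * Sᵀ).PosSemidef := by
    refine PosSemidef.of_dotProduct_mulVec_nonneg ?_ fun ξ => ?_
    · have := (hTsymm.add hDsymm).sub (symm S hX)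
      rwa [Matrix.IsHermitian, conjTranspose_eq_transpose_of_trivial]
    · have h2 := h (Sᵀ *ᵥ ξ) (Tᵀ *ᵥ ξ)
      rw [star_trivial, sub_mulVec, add_mulVec, dotProduct_sub, dotProduct_add, form, form, hD,
        add_mulVec, smul_mulVec, smul_mulVec, add_mulVec, dotProduct_add, dotProduct_smul,
        dotProduct_smul, dotProduct_add, form', form', form', transpose_sub, sub_mulVec,
        neg_mulVec, dotProduct_neg, smul_eq_mul, smul_eq_mul]
      linarith
  have h2 := (hG _ _ (hTsymm.add hDsymm) (symm S hX) hpos).1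
  have h3 : 0 ≤ lam * (T * (-Y) * Tᵀ + D - S * X * Sᵀ).trace :=
    mul_nonneg hlam.le hpos.trace_nonneg
  have h4 : D.trace = b * ((S - T) * (S - T)ᵀ).trace + e * ((S * Sᵀ).trace + (T * Tᵀ).trace) := by
    rw [hD, trace_add, trace_smul, trace_smul, trace_add, smul_eq_mul, smul_eq_mul]
  rw [← h4]
  linarith

lemma trace_mul_transpose_self {m : ℕ} (R : Matrix (Fin m) (Fin n) ℝ) :
    (R * Rᵀ).trace = ∑ i, ∑ j, R i j ^ 2 := by
  simp [Matrix.trace, Matrix.mul_apply, sq]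

/-- Linear growth and Lipschitz bounds for the traces attached to a Lipschitz matrix field. -/
lemma exists_trace_bound {m : ℕ} {σ : ℝⁿ → Matrix (Fin m) (Fin n) ℝ}
    (hσ : ∃ K : ℝ, 0 ≤ K ∧ ∀ x y : ℝⁿ, ∀ i j, |σ x i j - σ y i j| ≤ K * ‖x - y‖) :
    ∃ T : ℝ, 0 ≤ T ∧ (∀ x, (σ x * (σ x)ᵀ).trace ≤ T * (1 + ‖x‖ ^ 2)) ∧
      ∀ x y, ((σ x - σ y) * (σ x - σ y)ᵀ).trace ≤ T * ‖x - y‖ ^ 2 := by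
  obtain ⟨K, hK, hσ⟩ := hσ
  have sq_le : ∀ x y i j, (σ x i j - σ y i j) ^ 2 ≤ K ^ 2 * ‖x - y‖ ^ 2 := by
    intro x y i j
    rw [← mul_pow, ← sq_abs]
    exact pow_le_pow_left₀ (abs_nonneg _) (hσ x y i j) 2
  refine ⟨∑ i, ∑ j, (2 * σ 0 i j ^ 2 + 2 * K ^ 2), by positivity, fun x => ?_, fun x y => ?_⟩
  · rw [trace_mul_transpose_self]
    simp only [Finset.sum_mul]
    refine Finset.sum_le_sum fun i _ => Finset.sum_le_sum fun j _ => ?_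
    have h1 := sq_le x 0 i j
    rw [sub_zero] at h1
    nlinarith [sq_nonneg (σ x i j - 2 * σ 0 i j), sq_nonneg K,
      mul_nonneg (sq_nonneg (σ 0 i j)) (sq_nonneg ‖x‖)]
  · rw [trace_mul_transpose_self]
    simp only [Finset.sum_mul]
    refine Finset.sum_le_sum fun i _ => Finset.sum_le_sum fun j _ => ?_
    have h1 := sq_le x y i j
    rw [Matrix.sub_apply]
    nlinarith [mul_nonneg (sq_nonneg (σ 0 i j)) (sq_nonneg ‖x - y‖), sq_nonneg (K * ‖x - y‖)]

end Quadratic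

section Viscosity

variable {n : ℕ}

local notation "ℝⁿ" => EuclideanSpace ℝ (Fin n)

lemma IsViscositySubsolution.le_of_expansion {F : Matrix (Fin n) (Fin n) ℝ → ℝⁿ → ℝ}
    {c f u : ℝⁿ → ℝ} (hu : IsViscositySubsolution F c f u) {z q : ℝⁿ} {A : ℝⁿ →L[ℝ] ℝⁿ}
    (h : ∀ᶠ h in 𝓝 (0 : ℝⁿ), u (z + h) ≤ u z + ⟪q, h⟫ + ⟪A h, h⟫ / 2) :
    f z ≤ F (quadraticFormMatrix A) z - c z * u z := by
  rw [← hessianMatrix_quadratic q z A]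
  refine hu _ (contDiff_quadratic q z A) z ?_
  have lim : Tendsto (fun y => y - z) (𝓝 z) (𝓝 0) := by
    simpa using (continuous_sub_right z).tendsto z
  filter_upwards [lim.eventually h] with y hy
  rw [add_sub_cancel] at hy
  simp only [sub_self, inner_zero_right, zero_div, add_zero, sub_zero]
  linarith

lemma IsViscositySupersolution.le_of_expansion {F : Matrix (Fin n) (Fin n) ℝ → ℝⁿ → ℝ}
    {c f u : ℝⁿ → ℝ} (hu : IsViscositySupersolution F c f u) {z q : ℝⁿ} {A : ℝⁿ →L[ℝ] ℝⁿ}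
    (h : ∀ᶠ h in 𝓝 (0 : ℝⁿ), -u (z + h) ≤ -u z + ⟪q, h⟫ + ⟪A h, h⟫ / 2) :
    F (-quadraticFormMatrix A) z - c z * u z ≤ f z := by
  rw [← quadraticFormMatrix_neg, ← hessianMatrix_quadratic (-q) z (-A)]
  refine hu _ (contDiff_quadratic (-q) z (-A)) z ?_
  have lim : Tendsto (fun y => y - z) (𝓝 z) (𝓝 0) := by
    simpa using (continuous_sub_right z).tendsto z
  filter_upwards [lim.eventually h] with y hy
  rw [add_sub_cancel] at hy
  simp only [sub_self, inner_zero_right, zero_div, add_zero, sub_zero, inner_neg_left,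
    _root_.neg_apply]
  linarith

lemma norm_sub_sq_le_of_close {x y z w : ℝⁿ} {κ : ℝ} (hx : ‖x - z‖ ^ 2 ≤ κ / 4)
    (hy : ‖y - w‖ ^ 2 ≤ κ / 4) : ‖z - w‖ ^ 2 ≤ 4 * (κ + ‖x - y‖ ^ 2) := by
  have h1 : ‖z - w‖ ≤ ‖x - y‖ + (‖x - z‖ + ‖y - w‖) := by
    have h2 : z - w = (x - y) + (-(x - z) + (y - w)) := by abel
    rw [h2]
    refine (norm_add_le _ _).trans (add_le_add le_rfl ((norm_add_le _ _).trans ?_))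
    rw [norm_neg]
  have h3 := pow_le_pow_left₀ (norm_nonneg _) h1 2
  have h4 := add_sq_le (a := ‖x - y‖) (b := ‖x - z‖ + ‖y - w‖)
  have h5 := add_sq_le (a := ‖x - z‖) (b := ‖y - w‖)
  linarith [sq_nonneg ‖x - y‖, sq_nonneg ‖x - z‖]

lemma norm_sq_le_of_close {p w : ℝⁿ} {κ : ℝ} (hκ : κ ≤ 1) (hpw : ‖p - w‖ ^ 2 ≤ κ / 4) :
    ‖w‖ ^ 2 ≤ 2 * ‖p‖ ^ 2 + 1 := by
  have h1 : ‖w‖ ≤ ‖p‖ + ‖p - w‖ := by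
    have := norm_sub_le p (p - w)
    rwa [sub_sub_cancel] at this
  have h2 := pow_le_pow_left₀ (norm_nonneg _) h1 2
  have h3 := add_sq_le (a := ‖p‖) (b := ‖p - w‖)
  linarith

/-- The regularized Hölder estimate, uniform in the regularization parameter `κ`. -/
lemma sub_le_regularized_holder {m : ℕ} {lam Lam : ℝ} (hlam : 0 < lam) (hLam : 0 < Lam)
    {σ : ℝⁿ → Matrix (Fin m) (Fin n) ℝ} {G : Matrix (Fin m) (Fin m) ℝ → ℝ}
    (hG : ∀ A B : Matrix (Fin m) (Fin m) ℝ, A.IsSymm → B.IsSymm → (A - B).PosSemidef →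
      lam * (A - B).trace ≤ G A - G B ∧ G A - G B ≤ Lam * (A - B).trace)
    {F : Matrix (Fin n) (Fin n) ℝ → ℝⁿ → ℝ} (hF : ∀ M x, F M x = G (σ x * M * (σ x)ᵀ))
    {c f u : ℝⁿ → ℝ} {L_c L_f c₀ T M α L κ : ℝ} (hLc : 0 < L_c) (hLf : 0 < L_f) (hc₀ : 0 < c₀)
    (hc : ∀ x, c₀ ≤ c x) (hα : 0 < α) (hα1 : α ≤ 1)
    (hcH : ∀ x y : ℝⁿ, ‖x - y‖ ≤ 1 → |c x - c y| ≤ L_c * ‖x - y‖ ^ α)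
    (hfH : ∀ x y : ℝⁿ, ‖x - y‖ ≤ 1 → |f x - f y| ≤ L_f * ‖x - y‖ ^ α)
    (hT : 0 ≤ T) (hT₁ : ∀ x, (σ x * (σ x)ᵀ).trace ≤ T * (1 + ‖x‖ ^ 2))
    (hT₂ : ∀ x y, ((σ x - σ y) * (σ x - σ y)ᵀ).trace ≤ T * ‖x - y‖ ^ 2)
    (huc : Continuous u) (hM : ∀ x, |u x| ≤ M) (hu : IsViscositySolution F c f u)
    (hαT : 16 * Lam * T * α ≤ c₀) (hL : 0 < L) (hLM : 4 * M ≤ L)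
    (hLc₀ : 8 * (L_f + L_c * M) ≤ c₀ * L) (hκ : 0 < κ) (hκ1 : κ ≤ 1) (x₀ y₀ : ℝⁿ) :
    u x₀ - u y₀ ≤ L * (κ + ‖x₀ - y₀‖ ^ 2) ^ (α / 2) := by
  by_contra! hcon
  have hM0 : 0 ≤ M := (abs_nonneg _).trans (hM 0)
  obtain ⟨a, rfl⟩ : ∃ a, α = 2 * a := ⟨α / 2, by ring⟩
  rw [mul_div_cancel_left₀ a two_ne_zero] at hcon
  have ha : 0 < a := by linarith
  have ha1 : a ≤ 1 := by linarith
  obtain ⟨τ, hτ, hτM⟩ : ∃ τ : ℝ, 0 < τ ∧ 8 * M ≤ τ * κ := by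
    refine ⟨8 * M / κ + 1, by positivity, ?_⟩
    have : (8 * M / κ + 1) * κ = 8 * M + κ := by field_simp
    linarith
  obtain ⟨U, z, hUc, hUu, hUz, hUle, hUd, hUs⟩ := exists_supConvolution huc hM hτ
  obtain ⟨V, z', hVc, hVu, hVz, hVle, hVd, hVs⟩ := exists_supConvolution (u := fun x => -u x)
    huc.neg (M := M) (by simpa using hM) hτ
  have hU_le : ∀ x, U x ≤ u (z x) := fun x => by
    rw [hUz]; linarith [mul_nonneg hτ.le (sq_nonneg ‖x - z x‖)]
  have hV_le : ∀ x, V x ≤ -u (z' x) := fun x => by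
    rw [hVz]; linarith [mul_nonneg hτ.le (sq_nonneg ‖x - z' x‖)]
  have close : ∀ {d : ℝ}, τ * d ^ 2 ≤ 2 * M → d ^ 2 ≤ κ / 4 := by
    intro d hd
    have : τ * d ^ 2 ≤ τ * (κ / 4) := by linarith
    exact le_of_mul_le_mul_left this hτ
  have hκpow : ∀ s : ℝ, 0 ≤ s → (κ + s) ^ (a - 1) ≤ κ ^ (a - 1) := fun s hs =>
    Real.rpow_le_rpow_of_nonpos hκ (by linarith) (by linarith)
  have semi : ∀ v h : ℝⁿ, L * (κ + ‖v + h‖ ^ 2) ^ a ≤ L * (κ + ‖v‖ ^ 2) ^ a +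
      ⟪(L * (2 * (a * (κ + ‖v‖ ^ 2) ^ (a - 1)))) • v, h⟫ +
        L * (a * (κ + ‖v‖ ^ 2) ^ (a - 1)) * ‖h‖ ^ 2 := by
    intro v h
    have h1 := mul_le_mul_of_nonneg_left (rpow_norm_sq_semiconcave hκ ha.le ha1 v h) hL.le
    rw [real_inner_smul_left] at h1 ⊢
    linarith
  have hκa : 0 < κ ^ a := Real.rpow_pos_of_pos hκ a
  obtain ⟨θ, hθ, hθs⟩ : ∃ θ : ℝ, 0 < θ ∧ 48 * Lam * T * θ < c₀ * L * κ ^ a := by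
    refine ⟨c₀ * L * κ ^ a / (48 * Lam * T + 1), by positivity, ?_⟩
    rw [mul_div_assoc', div_lt_iff₀ (by positivity)]
    have : 0 < c₀ * L * κ ^ a := by positivity
    linarith
  obtain ⟨ε, x, y, q₁, q₂, X, Y, hε, hεθ, hεxy, hpos, hX, hY, hXY⟩ :=
    theorem_on_sums_s0 (U := U) (V := V) (g := fun v => L * (κ + ‖v‖ ^ 2) ^ a)
      (l := fun v => (L * (2 * (a * (κ + ‖v‖ ^ 2) ^ (a - 1)))) • v)
      (C := τ + L * (a * κ ^ (a - 1))) (M := M + M) (by positivity) hUc hVc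
      (by
        have : Continuous fun v : ℝⁿ => κ + ‖v‖ ^ 2 := by fun_prop
        exact continuous_const.mul (this.rpow_const fun v => Or.inr ha.le))
      (fun v => by positivity)
      (fun v h => by
        refine le_trans ?_ (hUs v h)
        have : 0 ≤ L * (a * κ ^ (a - 1)) * ‖h‖ ^ 2 := by positivity
        linarith)
      (fun v h => by
        refine le_trans ?_ (hVs v h)
        have : 0 ≤ L * (a * κ ^ (a - 1)) * ‖h‖ ^ 2 := by positivity
        linarith)
      (fun v h => by
        refine (semi v h).trans ?_
        have h1 : L * (a * (κ + ‖v‖ ^ 2) ^ (a - 1)) * ‖h‖ ^ 2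
            ≤ L * (a * κ ^ (a - 1)) * ‖h‖ ^ 2 := by
          have hp := hκpow (‖v‖ ^ 2) (by positivity)
          exact mul_le_mul_of_nonneg_right (mul_le_mul_of_nonneg_left
            (mul_le_mul_of_nonneg_left hp ha.le) hL.le) (by positivity)
        have h2 : 0 ≤ τ * ‖h‖ ^ 2 := by positivity
        linarith)
      (fun x y => by
        linarith [hU_le x, hV_le y, (abs_le.1 (hM (z x))).2, (abs_le.1 (hM (z' y))).1])
      (x₀ := x₀) (y₀ := y₀)
      (by
        have := hUu x₀
        have := hVu y₀
        linarith) hθ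
  have quad := hXY _ _ (semi (x - y))
  set s := κ + ‖x - y‖ ^ 2 with hs
  have hspos : 0 < s := by positivity
  set ρ := s ^ a with hρ
  have hρpos : 0 < ρ := Real.rpow_pos_of_pos hspos a
  have hsa : s ^ (a - 1) * s = ρ := by rw [Real.rpow_sub_one hspos.ne']; field_simp; rfl
  have hsub : f (z x) ≤ F (quadraticFormMatrix X) (z x) - c (z x) * u (z x) := by
    refine hu.1.le_of_expansion (q := q₁) ?_
    filter_upwards [hX] with h hh
    have h1 := hUle (x + h) (z x + h)
    rw [add_sub_add_right_eq_sub] at h1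
    linarith [hUz x]
  have hsuper : F (-quadraticFormMatrix Y) (z' y) - c (z' y) * u (z' y) ≤ f (z' y) := by
    refine hu.2.le_of_expansion (q := q₂) ?_
    filter_upwards [hY] with h hh
    have h1 := hVle (y + h) (z' y + h)
    rw [add_sub_add_right_eq_sub] at h1
    linarith [hVz y]
  rw [hF] at hsub hsuper
  have hell := elliptic_sub_le hlam hG (S := σ (z x)) (T := σ (z' y))
    (quadraticFormMatrix_isSymm X) (quadraticFormMatrix_isSymm Y)
    (b := 2 * (L * (a * s ^ (a - 1)))) (e := 4 * ε) (by positivity) (by positivity)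
    (fun h k => by
      have dot : ∀ v : Fin n → ℝ, v ⬝ᵥ v = ‖(WithLp.toLp 2 v : ℝⁿ)‖ ^ 2 := fun v => by
        rw [EuclideanSpace.norm_sq_eq]
        simp [dotProduct, sq]
      rw [dotProduct_quadraticFormMatrix, dotProduct_quadraticFormMatrix, dot, dot, dot]
      exact quad _ _)
  have hdx := close (hUd x)
  have hdy := close (hVd y)
  have hdist : ‖z x - z' y‖ ^ 2 ≤ 4 * s := norm_sub_sq_le_of_close hdx hdy
  have hgap : L * ρ < u (z x) - u (z' y) := by
    linarith [hU_le x, hV_le y]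
  have hs4 : 4 * s ≤ 1 := by
    by_contra! hlt
    have h1 : (1 / 4 : ℝ) ^ a ≤ ρ := Real.rpow_le_rpow (by norm_num) (by linarith) ha.le
    have h2 : (1 / 4 : ℝ) ^ (1 / 2 : ℝ) ≤ (1 / 4 : ℝ) ^ a :=
      Real.rpow_le_rpow_of_exponent_ge (by norm_num) (by norm_num) (by linarith)
    have h3 : (1 / 4 : ℝ) ^ (1 / 2 : ℝ) = 1 / 2 := by
      rw [← Real.sqrt_eq_rpow, show (1 / 4 : ℝ) = (1 / 2) ^ 2 by norm_num]
      exact Real.sqrt_sq (by norm_num)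
    have h4 : L * (1 / 2) ≤ L * ρ := by
      gcongr
      linarith
    linarith [(abs_le.1 (hM (z x))).2, (abs_le.1 (hM (z' y))).1]
  have hd1 : ‖z x - z' y‖ ≤ 1 := by
    nlinarith [norm_nonneg (z x - z' y)]
  have hdα : ‖z x - z' y‖ ^ (2 * a) ≤ 2 * ρ := by
    rw [Real.rpow_mul (norm_nonneg _), Real.rpow_two]
    calc (‖z x - z' y‖ ^ 2) ^ a ≤ (4 * s) ^ a := Real.rpow_le_rpow (by positivity) hdist ha.le
      _ = 4 ^ a * ρ := Real.mul_rpow (by norm_num) hspos.le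
      _ ≤ 4 ^ (1 / 2 : ℝ) * ρ := by
        gcongr
        · norm_num
        · linarith
      _ = 2 * ρ := by
        rw [← Real.sqrt_eq_rpow, show (4 : ℝ) = 2 ^ 2 by norm_num, Real.sqrt_sq (by norm_num)]
  have hfd : f (z' y) - f (z x) ≤ L_f * (2 * ρ) := by
    have h1 := (abs_le.1 (hfH _ _ hd1)).1
    have h2 := mul_le_mul_of_nonneg_left hdα hLf.le
    linarith
  have hcd : (c (z' y) - c (z x)) * u (z' y) ≤ L_c * (2 * ρ) * M := by
    refine (le_abs_self _).trans ?_
    rw [abs_mul, abs_sub_comm]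
    have h2 := mul_le_mul_of_nonneg_left hdα hLc.le
    exact mul_le_mul ((hcH _ _ hd1).trans h2) (hM _) (abs_nonneg _) (by positivity)
  have hcu : c₀ * (L * ρ) ≤ c (z x) * (u (z x) - u (z' y)) :=
    mul_le_mul (hc _) hgap.le (by positivity) (hc₀.le.trans (hc _))
  have htr₁ : 2 * (L * (a * s ^ (a - 1))) *
      ((σ (z x) - σ (z' y)) * (σ (z x) - σ (z' y))ᵀ).trace ≤ 8 * T * a * (L * ρ) := by
    calc _ ≤ 2 * (L * (a * s ^ (a - 1))) * (T * (4 * s)) := by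
          gcongr
          exact (hT₂ _ _).trans (by gcongr)
      _ = 8 * T * a * (L * (s ^ (a - 1) * s)) := by ring
      _ = _ := by rw [hsa]
  have htr₂ : 4 * ε * ((σ (z x) * (σ (z x))ᵀ).trace + (σ (z' y) * (σ (z' y))ᵀ).trace)
      ≤ 24 * T * θ := by
    calc _ ≤ 4 * ε * (T * (1 + ‖z x‖ ^ 2) + T * (1 + ‖z' y‖ ^ 2)) := by
          gcongr
          · exact hT₁ _
          · exact hT₁ _
      _ ≤ 4 * ε * (T * (1 + (2 * ‖x‖ ^ 2 + 1)) + T * (1 + (2 * ‖y‖ ^ 2 + 1))) := by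
          gcongr
          · exact norm_sq_le_of_close hκ1 hdx
          · exact norm_sq_le_of_close hκ1 hdy
      _ = 8 * T * (2 * ε + ε * (‖x‖ ^ 2 + ‖y‖ ^ 2)) := by ring
      _ ≤ 8 * T * (2 * θ + θ) := by gcongr
      _ = _ := by ring
  have htr := mul_le_mul_of_nonneg_left (add_le_add htr₁ htr₂) hLam.le
  have hρκ : c₀ * L * κ ^ a ≤ c₀ * L * ρ := by
    gcongr
    exact Real.rpow_le_rpow hκ.le (by rw [hs]; linarith [sq_nonneg ‖x - y‖]) ha.le
  have hαρ := mul_le_mul_of_nonneg_right hαT (by positivity : 0 ≤ L * ρ)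
  have hLρ := mul_le_mul_of_nonneg_right hLc₀ hρpos.le
  linarith

end Viscosity

/-- **Theorem 1.2.**  Fix `1 ≤ m ≤ n`, `0 < λ ≤ Λ`, a Lipschitz matrix
field `σ : ℝⁿ → ℝ^{m×n}`, `P(x) = σ(x)ᵀσ(x)`, and `G` uniformly elliptic on symmetric
`m × m` matrices; set `F(M,x) = G(σ(x)·M·σ(x)ᵀ)`.  Let `c, f` be Hölder continuous with
exponents `β, β' ∈ (0,1]` and constants `L_c, L_f > 0`, with `c₀ := inf c > 0`, and
assume `limsup_{|x|→∞} (Tr P(x)/|x|² − c₀/(2Λ)) ≤ 0`.  If `u` is a bounded, uniformly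
continuous viscosity solution of `F(D²u, x) − c·u = f` on `ℝⁿ`, then there are
`α ∈ (0,1]` with `α ≤ min{β,β'}` and `L > 0` with `|u(x) − u(y)| ≤ L|x−y|^α` for all
`x, y`. -/
theorem holder_regularity_degenerate_fully_nonlinear
    (m n : ℕ) (hm : 1 ≤ m) (hmn : m ≤ n)
    (lam Lam : ℝ) (hlam : 0 < lam) (hlamLam : lam ≤ Lam)
    (σ : EuclideanSpace ℝ (Fin n) → Matrix (Fin m) (Fin n) ℝ)
    (hσ : ∃ K : ℝ, 0 ≤ K ∧ ∀ x y : EuclideanSpace ℝ (Fin n), ∀ i j,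
      |σ x i j - σ y i j| ≤ K * ‖x - y‖)
    (P : EuclideanSpace ℝ (Fin n) → Matrix (Fin n) (Fin n) ℝ)
    (hP : ∀ x, P x = (σ x)ᵀ * σ x)
    (G : Matrix (Fin m) (Fin m) ℝ → ℝ)
    (hG : ∀ A B : Matrix (Fin m) (Fin m) ℝ, A.IsSymm → B.IsSymm → (A - B).PosSemidef →
      lam * (A - B).trace ≤ G A - G B ∧ G A - G B ≤ Lam * (A - B).trace)
    (F : Matrix (Fin n) (Fin n) ℝ → EuclideanSpace ℝ (Fin n) → ℝ)
    (hF : ∀ M x, F M x = G (σ x * M * (σ x)ᵀ))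
    (c f : EuclideanSpace ℝ (Fin n) → ℝ) (hc : Continuous c) (hfc : Continuous f)
    (L_c L_f β β' : ℝ) (hLc : 0 < L_c) (hLf : 0 < L_f)
    (hβ : β ∈ Set.Ioc (0 : ℝ) 1) (hβ' : β' ∈ Set.Ioc (0 : ℝ) 1)
    (hcHolder : ∀ x y : EuclideanSpace ℝ (Fin n), |c x - c y| ≤ L_c * ‖x - y‖ ^ β)
    (hfHolder : ∀ x y : EuclideanSpace ℝ (Fin n), |f x - f y| ≤ L_f * ‖x - y‖ ^ β')
    (c₀ : ℝ) (hc₀def : c₀ = ⨅ x : EuclideanSpace ℝ (Fin n), c x) (hc₀ : 0 < c₀)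
    (hlimsup : limsup (fun x : EuclideanSpace ℝ (Fin n) =>
        (P x).trace / ‖x‖ ^ 2 - c₀ / (2 * Lam))
      (comap (fun x : EuclideanSpace ℝ (Fin n) => ‖x‖) atTop) ≤ 0)
    (u : EuclideanSpace ℝ (Fin n) → ℝ)
    (hu_cont : Continuous u) (hu_bdd : ∃ C : ℝ, ∀ x, |u x| ≤ C)
    (hu_uc : UniformContinuous u)
    (hu_visc : IsViscositySolution F c f u) :
    ∃ α L : ℝ, 0 < α ∧ α ≤ 1 ∧ α ≤ min β β' ∧ 0 < L ∧
      ∀ x y : EuclideanSpace ℝ (Fin n), |u x - u y| ≤ L * ‖x - y‖ ^ α := by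
  obtain ⟨M, hM⟩ := hu_bdd
  have hM0 : 0 ≤ M := (abs_nonneg _).trans (hM 0)
  have hLam : 0 < Lam := hlam.trans_le hlamLam
  obtain ⟨T, hT, hT₁, hT₂⟩ := exists_trace_bound hσ
  have hc_ge : ∀ x, c₀ ≤ c x := by
    have bdd : BddBelow (Set.range c) := by
      by_contra hb
      rw [hc₀def, Real.iInf_of_not_bddBelow hb] at hc₀
      exact lt_irrefl _ hc₀
    intro x
    rw [hc₀def]
    exact ciInf_le bdd x
  obtain ⟨α, hα, hαβ, hαT⟩ : ∃ α : ℝ, 0 < α ∧ α ≤ min β β' ∧ 16 * Lam * T * α ≤ c₀ := by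
    have := hβ.1
    have := hβ'.1
    refine ⟨min (min β β') (c₀ / (16 * Lam * T + 1)), by positivity, min_le_left _ _, ?_⟩
    have h1 := min_le_right (min β β') (c₀ / (16 * Lam * T + 1))
    have h2 : 0 < min (min β β') (c₀ / (16 * Lam * T + 1)) := by positivity
    rw [le_div_iff₀ (by positivity)] at h1
    linarith
  have hαβ₁ : α ≤ β := hαβ.trans (min_le_left _ _)
  have hαβ₂ : α ≤ β' := hαβ.trans (min_le_right _ _)
  have hα1 : α ≤ 1 := hαβ₁.trans hβ.2
  have lower_exponent : ∀ {b C : ℝ} {g : EuclideanSpace ℝ (Fin n) → ℝ}, 0 < C → α ≤ b →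
      (∀ x y, |g x - g y| ≤ C * ‖x - y‖ ^ b) →
      ∀ x y, ‖x - y‖ ≤ 1 → |g x - g y| ≤ C * ‖x - y‖ ^ α := by
    intro b C g hC hb hg x y hxy
    refine (hg x y).trans (mul_le_mul_of_nonneg_left ?_ hC.le)
    exact Real.rpow_le_rpow_of_exponent_ge_of_imp (norm_nonneg _) hxy hb
      (fun _ h0 => absurd h0 (hα.trans_le hb).ne')
  obtain ⟨L, hL, hLM, hLc₀⟩ : ∃ L : ℝ, 0 < L ∧ 4 * M ≤ L ∧ 8 * (L_f + L_c * M) ≤ c₀ * L := by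
    refine ⟨4 * M + 8 * (L_f + L_c * M) / c₀, by positivity, ?_, ?_⟩
    · linarith [show 0 ≤ 8 * (L_f + L_c * M) / c₀ by positivity]
    · have : c₀ * (4 * M + 8 * (L_f + L_c * M) / c₀)
          = c₀ * (4 * M) + 8 * (L_f + L_c * M) := by field_simp
      linarith [show 0 ≤ c₀ * (4 * M) by positivity]
  have one_sided : ∀ x y, u x - u y ≤ L * ‖x - y‖ ^ α := by
    intro x y
    have lim : Tendsto (fun κ : ℝ => L * (κ + ‖x - y‖ ^ 2) ^ (α / 2)) (𝓝[>] 0)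
        (𝓝 (L * (0 + ‖x - y‖ ^ 2) ^ (α / 2))) := by
      have h1 : Continuous fun κ : ℝ => κ + ‖x - y‖ ^ 2 := by fun_prop
      have h2 : Continuous fun κ : ℝ => L * (κ + ‖x - y‖ ^ 2) ^ (α / 2) :=
        continuous_const.mul (h1.rpow_const fun _ => Or.inr (by positivity))
      exact (h2.tendsto 0).mono_left nhdsWithin_le_nhds
    have h3 : (0 + ‖x - y‖ ^ 2) ^ (α / 2) = ‖x - y‖ ^ α := by
      rw [zero_add, ← Real.rpow_two, ← Real.rpow_mul (norm_nonneg _), mul_div_cancel₀ _ two_ne_zero]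
    rw [← h3]
    refine ge_of_tendsto lim ?_
    filter_upwards [Ioc_mem_nhdsGT (zero_lt_one' ℝ)] with κ hκ
    exact sub_le_regularized_holder hlam hLam hG hF hLc hLf hc₀ hc_ge hα hα1
      (lower_exponent hLc hαβ₁ hcHolder) (lower_exponent hLf hαβ₂ hfHolder) hT hT₁ hT₂ hu_cont hM
      hu_visc hαT hL hLM hLc₀ hκ.1 hκ.2 x y
  refine ⟨α, L, hα, hα1, hαβ, hL, fun x y => abs_le.2 ⟨?_, one_sided x y⟩⟩
  have := one_sided y x
  rw [norm_sub_rev] at this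
  linarith
end

section
/- (Crandall–Ishii–Lions theorem on sums.) Let Ω ⊆ ℝⁿ be open, u upper semicontinuous on the closure of Ω, v lower semicontinuous on the closure of Ω, and φ a C² function on an open set W containing Ω×Ω. Suppose there exists (x̂,ŷ) ∈ Ω×Ω such that u(x̂) − v(ŷ) − φ(x̂,ŷ) = max over (x,y) ∈ (closure of Ω)×(closure of Ω) of ( u(x) − v(y) − φ(x,y) ). Then for every μ > 0 there exist symmetric n×n matrices A and B such that (D_xφ(x̂,ŷ), A) belongs to the closure of the second-order superjet of u at x̂, (−D_yφ(x̂,ŷ), B) belongs to the closure of the second-order subjet of v at ŷ, and, in the Loewner order on symmetric 2n×2n matrices, −(μ + ‖D²φ(x̂,ŷ)‖)·I₂ₙ ≤ [[A,0],[0,−B]] ≤ D²φ(x̂,ŷ) + (1/μ)(D²φ(x̂,ŷ))², where ‖M‖ denotes the maximum absolute value of the eigenvalues of M. -/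
open Matrix Filter Topology

/-- The second-order superjet `J^{2,+}u(x)` of `u : Ω → ℝ` at `x`: pairs `(p, X)` of a
vector and a symmetric matrix with
`u(y) ≤ u(x) + ⟨p, y−x⟩ + ½⟨X(y−x), y−x⟩ + o(|y−x|²)` as `y → x` in `Ω`. -/
def secondOrderSuperjet {n : ℕ} (Ω : Set (EuclideanSpace ℝ (Fin n)))
    (u : EuclideanSpace ℝ (Fin n) → ℝ) (x : EuclideanSpace ℝ (Fin n)) :
    Set ((Fin n → ℝ) × Matrix (Fin n) (Fin n) ℝ) :=
  {pX | pX.2.IsSymm ∧ ∀ ε > (0 : ℝ), ∃ δ > (0 : ℝ), ∀ y ∈ Ω, ‖y - x‖ < δ →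
    u y ≤ u x + (∑ i, pX.1 i * (y - x) i) +
      (1 / 2) * (pX.2.mulVec (y - x) ⬝ᵥ (y - x)) + ε * ‖y - x‖ ^ 2}

/-- The second-order subjet `J^{2,−}u(x)`, defined with the reverse inequality. -/
def secondOrderSubjet {n : ℕ} (Ω : Set (EuclideanSpace ℝ (Fin n)))
    (u : EuclideanSpace ℝ (Fin n) → ℝ) (x : EuclideanSpace ℝ (Fin n)) :
    Set ((Fin n → ℝ) × Matrix (Fin n) (Fin n) ℝ) :=
  {pX | pX.2.IsSymm ∧ ∀ ε > (0 : ℝ), ∃ δ > (0 : ℝ), ∀ y ∈ Ω, ‖y - x‖ < δ →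
    u x + (∑ i, pX.1 i * (y - x) i) +
      (1 / 2) * (pX.2.mulVec (y - x) ⬝ᵥ (y - x)) - ε * ‖y - x‖ ^ 2 ≤ u y}

/-- The closure `J̄^{2,+}u(x)`: pairs `(p, X)` which are limits of `(p_k, X_k) ∈
J^{2,+}u(x_k)` along sequences `x_k → x` in `Ω` with `u(x_k) → u(x)`. -/
def closureSuperjet {n : ℕ} (Ω : Set (EuclideanSpace ℝ (Fin n)))
    (u : EuclideanSpace ℝ (Fin n) → ℝ) (x : EuclideanSpace ℝ (Fin n)) :
    Set ((Fin n → ℝ) × Matrix (Fin n) (Fin n) ℝ) :=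
  {pX | ∃ (xk : ℕ → EuclideanSpace ℝ (Fin n)) (pk : ℕ → Fin n → ℝ)
      (Xk : ℕ → Matrix (Fin n) (Fin n) ℝ),
    (∀ k, xk k ∈ Ω) ∧ (∀ k, (pk k, Xk k) ∈ secondOrderSuperjet Ω u (xk k)) ∧
    Tendsto xk atTop (𝓝 x) ∧ Tendsto (fun k => u (xk k)) atTop (𝓝 (u x)) ∧
    Tendsto pk atTop (𝓝 pX.1) ∧ Tendsto Xk atTop (𝓝 pX.2)}

/-- The closure `J̄^{2,−}u(x)`, defined analogously. -/
def closureSubjet {n : ℕ} (Ω : Set (EuclideanSpace ℝ (Fin n)))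
    (u : EuclideanSpace ℝ (Fin n) → ℝ) (x : EuclideanSpace ℝ (Fin n)) :
    Set ((Fin n → ℝ) × Matrix (Fin n) (Fin n) ℝ) :=
  {pX | ∃ (xk : ℕ → EuclideanSpace ℝ (Fin n)) (pk : ℕ → Fin n → ℝ)
      (Xk : ℕ → Matrix (Fin n) (Fin n) ℝ),
    (∀ k, xk k ∈ Ω) ∧ (∀ k, (pk k, Xk k) ∈ secondOrderSubjet Ω u (xk k)) ∧
    Tendsto xk atTop (𝓝 x) ∧ Tendsto (fun k => u (xk k)) atTop (𝓝 (u x)) ∧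
    Tendsto pk atTop (𝓝 pX.1) ∧ Tendsto Xk atTop (𝓝 pX.2)}

/-- The basis vectors of `ℝⁿ × ℝⁿ` indexed by `Fin n ⊕ Fin n`. -/
noncomputable def prodBasis {n : ℕ} :
    Fin n ⊕ Fin n → EuclideanSpace ℝ (Fin n) × EuclideanSpace ℝ (Fin n) :=
  Sum.elim (fun i => (EuclideanSpace.single i 1, 0)) (fun j => (0, EuclideanSpace.single j 1))

/-- The gradient in the `x`-variable, `D_xφ(x,y)`, as a vector of `ℝⁿ`. -/
noncomputable def gradFst {n : ℕ}
    (φ : EuclideanSpace ℝ (Fin n) × EuclideanSpace ℝ (Fin n) → ℝ)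
    (z : EuclideanSpace ℝ (Fin n) × EuclideanSpace ℝ (Fin n)) : Fin n → ℝ :=
  fun i => fderiv ℝ φ z (prodBasis (Sum.inl i))

/-- The gradient in the `y`-variable, `D_yφ(x,y)`, as a vector of `ℝⁿ`. -/
noncomputable def gradSnd {n : ℕ}
    (φ : EuclideanSpace ℝ (Fin n) × EuclideanSpace ℝ (Fin n) → ℝ)
    (z : EuclideanSpace ℝ (Fin n) × EuclideanSpace ℝ (Fin n)) : Fin n → ℝ :=
  fun j => fderiv ℝ φ z (prodBasis (Sum.inr j))

/-- The full Hessian `D²φ(x,y)` of `φ : ℝⁿ × ℝⁿ → ℝ`, viewed as a symmetric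
`2n × 2n` matrix (indexed by `Fin n ⊕ Fin n`). -/
noncomputable def hessianProd {n : ℕ}
    (φ : EuclideanSpace ℝ (Fin n) × EuclideanSpace ℝ (Fin n) → ℝ)
    (z : EuclideanSpace ℝ (Fin n) × EuclideanSpace ℝ (Fin n)) :
    Matrix (Fin n ⊕ Fin n) (Fin n ⊕ Fin n) ℝ :=
  fun a b => fderiv ℝ (fun w => fderiv ℝ φ w (prodBasis b)) z (prodBasis a)

/-- The maximum of the absolute values of the (real) eigenvalues of a matrix. -/
noncomputable def maxAbsEigenvalue {ι : Type*} [Fintype ι] (M : Matrix ι ι ℝ) : ℝ :=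
  sSup {r : ℝ | ∃ t : ℝ, r = |t| ∧ ∃ w : ι → ℝ, w ≠ 0 ∧ M.mulVec w = t • w}

/-- Second-order Taylor expansion at a point where the derivative is differentiable. -/
theorem exists_forall_abs_taylor_two_le {E : Type*} [NormedAddCommGroup E] [NormedSpace ℝ E]
    {f : E → ℝ} {f' : E → E →L[ℝ] ℝ} {f'' : E →L[ℝ] E →L[ℝ] ℝ} {x : E}
    (hf : ∀ᶠ y in 𝓝 x, HasFDerivAt f (f' y) y) (hf' : HasFDerivAt f' f'' x)
    {ε : ℝ} (hε : 0 < ε) :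
    ∃ δ > 0, ∀ h : E, ‖h‖ < δ →
      |f (x + h) - f x - f' x h - 1 / 2 * f'' h h| ≤ ε * ‖h‖ ^ 2 := by
  have hsymm := second_derivative_symmetric_of_eventually hf hf'
  have hlit := (hasFDerivAt_iff_isLittleO.1 hf').def hε
  obtain ⟨δ, hδ, hball⟩ := Metric.eventually_nhds_iff.1 (hf.and hlit)
  refine ⟨δ, hδ, fun h hh => ?_⟩
  have hderiv : ∀ y ∈ Metric.closedBall (0 : E) ‖h‖,
      HasFDerivWithinAt (fun y => f (x + y) - f' x y - 1 / 2 * f'' y y)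
        (f' (x + y) - f' x - f'' y) (Metric.closedBall (0 : E) ‖h‖) y := by
    intro y hy
    have hy' : dist (x + y) x < δ := by
      simpa using lt_of_le_of_lt (by simpa using hy) hh
    have h1 : HasFDerivAt (fun y => f (x + y)) (f' (x + y)) y := by
      have := (hball hy').1.comp y ((hasFDerivAt_id y).const_add x)
      simpa using! this
    have h2 : HasFDerivAt (fun y => f'' y y) (f'' y + f'' y) y := by
      have := f''.hasFDerivAt.clm_apply (x := y) (hasFDerivAt_id y)
      refine this.congr_fderiv ?_
      ext k
      simp [hsymm k y]
    refine (((h1.sub (f' x).hasFDerivAt).sub (h2.const_mul (1 / 2))).congr_fderiv ?_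
      ).hasFDerivWithinAt
    ext k
    simp
    ring
  have hbound : ∀ y ∈ Metric.closedBall (0 : E) ‖h‖, ‖f' (x + y) - f' x - f'' y‖ ≤ ε * ‖h‖ := by
    intro y hy
    have hy1 : ‖y‖ ≤ ‖h‖ := by simpa using hy
    have hy' : dist (x + y) x < δ := by simpa using lt_of_le_of_lt hy1 hh
    have := (hball hy').2
    rw [add_sub_cancel_left] at this
    exact this.trans (by gcongr)
  have := (convex_closedBall (0 : E) ‖h‖).norm_image_sub_le_of_norm_hasFDerivWithin_le
    hderiv hbound (x := 0) (y := h) (by simp) (by simp)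
  simp only [Real.norm_eq_abs, add_zero, map_zero, sub_zero, mul_zero] at this
  calc _ = |f (x + h) - f' x h - 1 / 2 * f'' h h - f x| := by congr 1; ring
    _ ≤ _ := this
    _ = _ := by ring

/-- A function with a quadratic error bound at every point is differentiable there. -/
theorem hasFDerivAt_of_abs_sub_le_sq {E : Type*} [NormedAddCommGroup E] [NormedSpace ℝ E]
    {f : E → ℝ} {L : E →L[ℝ] ℝ} {x : E} {K : ℝ}
    (h : ∀ y, |f y - f x - L (y - x)| ≤ K * ‖y - x‖ ^ 2) : HasFDerivAt f L x := by
  refine HasFDerivAt.of_isLittleO ?_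
  have h1 : (fun y => f y - f x - L (y - x)) =O[𝓝 x] fun y => ‖y - x‖ ^ 2 :=
    Asymptotics.IsBigO.of_bound K (Eventually.of_forall fun y => by simpa using h y)
  refine h1.trans_isLittleO ?_
  have h2 : Tendsto (fun y : E => y - x) (𝓝 x) (𝓝 0) := by
    simpa using (continuous_id.sub continuous_const).tendsto (x := x) (f := fun y : E => y - x)
  have h3 := (Asymptotics.isLittleO_norm_pow_id (E' := E) (n := 2) (by norm_num)).comp_tendsto h2
  exact h3

theorem norm_sq_sub_midpoint {E : Type*} [NormedAddCommGroup E] [InnerProductSpace ℝ E]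
    (x a b : E) : ‖x - (1 / 2 : ℝ) • (a + b)‖ ^ 2 =
      1 / 2 * ‖x - a‖ ^ 2 + 1 / 2 * ‖x - b‖ ^ 2 - 1 / 4 * ‖a - b‖ ^ 2 := by
  simp only [← real_inner_self_eq_norm_sq, inner_sub_left, inner_sub_right, inner_add_left,
    inner_add_right, inner_smul_left, inner_smul_right, real_inner_comm x a, real_inner_comm x b,
    real_inner_comm a b, conj_trivial]
  ring

/-- Lasry–Lions regularization of an upper semicontinuous function on a compact set: a `C^{1,1}`
majorant of its sup-convolution with parameter `l` that lies below every `k`-semiconcave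
majorant. -/
theorem exists_lasryLions {E : Type*} [NormedAddCommGroup E] [InnerProductSpace ℝ E]
    [FiniteDimensional ℝ E] {C : Set E} (hC : IsCompact C) (hne : C.Nonempty) {u : E → ℝ}
    (hu : UpperSemicontinuousOn u C) {l k : ℝ} (hl : 0 < l) (hk : 0 < k) :
    ∃ (w : E → ℝ) (w' : E → E →L[ℝ] ℝ) (K : NNReal), LipschitzWith K w' ∧
      (∀ ξ, HasFDerivAt w (w' ξ) ξ) ∧
      (∀ ξ, ∀ x ∈ C, u x - l / 2 * ‖x - ξ‖ ^ 2 ≤ w ξ) ∧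
      (∀ ξ η, ∃ x ∈ C, ∃ z, w ξ ≤
        u x - l / 2 * ‖x - z‖ ^ 2 - k / 2 * ‖z - η‖ ^ 2 + k / 2 * ‖ξ - η‖ ^ 2) := by
  obtain ⟨t, ht⟩ : ∃ t, t = l * k / (l + k) := ⟨_, rfl⟩
  have hlk : 0 < l + k := add_pos hl hk
  have ht' : t * (l + k) = l * k := by rw [ht]; field_simp
  have htpos : 0 < t := by rw [ht]; positivity
  have htk : t < k := by
    by_contra hcon
    nlinarith [mul_pos hk hk, mul_le_mul_of_nonneg_right (not_lt.1 hcon) hlk.le]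
  -- the sup-convolution
  have hmax : ∀ η : E, ∃ x ∈ C, ∀ y ∈ C,
      u y - t / 2 * ‖y - η‖ ^ 2 ≤ u x - t / 2 * ‖x - η‖ ^ 2 := by
    intro η
    have : UpperSemicontinuousOn (fun x => u x + -(t / 2 * ‖x - η‖ ^ 2)) C :=
      hu.add (Continuous.continuousOn (by fun_prop)).upperSemicontinuousOn
    obtain ⟨x, hx, hmx⟩ := this.exists_isMaxOn hne hC
    exact ⟨x, hx, fun y hy => by simpa [sub_eq_add_neg] using hmx hy⟩
  choose X hXC hX using hmax
  obtain ⟨S, hS⟩ : ∃ S : E → ℝ, ∀ η, S η = u (X η) - t / 2 * ‖X η - η‖ ^ 2 := ⟨_, fun _ => rfl⟩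
  have hSle : ∀ η, ∀ x ∈ C, u x - t / 2 * ‖x - η‖ ^ 2 ≤ S η := fun η x hx => by
    rw [hS]; exact hX η x hx
  have hSlsc : LowerSemicontinuous S := by
    intro η y hy
    rw [hS] at hy
    have hcont : Continuous fun η' => u (X η) - t / 2 * ‖X η - η'‖ ^ 2 := by fun_prop
    filter_upwards [hcont.continuousAt.eventually (lt_mem_nhds hy)] with η' hη'
    exact hη'.trans_le (hSle η' _ (hXC η))
  have hSmid : ∀ a b, S ((1 / 2 : ℝ) • (a + b)) ≤
      1 / 2 * S a + 1 / 2 * S b + t / 8 * ‖a - b‖ ^ 2 := by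
    intro a b
    rw [hS ((1 / 2 : ℝ) • (a + b)), norm_sq_sub_midpoint]
    have := hSle a _ (hXC ((1 / 2 : ℝ) • (a + b)))
    have := hSle b _ (hXC ((1 / 2 : ℝ) • (a + b)))
    linarith
  obtain ⟨s, hs⟩ : ∃ s, s = k - t := ⟨_, rfl⟩
  have hspos : 0 < s := by linarith
  -- the minimisation defining the regularization
  have hmin : ∀ ξ, ∃ η, ∀ η', S η + k / 2 * ‖ξ - η‖ ^ 2 ≤ S η' + k / 2 * ‖ξ - η'‖ ^ 2 := by
    intro ξ
    obtain ⟨x₀, hx₀⟩ := hne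
    obtain ⟨c, hc⟩ : ∃ c : E, c = s⁻¹ • (k • ξ - t • x₀) := ⟨_, rfl⟩
    have hc' : s • c = k • ξ - t • x₀ := by rw [hc, smul_inv_smul₀ hspos.ne']
    have hid : ∀ η, k / 2 * ‖ξ - η‖ ^ 2 - t / 2 * ‖x₀ - η‖ ^ 2 =
        s / 2 * ‖η - c‖ ^ 2 + (k / 2 * ‖ξ‖ ^ 2 - t / 2 * ‖x₀‖ ^ 2 - s / 2 * ‖c‖ ^ 2) := by
      intro η
      have h1 : s * inner ℝ η c = k * inner ℝ η ξ - t * inner ℝ η x₀ := by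
        rw [← inner_smul_right, hc', inner_sub_right, inner_smul_right, inner_smul_right]
      rw [norm_sub_sq_real, norm_sub_sq_real, norm_sub_sq_real, real_inner_comm η ξ,
        real_inner_comm η x₀]
      rw [hs] at h1 ⊢
      linear_combination h1
    obtain ⟨A, hA⟩ : ∃ A, A = u x₀ + (k / 2 * ‖ξ‖ ^ 2 - t / 2 * ‖x₀‖ ^ 2 - s / 2 * ‖c‖ ^ 2) :=
      ⟨_, rfl⟩
    have hlow : ∀ η, A + s / 2 * ‖η - c‖ ^ 2 ≤ S η + k / 2 * ‖ξ - η‖ ^ 2 := by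
      intro η
      have := hSle η x₀ hx₀
      have := hid η
      linarith
    obtain ⟨ρ, hρ⟩ : ∃ ρ, ρ = √(2 * (S c + k / 2 * ‖ξ - c‖ ^ 2 - A) / s) := ⟨_, rfl⟩
    have hρ0 : 0 ≤ ρ := hρ ▸ Real.sqrt_nonneg _
    have hρ2 : s / 2 * ρ ^ 2 = S c + k / 2 * ‖ξ - c‖ ^ 2 - A := by
      have : 0 ≤ 2 * (S c + k / 2 * ‖ξ - c‖ ^ 2 - A) / s := by
        have := hlow c
        simp only [sub_self, norm_zero] at this
        exact div_nonneg (by linarith) hspos.le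
      rw [hρ, Real.sq_sqrt this]
      field_simp
    have hlsc : LowerSemicontinuous fun η => S η + k / 2 * ‖ξ - η‖ ^ 2 :=
      hSlsc.add (Continuous.lowerSemicontinuous (by fun_prop))
    obtain ⟨η, hη, hηmin⟩ := (hlsc.lowerSemicontinuousOn _).exists_isMinOn
      (Metric.nonempty_closedBall.2 hρ0) (isCompact_closedBall c ρ)
    refine ⟨η, fun η' => ?_⟩
    by_cases hη' : η' ∈ Metric.closedBall c ρ
    · exact hηmin hη'
    · have h1 : ρ < ‖η' - c‖ := by simpa [dist_eq_norm] using hη'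
      have h2 : ρ ^ 2 < ‖η' - c‖ ^ 2 := by gcongr
      have h3 : S η + k / 2 * ‖ξ - η‖ ^ 2 ≤ S c + k / 2 * ‖ξ - c‖ ^ 2 :=
        hηmin (Metric.mem_closedBall_self hρ0)
      have := hlow η'
      nlinarith
  choose m hm using hmin
  have hgrow : ∀ ξ η, S (m ξ) + k / 2 * ‖ξ - m ξ‖ ^ 2 + s / 4 * ‖m ξ - η‖ ^ 2 ≤
      S η + k / 2 * ‖ξ - η‖ ^ 2 := by
    intro ξ η
    have h1 := hm ξ ((1 / 2 : ℝ) • (m ξ + η))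
    have h2 := hSmid (m ξ) η
    rw [norm_sq_sub_midpoint] at h1
    rw [hs]
    linarith
  have hmLip : ∀ ξ ξ', ‖m ξ - m ξ'‖ ≤ 2 * k / s * ‖ξ - ξ'‖ := by
    intro ξ ξ'
    have h1 := hgrow ξ (m ξ')
    have h2 := hgrow ξ' (m ξ)
    rw [norm_sub_rev (m ξ') (m ξ)] at h2
    have h3 : s / 2 * ‖m ξ - m ξ'‖ ^ 2 ≤ k * inner ℝ (ξ - ξ') (m ξ - m ξ') := by
      simp only [norm_sub_sq_real ξ, norm_sub_sq_real ξ'] at h1 h2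
      simp only [inner_sub_left, inner_sub_right]
      linarith
    have h4 := real_inner_le_norm (ξ - ξ') (m ξ - m ξ')
    rcases (norm_nonneg (m ξ - m ξ')).eq_or_lt with h0 | h0
    · rw [← h0]; positivity
    · rw [div_mul_eq_mul_div, le_div_iff₀ hspos]
      have h5 : s / 2 * ‖m ξ - m ξ'‖ ^ 2 ≤ k * (‖ξ - ξ'‖ * ‖m ξ - m ξ'‖) := h3.trans (by gcongr)
      have h6 : (s * ‖m ξ - m ξ'‖) * ‖m ξ - m ξ'‖ ≤ (2 * k * ‖ξ - ξ'‖) * ‖m ξ - m ξ'‖ := by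
        linarith
      linarith [le_of_mul_le_mul_right h6 h0]
  obtain ⟨g, hg⟩ : ∃ g : E → E, ∀ ξ, g ξ = k • (ξ - m ξ) := ⟨_, fun _ => rfl⟩
  obtain ⟨w, hw⟩ : ∃ w : E → ℝ, ∀ ξ, w ξ = S (m ξ) + k / 2 * ‖ξ - m ξ‖ ^ 2 := ⟨_, fun _ => rfl⟩
  obtain ⟨K, hK⟩ : ∃ K, K = k * (1 + 2 * k / s) := ⟨_, rfl⟩
  have hK0 : 0 ≤ K := by rw [hK]; positivity
  have hgLip : ∀ ξ ξ', ‖g ξ - g ξ'‖ ≤ K * ‖ξ - ξ'‖ := by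
    intro ξ ξ'
    have : g ξ - g ξ' = k • ((ξ - ξ') - (m ξ - m ξ')) := by
      rw [hg, hg, ← smul_sub]; congr 1; abel
    rw [this, norm_smul, Real.norm_of_nonneg hk.le, hK, mul_assoc]
    gcongr
    linarith [norm_sub_le (ξ - ξ') (m ξ - m ξ'), hmLip ξ ξ']
  have hup : ∀ ξ ξ', w ξ' ≤ w ξ + inner ℝ (g ξ) (ξ' - ξ) + k / 2 * ‖ξ' - ξ‖ ^ 2 := by
    intro ξ ξ'
    have h1 := hm ξ' (m ξ)
    have h2 : ‖ξ' - m ξ‖ ^ 2 = ‖ξ' - ξ‖ ^ 2 + 2 * inner ℝ (ξ - m ξ) (ξ' - ξ) + ‖ξ - m ξ‖ ^ 2 := by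
      rw [← sub_add_sub_cancel ξ' ξ (m ξ), norm_add_sq_real, real_inner_comm]
    rw [hw, hw, hg, inner_smul_left, conj_trivial]
    rw [h2] at h1
    linarith
  refine ⟨w, fun ξ => innerSL ℝ (g ξ), K.toNNReal,
    LipschitzWith.of_dist_le_mul fun ξ ξ' => ?_, fun ξ => ?_, ?_, ?_⟩
  · rw [dist_eq_norm, dist_eq_norm, Real.coe_toNNReal _ hK0, ← map_sub, innerSL_apply_norm]
    exact hgLip ξ ξ'
  · refine hasFDerivAt_of_abs_sub_le_sq (K := K + k / 2) fun ξ' => ?_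
    rw [innerSL_apply_apply]
    have h1 := hup ξ ξ'
    have h2 := hup ξ' ξ
    have h3 : inner ℝ (g ξ') (ξ - ξ') =
        -inner ℝ (g ξ) (ξ' - ξ) - inner ℝ (g ξ' - g ξ) (ξ' - ξ) := by
      rw [← neg_sub ξ' ξ, inner_neg_right, inner_sub_left]; ring
    have h4 := (real_inner_le_norm (g ξ' - g ξ) (ξ' - ξ))
    have h5 : ‖g ξ' - g ξ‖ * ‖ξ' - ξ‖ ≤ K * ‖ξ' - ξ‖ * ‖ξ' - ξ‖ := by
      gcongr
      exact hgLip ξ' ξ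
    have h6 := neg_le_of_abs_le (abs_real_inner_le_norm (g ξ' - g ξ) (ξ' - ξ))
    rw [norm_sub_rev ξ ξ'] at h2
    have h7 : 0 ≤ K * ‖ξ' - ξ‖ ^ 2 := by positivity
    rw [abs_le]
    constructor <;> nlinarith
  · intro ξ x hx
    have h1 := hSle (m ξ) x hx
    have h2 : t / 2 * ‖x - m ξ‖ ^ 2 ≤ l / 2 * ‖x - ξ‖ ^ 2 + k / 2 * ‖ξ - m ξ‖ ^ 2 := by
      obtain ⟨a, ha⟩ : ∃ a, a = x - ξ := ⟨_, rfl⟩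
      obtain ⟨b, hb⟩ : ∃ b, b = ξ - m ξ := ⟨_, rfl⟩
      have hab : x - m ξ = a + b := by rw [ha, hb]; abel
      rw [hab, ← ha, ← hb]
      have h3 := sq_nonneg ‖l • a - k • b‖
      rw [norm_sub_sq_real, norm_smul, norm_smul, inner_smul_left, inner_smul_right,
        Real.norm_of_nonneg hl.le, Real.norm_of_nonneg hk.le, conj_trivial] at h3
      have h4 : (t * (l + k)) * ‖a + b‖ ^ 2 ≤ (l + k) * (l * ‖a‖ ^ 2 + k * ‖b‖ ^ 2) := by
        rw [ht', norm_add_sq_real]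
        linarith
      have h5 : (l + k) * (t * ‖a + b‖ ^ 2) ≤ (l + k) * (l * ‖a‖ ^ 2 + k * ‖b‖ ^ 2) := by
        linarith
      linarith [le_of_mul_le_mul_left h5 hlk]
    rw [hw]
    linarith
  · intro ξ η
    obtain ⟨z, hz⟩ : ∃ z, z = η + (l / (l + k)) • (X η - η) := ⟨_, rfl⟩
    refine ⟨X η, hXC η, z, ?_⟩
    have h1 := hm ξ η
    have h2 : z - η = (l / (l + k)) • (X η - η) := by rw [hz]; abel
    have h3 : X η - z = (k / (l + k)) • (X η - η) := by
      have : k / (l + k) = 1 - l / (l + k) := by field_simp; ring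
      rw [this, sub_smul, one_smul, hz]; abel
    rw [h2, h3, norm_smul, norm_smul, Real.norm_of_nonneg (by positivity),
      Real.norm_of_nonneg (by positivity), hw]
    rw [hS η] at h1
    refine h1.trans (le_of_eq ?_)
    rw [ht]
    field_simp
    ring

/-- First- and second-order conditions at a point where a quadratic polynomial touches a function
from above. -/
theorem eq_and_le_of_forall_le_quadratic {E : Type*} [NormedAddCommGroup E] [NormedSpace ℝ E]
    {f : E → ℝ} {f' : E → E →L[ℝ] ℝ} {f'' : E →L[ℝ] E →L[ℝ] ℝ} {x : E}
    (hf : ∀ᶠ y in 𝓝 x, HasFDerivAt f (f' y) y) (hf' : HasFDerivAt f' f'' x)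
    {L : E →L[ℝ] ℝ} {q : E →L[ℝ] E →L[ℝ] ℝ}
    (h : ∀ h, f (x + h) ≤ f x + L h + 1 / 2 * q h h) :
    f' x = L ∧ ∀ h, f'' h h ≤ q h h := by
  have hL : f' x = L := by
    have h1 : HasFDerivAt (fun h => f (x + h)) (f' x) 0 := by
      have hfx : HasFDerivAt f (f' x) (x + 0) := by simpa using hf.self_of_nhds
      simpa using! hfx.comp (0 : E) ((hasFDerivAt_id (0 : E)).const_add x)
    have h2 : HasFDerivAt (fun h : E => q h h) (0 : E →L[ℝ] ℝ) 0 := by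
      refine (q.hasFDerivAt.clm_apply (x := (0 : E)) (hasFDerivAt_id (0 : E))).congr_fderiv ?_
      ext k
      simp
    have h3 := (h1.sub L.hasFDerivAt).sub (h2.const_mul (1 / 2 : ℝ))
    have h4 : IsLocalMax (fun y => f (x + y) - L y - 1 / 2 * q y y) 0 :=
      Eventually.of_forall fun y => by
        have := h y
        simp only [add_zero, map_zero, mul_zero, sub_zero]
        linarith
    have h5 := h4.hasFDerivAt_eq_zero h3
    simpa [sub_eq_zero] using h5
  refine ⟨hL, fun k => ?_⟩
  refine le_of_forall_pos_le_add fun ε hε => ?_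
  obtain ⟨c, hc⟩ : ∃ c, c = ε / (2 * (‖k‖ ^ 2 + 1)) := ⟨_, rfl⟩
  have hcpos : 0 < c := by rw [hc]; positivity
  obtain ⟨δ, hδ, hT⟩ := exists_forall_abs_taylor_two_le hf hf' hcpos
  obtain ⟨t, ht⟩ : ∃ t, t = δ / (2 * (‖k‖ + 1)) := ⟨_, rfl⟩
  have htpos : 0 < t := by rw [ht]; positivity
  have htk : ‖t • k‖ < δ := by
    rw [norm_smul, Real.norm_of_nonneg htpos.le, ht, div_mul_eq_mul_div,
      div_lt_iff₀ (by positivity)]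
    nlinarith [norm_nonneg k]
  have h1 := neg_le_of_abs_le (hT (t • k) htk)
  have h2 := h (t • k)
  rw [hL] at h1
  simp only [map_smul, FunLike.coe_smul, Pi.smul_apply, smul_eq_mul, norm_smul,
    Real.norm_of_nonneg htpos.le] at h1 h2
  have h3 : t ^ 2 * f'' k k ≤ t ^ 2 * (q k k + 2 * c * ‖k‖ ^ 2) := by nlinarith
  have h4 := le_of_mul_le_mul_left h3 (by positivity)
  have h5 : 2 * c * ‖k‖ ^ 2 ≤ ε := by
    rw [hc, ← mul_div_assoc, div_mul_eq_mul_div, div_le_iff₀ (by positivity)]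
    nlinarith [sq_nonneg ‖k‖]
  linarith

theorem norm_sq_le_norm_fst_sq_add_norm_snd_sq {E F : Type*} [NormedAddCommGroup E]
    [NormedAddCommGroup F] (z : E × F) : ‖z‖ ^ 2 ≤ ‖z.1‖ ^ 2 + ‖z.2‖ ^ 2 := by
  rw [Prod.norm_def]
  rcases max_choice ‖z.1‖ ‖z.2‖ with h | h <;> rw [h] <;>
    linarith [sq_nonneg ‖z.1‖, sq_nonneg ‖z.2‖]

/-- Existence of a maximizer, close to the origin, of a linearly perturbed doubled functional. -/
theorem exists_isMax_perturbed {E : Type*} [NormedAddCommGroup E] [NormedSpace ℝ E]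
    [FiniteDimensional ℝ E] {C₁ C₂ : Set E} (hC₁ : IsCompact C₁) (hC₂ : IsCompact C₂)
    (h₁ : (0 : E) ∈ C₁) (h₂ : (0 : E) ∈ C₂) {u₁ u₂ : E → ℝ}
    (hu₁ : UpperSemicontinuousOn u₁ C₁) (hu₂ : UpperSemicontinuousOn u₂ C₂)
    (h0₁ : u₁ 0 = 0) (h0₂ : u₂ 0 = 0) (R : E × E →L[ℝ] E × E →L[ℝ] ℝ) {l θ : ℝ} (hθ : 0 < θ)
    (hH : ∀ x ∈ C₁, ∀ y ∈ C₂, ∀ ξ : E × E,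
      u₁ x + u₂ y - l / 2 * (‖x - ξ.1‖ ^ 2 + ‖y - ξ.2‖ ^ 2) ≤
        1 / 2 * R ξ ξ - θ / 2 * (‖ξ.1‖ ^ 2 + ‖ξ.2‖ ^ 2)) (p : E × E →L[ℝ] ℝ) :
    ∃ x ∈ C₁, ∃ y ∈ C₂, ∃ ξ : E × E, ‖ξ‖ ≤ 2 * ‖p‖ / θ ∧
      0 ≤ u₁ x + u₂ y - l / 2 * (‖x - ξ.1‖ ^ 2 + ‖y - ξ.2‖ ^ 2) - 1 / 2 * R ξ ξ - p ξ ∧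
      ∀ x' ∈ C₁, ∀ y' ∈ C₂, ∀ ζ : E × E,
        u₁ x' + u₂ y' - l / 2 * (‖x' - ζ.1‖ ^ 2 + ‖y' - ζ.2‖ ^ 2) - 1 / 2 * R ζ ζ - p ζ ≤
        u₁ x + u₂ y - l / 2 * (‖x - ξ.1‖ ^ 2 + ‖y - ξ.2‖ ^ 2) - 1 / 2 * R ξ ξ - p ξ := by
  have hr0 : 0 ≤ 2 * ‖p‖ / θ := by positivity
  have hneg : ∀ x ∈ C₁, ∀ y ∈ C₂, ∀ ξ : E × E, 2 * ‖p‖ / θ < ‖ξ‖ →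
      u₁ x + u₂ y - l / 2 * (‖x - ξ.1‖ ^ 2 + ‖y - ξ.2‖ ^ 2) - 1 / 2 * R ξ ξ - p ξ ≤ 0 := by
    intro x hx y hy ξ hξ
    have h3 := hH x hx y hy ξ
    have h4 := norm_sq_le_norm_fst_sq_add_norm_snd_sq ξ
    have h5 := neg_le_of_abs_le (p.le_opNorm ξ)
    rw [div_lt_iff₀ hθ] at hξ
    nlinarith [norm_nonneg ξ, mul_le_mul_of_nonneg_left hξ.le (norm_nonneg ξ)]
  have husc : UpperSemicontinuousOn (fun q : E × E × E × E => u₁ q.1 + u₂ q.2.1 +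
      (-(l / 2) * (‖q.1 - q.2.2.1‖ ^ 2 + ‖q.2.1 - q.2.2.2‖ ^ 2) - 1 / 2 * R q.2.2 q.2.2 - p q.2.2))
      (C₁ ×ˢ C₂ ×ˢ Metric.closedBall (0 : E × E) (2 * ‖p‖ / θ)) := by
    refine ((hu₁.comp continuous_fst.continuousOn fun q hq => hq.1).add
      (hu₂.comp (by fun_prop : Continuous fun q : E × E × E × E => q.2.1).continuousOn
        fun q hq => hq.2.1)).add (Continuous.continuousOn ?_).upperSemicontinuousOn
    have : Continuous fun q : E × E × E × E => R q.2.2 q.2.2 :=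
      (R.continuous.comp (continuous_snd.comp continuous_snd)).clm_apply
        (continuous_snd.comp continuous_snd)
    fun_prop
  have hne : (C₁ ×ˢ C₂ ×ˢ Metric.closedBall (0 : E × E) (2 * ‖p‖ / θ)).Nonempty :=
    ⟨(0, 0, 0), h₁, h₂, Metric.mem_closedBall_self hr0⟩
  obtain ⟨⟨x, y, ξ⟩, ⟨hx, hy, hξ⟩, hmax⟩ := husc.exists_isMaxOn hne
    (hC₁.prod (hC₂.prod (isCompact_closedBall _ _)))
  have hmax' : ∀ x' ∈ C₁, ∀ y' ∈ C₂, ∀ ζ : E × E, ‖ζ‖ ≤ 2 * ‖p‖ / θ →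
        u₁ x' + u₂ y' - l / 2 * (‖x' - ζ.1‖ ^ 2 + ‖y' - ζ.2‖ ^ 2) - 1 / 2 * R ζ ζ - p ζ ≤
        u₁ x + u₂ y - l / 2 * (‖x - ξ.1‖ ^ 2 + ‖y - ξ.2‖ ^ 2) - 1 / 2 * R ξ ξ - p ξ := by
    intro x' hx' y' hy' ζ hζ
    have : (x', y', ζ) ∈ C₁ ×ˢ C₂ ×ˢ Metric.closedBall (0 : E × E) (2 * ‖p‖ / θ) :=
      ⟨hx', hy', by simpa using hζ⟩
    have := isMaxOn_iff.1 hmax _ this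
    dsimp only at this
    linarith
  have hpos := hmax' 0 h₁ 0 h₂ 0 (by simpa using hr0)
  simp only [h0₁, h0₂, Prod.fst_zero, Prod.snd_zero, sub_zero, norm_zero, map_zero] at hpos
  norm_num at hpos
  refine ⟨x, hx, y, hy, ξ, by simpa using hξ, by linarith, fun x' hx' y' hy' ζ => ?_⟩
  rcases le_or_gt ‖ζ‖ (2 * ‖p‖ / θ) with hζ | hζ
  · exact hmax' x' hx' y' hy' ζ hζ
  · exact (hneg x' hx' y' hy' ζ hζ).trans (by linarith)

/-- A Lipschitz map into a space of the same dimension cannot cover a ball by the image of the set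
of points where a given Lipschitz map fails to be differentiable. -/
theorem exists_notMem_image_not_differentiableAt {Z F G : Type*} [NormedAddCommGroup Z]
    [NormedSpace ℝ Z] [FiniteDimensional ℝ Z] [NormedAddCommGroup F] [NormedSpace ℝ F]
    [FiniteDimensional ℝ F] [NormedAddCommGroup G] [NormedSpace ℝ G] [FiniteDimensional ℝ G]
    (hdim : Module.finrank ℝ Z = Module.finrank ℝ F) {f : Z → G} {K : NNReal}
    (hf : LipschitzWith K f) {Ψ : Z → F} {K' : NNReal} (hΨ : LipschitzWith K' Ψ) {r : ℝ}
    (hr : 0 < r) : ∃ p : F, ‖p‖ < r ∧ ∀ z, Ψ z = p → DifferentiableAt ℝ f z := by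
  borelize Z F
  have hnull : MeasureTheory.Measure.hausdorffMeasure (Module.finrank ℝ Z : ℝ)
      {z | ¬DifferentiableAt ℝ f z} = 0 :=
    MeasureTheory.ae_iff.1 (hf.ae_differentiableAt)
  have himage := hΨ.hausdorffMeasure_image_le (Nat.cast_nonneg (Module.finrank ℝ Z))
    {z | ¬DifferentiableAt ℝ f z}
  rw [hnull, mul_zero, hdim, nonpos_iff_eq_zero] at himage
  by_contra! hcon
  refine (Metric.measure_ball_pos
    (MeasureTheory.Measure.hausdorffMeasure (Module.finrank ℝ F : ℝ)) (0 : F) hr).ne'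
    (MeasureTheory.measure_mono_null (fun p hp => ?_) himage)
  obtain ⟨z, hz, hz'⟩ := hcon p (by simpa using hp)
  exact ⟨z, hz', hz⟩

/-- If an upper semicontinuous function is touched, after regularization and translation, by a
function with a second-order expansion, it inherits a superjet. -/
theorem exists_superjet_of_translate {E : Type*} [NormedAddCommGroup E] [NormedSpace ℝ E]
    {C : Set E} {u w : E → ℝ} {w' : E → E →L[ℝ] ℝ} {w'' : E →L[ℝ] E →L[ℝ] ℝ} {x ξ : E}
    (hw : ∀ ζ, HasFDerivAt w (w' ζ) ζ) (hw' : HasFDerivAt w' w'' ξ)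
    (hle : ∀ x' ∈ C, u x' ≤ u x + w (ξ + (x' - x)) - w ξ) {ε : ℝ} (hε : 0 < ε) :
    ∃ δ > 0, ∀ x' ∈ C, ‖x' - x‖ < δ →
      u x' ≤ u x + w' ξ (x' - x) + 1 / 2 * w'' (x' - x) (x' - x) + ε * ‖x' - x‖ ^ 2 := by
  obtain ⟨δ, hδ, hT⟩ := exists_forall_abs_taylor_two_le (Eventually.of_forall hw) hw' hε
  refine ⟨δ, hδ, fun x' hx' hd => ?_⟩
  have h1 := le_of_abs_le (hT _ hd)
  have h2 := hle x' hx'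
  linarith

/-- First- and second-order conditions at a point where a concave paraboloid touches a function
from below. -/
theorem eq_and_le_of_forall_paraboloid_le {E : Type*} [NormedAddCommGroup E]
    [InnerProductSpace ℝ E] {w : E → ℝ} {w' : E → E →L[ℝ] ℝ} {w'' : E →L[ℝ] E →L[ℝ] ℝ} {x ξ : E}
    {a l : ℝ} (hw : ∀ ζ, HasFDerivAt w (w' ζ) ζ) (hw' : HasFDerivAt w' w'' ξ)
    (hle : ∀ ζ, a - l / 2 * ‖x - ζ‖ ^ 2 ≤ w ζ) (heq : w ξ = a - l / 2 * ‖x - ξ‖ ^ 2) :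
    w' ξ = l • innerSL ℝ (x - ξ) ∧ ∀ h, -l * ‖h‖ ^ 2 ≤ w'' h h := by
  obtain ⟨q, hq⟩ : ∃ q : E →L[ℝ] E →L[ℝ] ℝ, ∀ h, q h h = l * ‖h‖ ^ 2 :=
    ⟨l • innerSL ℝ, fun h => congrArg (l * ·) (real_inner_self_eq_norm_sq h)⟩
  have key := eq_and_le_of_forall_le_quadratic (f := fun ζ => -w ζ) (f' := fun ζ => -w' ζ)
    (f'' := -w'') (x := ξ) (L := -(l • innerSL ℝ (x - ξ))) (q := q)
    (Eventually.of_forall fun ζ => (hw ζ).neg) hw'.neg (by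
      intro h
      have h1 := hle (ξ + h)
      rw [← sub_sub, norm_sub_sq_real] at h1
      simp only [FunLike.coe_neg, FunLike.coe_smul, Pi.neg_apply,
        Pi.smul_apply, smul_eq_mul, innerSL_apply_apply, hq]
      linarith)
  refine ⟨neg_injective key.1, fun h => ?_⟩
  have h2 := key.2 h
  simp only [FunLike.coe_neg, Pi.neg_apply, hq] at h2
  linarith

/-- The hull property of two regularizations with respect to a joint quadratic majorant. -/
theorem add_le_quadratic_of_hull {E : Type*} [NormedAddCommGroup E] [InnerProductSpace ℝ E]
    [FiniteDimensional ℝ E] {C₁ C₂ : Set E} {u₁ u₂ w₁ w₂ : E → ℝ}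
    {R : E × E →L[ℝ] E × E →L[ℝ] ℝ} (hR : ∀ z w, R z w = R w z) {l k c : ℝ} (hk : 0 < k)
    (hRk : ∀ z : E × E, R z z ≤ k * (‖z.1‖ ^ 2 + ‖z.2‖ ^ 2)) (p : E × E →L[ℝ] ℝ)
    (hw₁ : ∀ ξ η, ∃ x ∈ C₁, ∃ z, w₁ ξ ≤
        u₁ x - l / 2 * ‖x - z‖ ^ 2 - k / 2 * ‖z - η‖ ^ 2 + k / 2 * ‖ξ - η‖ ^ 2)
    (hw₂ : ∀ ξ η, ∃ x ∈ C₂, ∃ z, w₂ ξ ≤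
        u₂ x - l / 2 * ‖x - z‖ ^ 2 - k / 2 * ‖z - η‖ ^ 2 + k / 2 * ‖ξ - η‖ ^ 2)
    (hle : ∀ x ∈ C₁, ∀ y ∈ C₂, ∀ ζ : E × E,
      u₁ x + u₂ y - l / 2 * (‖x - ζ.1‖ ^ 2 + ‖y - ζ.2‖ ^ 2) - 1 / 2 * R ζ ζ - p ζ ≤ c)
    (ζ : E × E) : w₁ ζ.1 + w₂ ζ.2 ≤ 1 / 2 * R ζ ζ + p ζ + c := by
  obtain ⟨g₁, hg₁⟩ : ∃ g : E, ∀ h, inner ℝ g h = (R ζ + p) (h, 0) :=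
    ⟨(InnerProductSpace.toDual ℝ E).symm ((R ζ + p).comp (ContinuousLinearMap.inl ℝ E E)),
      fun h => by rw [InnerProductSpace.toDual_symm_apply]; simp⟩
  obtain ⟨g₂, hg₂⟩ : ∃ g : E, ∀ h, inner ℝ g h = (R ζ + p) (0, h) :=
    ⟨(InnerProductSpace.toDual ℝ E).symm ((R ζ + p).comp (ContinuousLinearMap.inr ℝ E E)),
      fun h => by rw [InnerProductSpace.toDual_symm_apply]; simp⟩
  have hid : ∀ g a z : E, k / 2 * ‖z - (a - k⁻¹ • g)‖ ^ 2 =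
      k / 2 * ‖z - a‖ ^ 2 + inner ℝ g (z - a) + k / 2 * ‖a - (a - k⁻¹ • g)‖ ^ 2 := by
    intro g a z
    have h1 : z - (a - k⁻¹ • g) = (z - a) + k⁻¹ • g := by abel
    rw [h1, sub_sub_cancel, norm_add_sq_real, inner_smul_right, real_inner_comm]
    field_simp
  obtain ⟨x, hx, a, ha⟩ := hw₁ ζ.1 (ζ.1 - k⁻¹ • g₁)
  obtain ⟨y, hy, b, hb⟩ := hw₂ ζ.2 (ζ.2 - k⁻¹ • g₂)
  rw [hid g₁ ζ.1 a, hg₁] at ha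
  rw [hid g₂ ζ.2 b, hg₂] at hb
  have h1 := hle x hx y hy (a, b)
  have h2 : (R ζ + p) (a - ζ.1, 0) + (R ζ + p) (0, b - ζ.2) = (R ζ + p) ((a, b) - ζ) := by
    rw [← map_add]; congr 1; ext <;> simp
  have h3 := hRk ((a, b) - ζ)
  have h4 : R (a, b) (a, b) = R ζ ζ + 2 * R ζ ((a, b) - ζ) + R ((a, b) - ζ) ((a, b) - ζ) := by
    simp only [map_sub, FunLike.coe_sub, Pi.sub_apply, hR (a, b) ζ]
    ring
  have h5 : p ((a, b) - ζ) = p (a, b) - p ζ := map_sub _ _ _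
  simp only [FunLike.coe_add, Pi.add_apply] at h2
  simp only [FunLike.coe_add, Pi.add_apply] at ha hb
  simp only [Prod.fst_sub, Prod.snd_sub] at h3
  dsimp only at h1
  linarith

set_option maxHeartbeats 1000000 in
set_option maxSynthPendingDepth 5 in
/-- The theorem on sums at the origin, in approximate form. -/
theorem exists_approx_jets_zero {E : Type*} [NormedAddCommGroup E] [InnerProductSpace ℝ E]
    [FiniteDimensional ℝ E] {C₁ C₂ : Set E} (hC₁ : IsCompact C₁) (hC₂ : IsCompact C₂)
    (h₁ : (0 : E) ∈ C₁) (h₂ : (0 : E) ∈ C₂) {u₁ u₂ : E → ℝ}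
    (hu₁ : UpperSemicontinuousOn u₁ C₁) (hu₂ : UpperSemicontinuousOn u₂ C₂)
    (h0₁ : u₁ 0 = 0) (h0₂ : u₂ 0 = 0) {R : E × E →L[ℝ] E × E →L[ℝ] ℝ}
    (hR : ∀ z w, R z w = R w z) {l θ : ℝ} (hl : 0 < l) (hθ : 0 < θ)
    (hH : ∀ x ∈ C₁, ∀ y ∈ C₂, ∀ ξ : E × E,
      u₁ x + u₂ y - l / 2 * (‖x - ξ.1‖ ^ 2 + ‖y - ξ.2‖ ^ 2) ≤
        1 / 2 * R ξ ξ - θ / 2 * (‖ξ.1‖ ^ 2 + ‖ξ.2‖ ^ 2)) {δ : ℝ} (hδ : 0 < δ) :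
    ∃ x ∈ C₁, ∃ y ∈ C₂, ∃ (p q : E →L[ℝ] ℝ) (X Y : E →L[ℝ] E →L[ℝ] ℝ),
      ‖x‖ < δ ∧ ‖y‖ < δ ∧ ‖p‖ < δ ∧ ‖q‖ < δ ∧ |u₁ x| < δ ∧ |u₂ y| < δ ∧
      (∀ h k, X h k = X k h) ∧ (∀ h k, Y h k = Y k h) ∧
      (∀ ε > 0, ∃ r > 0, ∀ x' ∈ C₁, ‖x' - x‖ < r →
        u₁ x' ≤ u₁ x + p (x' - x) + 1 / 2 * X (x' - x) (x' - x) + ε * ‖x' - x‖ ^ 2) ∧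
      (∀ ε > 0, ∃ r > 0, ∀ y' ∈ C₂, ‖y' - y‖ < r →
        u₂ y' ≤ u₂ y + q (y' - y) + 1 / 2 * Y (y' - y) (y' - y) + ε * ‖y' - y‖ ^ 2) ∧
      (∀ h, -l * ‖h‖ ^ 2 ≤ X h h) ∧ (∀ h, -l * ‖h‖ ^ 2 ≤ Y h h) ∧
      (∀ h k, X h h + Y k k ≤ R (h, k) (h, k)) := by
  obtain ⟨k, hk, hRk⟩ : ∃ k : ℝ, 0 < k ∧ ∀ z : E × E, R z z ≤ k * (‖z.1‖ ^ 2 + ‖z.2‖ ^ 2) := by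
    refine ⟨‖R‖ + 1, by positivity, fun z => ?_⟩
    have h3 := le_of_abs_le (R.le_opNorm₂ z z)
    have h4 := norm_sq_le_norm_fst_sq_add_norm_snd_sq z
    nlinarith [norm_nonneg R, sq_nonneg ‖z.1‖, sq_nonneg ‖z.2‖]
  obtain ⟨w₁, w₁', K₁, hLip₁, hder₁, hlow₁, hhull₁⟩ := exists_lasryLions hC₁ ⟨0, h₁⟩ hu₁ hl hk
  obtain ⟨w₂, w₂', K₂, hLip₂, hder₂, hlow₂, hhull₂⟩ := exists_lasryLions hC₂ ⟨0, h₂⟩ hu₂ hl hk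
  -- smallness of the perturbation
  obtain ⟨d₁, hd₁, hd₁'⟩ : ∃ d > 0, ∀ x ∈ C₁, ‖x‖ < d → u₁ x < δ / 2 := by
    have : ∀ᶠ x in 𝓝[C₁] 0, u₁ x < δ / 2 := hu₁ 0 h₁ (δ / 2) (by simpa [h0₁] using hδ)
    obtain ⟨d, hd, hd'⟩ := Metric.eventually_nhds_iff.1 (eventually_nhdsWithin_iff.1 this)
    exact ⟨d, hd, fun x hx hxd => hd' (by simpa using hxd) hx⟩
  obtain ⟨d₂, hd₂, hd₂'⟩ : ∃ d > 0, ∀ x ∈ C₂, ‖x‖ < d → u₂ x < δ / 2 := by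
    have : ∀ᶠ x in 𝓝[C₂] 0, u₂ x < δ / 2 := hu₂ 0 h₂ (δ / 2) (by simpa [h0₂] using hδ)
    obtain ⟨d, hd, hd'⟩ := Metric.eventually_nhds_iff.1 (eventually_nhdsWithin_iff.1 this)
    exact ⟨d, hd, fun x hx hxd => hd' (by simpa using hxd) hx⟩
  obtain ⟨ρ, hρ, hρ1, hρ2, hρ3⟩ : ∃ ρ > 0, ‖R‖ * (2 * ρ / θ) + ρ < δ ∧
      2 * ρ / θ + (‖R‖ * (2 * ρ / θ) + ρ) / l < min δ (min d₁ d₂) ∧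
      1 / 2 * ‖R‖ * (2 * ρ / θ) ^ 2 + ρ * (2 * ρ / θ) < δ / 2 := by
    have e1 : Tendsto (fun ρ : ℝ => ‖R‖ * (2 * ρ / θ) + ρ) (𝓝 0) (𝓝 0) :=
      Continuous.tendsto' (by fun_prop) _ _ (by simp)
    have e2 : Tendsto (fun ρ : ℝ => 2 * ρ / θ + (‖R‖ * (2 * ρ / θ) + ρ) / l) (𝓝 0) (𝓝 0) :=
      Continuous.tendsto' (by fun_prop) _ _ (by simp)
    have e3 : Tendsto (fun ρ : ℝ => 1 / 2 * ‖R‖ * (2 * ρ / θ) ^ 2 + ρ * (2 * ρ / θ))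
        (𝓝 0) (𝓝 0) :=
      Continuous.tendsto' (by fun_prop) _ _ (by simp)
    have hev := (e1.eventually (gt_mem_nhds hδ)).and ((e2.eventually (gt_mem_nhds
      (lt_min hδ (lt_min hd₁ hd₂)))).and (e3.eventually (gt_mem_nhds (half_pos hδ))))
    obtain ⟨ρ, hρ, hρ0⟩ := ((hev.filter_mono nhdsWithin_le_nhds).and
      (self_mem_nhdsWithin : Set.Ioi (0 : ℝ) ∈ 𝓝[>] 0)).exists
    exact ⟨ρ, hρ0, hρ⟩
  -- the choice of the perturbation
  obtain ⟨J₁, hJ₁⟩ : ∃ J : (E →L[ℝ] ℝ) →L[ℝ] (E × E →L[ℝ] ℝ), ∀ a z, J a z = a z.1 :=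
    ⟨(ContinuousLinearMap.compL ℝ (E × E) E ℝ).flip (ContinuousLinearMap.fst ℝ E E),
      fun _ _ => rfl⟩
  obtain ⟨J₂, hJ₂⟩ : ∃ J : (E →L[ℝ] ℝ) →L[ℝ] (E × E →L[ℝ] ℝ), ∀ a z, J a z = a z.2 :=
    ⟨(ContinuousLinearMap.compL ℝ (E × E) E ℝ).flip (ContinuousLinearMap.snd ℝ E E),
      fun _ _ => rfl⟩
  have hLip₁' : LipschitzWith (K₁ * 1) fun z : E × E => w₁' z.1 := hLip₁.comp LipschitzWith.prod_fst
  have hLip₂' : LipschitzWith (K₂ * 1) fun z : E × E => w₂' z.2 := hLip₂.comp LipschitzWith.prod_snd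
  have hdim : Module.finrank ℝ (E × E) = Module.finrank ℝ (E × E →L[ℝ] ℝ) := by
    rw [← (LinearMap.toContinuousLinearMap (𝕜 := ℝ) (E := E × E) (F' := ℝ)).finrank_eq]
    exact (Subspace.dual_finrank_eq (K := ℝ) (V := E × E)).symm
  obtain ⟨K, hΨ⟩ : ∃ K, LipschitzWith K fun z : E × E => J₁ (w₁' z.1) + J₂ (w₂' z.2) - R z :=
    ⟨_, ((J₁.lipschitz.comp hLip₁').add (J₂.lipschitz.comp hLip₂')).sub R.lipschitz⟩
  obtain ⟨p, hpρ, hp⟩ :=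
    exists_notMem_image_not_differentiableAt hdim (hLip₁'.prodMk hLip₂') hΨ hρ
  obtain ⟨x, hx, y, hy, ξ, hξ, hpos, hmax⟩ :=
    exists_isMax_perturbed hC₁ hC₂ h₁ h₂ hu₁ hu₂ h0₁ h0₂ R hθ hH p
  have hquad := add_le_quadratic_of_hull hR hk hRk p hhull₁ hhull₂ hmax
  have hξquad := hquad ξ
  have hlx := hlow₁ ξ.1 x hx
  have hly := hlow₂ ξ.2 y hy
  have heq₁ : w₁ ξ.1 = u₁ x - l / 2 * ‖x - ξ.1‖ ^ 2 := by linarith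
  have heq₂ : w₂ ξ.2 = u₂ y - l / 2 * ‖y - ξ.2‖ ^ 2 := by linarith
  have hW : ∀ z : E × E, HasFDerivAt (fun z : E × E => w₁ z.1 + w₂ z.2)
      (J₁ (w₁' z.1) + J₂ (w₂' z.2)) z := by
    intro z
    refine (((hder₁ z.1).comp z hasFDerivAt_fst).add
      ((hder₂ z.2).comp z hasFDerivAt_snd)).congr_fderiv ?_
    ext h <;> simp [hJ₁, hJ₂]
  have hquad' : ∀ h, w₁ (ξ + h).1 + w₂ (ξ + h).2 ≤
      w₁ ξ.1 + w₂ ξ.2 + (R ξ + p) h + 1 / 2 * R h h := by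
    intro h
    have h3 := hquad (ξ + h)
    simp only [map_add, FunLike.coe_add, Pi.add_apply, hR h ξ] at h3 ⊢
    linarith
  have hfirst : J₁ (w₁' ξ.1) + J₂ (w₂' ξ.2) = R ξ + p := by
    have hW0 := hW ξ
    have h4 : HasFDerivAt (fun z => w₁ z.1 + w₂ z.2 - 1 / 2 * R (z - ξ) (z - ξ))
        (J₁ (w₁' ξ.1) + J₂ (w₂' ξ.2)) ξ := by
      have h5 : HasFDerivAt (fun z => R (z - ξ) (z - ξ)) (0 : E × E →L[ℝ] ℝ) ξ := by
        have h6 : HasFDerivAt (fun z : E × E => z - ξ) (ContinuousLinearMap.id ℝ (E × E)) ξ :=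
          (hasFDerivAt_id ξ).sub_const ξ
        refine ((R.hasFDerivAt.comp ξ h6).clm_apply h6).congr_fderiv ?_
        ext k <;> simp
      exact (hW0.sub (h5.const_mul (1 / 2))).congr_fderiv (by rw [smul_zero, sub_zero])
    have h5 : IsLocalMax (fun z => w₁ z.1 + w₂ z.2 - 1 / 2 * R (z - ξ) (z - ξ) - (R ξ + p) z)
        ξ := by
      refine Eventually.of_forall fun z => ?_
      have h6 := hquad' (z - ξ)
      rw [add_sub_cancel, map_sub (R ξ + p)] at h6
      simp only [sub_self, map_zero, mul_zero, sub_zero]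
      linarith
    exact sub_eq_zero.1 (h5.hasFDerivAt_eq_zero (h4.sub (R ξ + p).hasFDerivAt))
  have hdiff := hp ξ (by
    rw [hfirst, add_sub_cancel_left])
  have hdiff₁ : DifferentiableAt ℝ w₁' ξ.1 := by
    have h3 : DifferentiableAt ℝ (fun a : E => (a, ξ.2)) ξ.1 := by fun_prop
    exact (hdiff.comp ξ.1 h3 (g := fun z : E × E => (w₁' z.1, w₂' z.2))).fst
  have hdiff₂ : DifferentiableAt ℝ w₂' ξ.2 := by
    have h3 : DifferentiableAt ℝ (fun a : E => (ξ.1, a)) ξ.2 := by fun_prop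
    exact (hdiff.comp ξ.2 h3 (g := fun z : E × E => (w₁' z.1, w₂' z.2))).snd
  obtain ⟨X, hX⟩ := hdiff₁
  obtain ⟨Y, hY⟩ := hdiff₂
  have hW' : HasFDerivAt (fun z : E × E => J₁ (w₁' z.1) + J₂ (w₂' z.2))
      ((J₁.comp X).comp (ContinuousLinearMap.fst ℝ E E) +
        (J₂.comp Y).comp (ContinuousLinearMap.snd ℝ E E)) ξ :=
    ((J₁.hasFDerivAt.comp ξ.1 hX).comp ξ hasFDerivAt_fst).add
      ((J₂.hasFDerivAt.comp ξ.2 hY).comp ξ hasFDerivAt_snd)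
  have hsecond := (eq_and_le_of_forall_le_quadratic (Eventually.of_forall hW) hW' hquad').2
  obtain ⟨hx1, hx2⟩ := eq_and_le_of_forall_paraboloid_le hder₁ hX (fun ζ => hlow₁ ζ x hx) heq₁
  obtain ⟨hy1, hy2⟩ := eq_and_le_of_forall_paraboloid_le hder₂ hY (fun ζ => hlow₂ ζ y hy) heq₂
  -- norm bounds
  have hξρ : ‖ξ‖ ≤ 2 * ρ / θ := hξ.trans (by gcongr)
  have hRp : ‖R ξ + p‖ ≤ ‖R‖ * (2 * ρ / θ) + ρ :=
    (norm_add_le _ _).trans (add_le_add ((R.le_opNorm ξ).trans (by gcongr)) hpρ.le)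
  have hw₁n : ‖w₁' ξ.1‖ ≤ ‖R‖ * (2 * ρ / θ) + ρ := by
    refine ContinuousLinearMap.opNorm_le_bound _ (by positivity) fun h => ?_
    have h3 : w₁' ξ.1 h = (R ξ + p) (h, 0) := by rw [← hfirst]; simp [hJ₁, hJ₂]
    rw [h3]
    refine ((R ξ + p).le_opNorm _).trans ?_
    simp only [Prod.norm_def, norm_zero, norm_nonneg, sup_of_le_left]
    gcongr
  have hw₂n : ‖w₂' ξ.2‖ ≤ ‖R‖ * (2 * ρ / θ) + ρ := by
    refine ContinuousLinearMap.opNorm_le_bound _ (by positivity) fun h => ?_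
    have h3 : w₂' ξ.2 h = (R ξ + p) (0, h) := by rw [← hfirst]; simp [hJ₁, hJ₂]
    rw [h3]
    refine ((R ξ + p).le_opNorm _).trans ?_
    simp only [Prod.norm_def, norm_zero, norm_nonneg, sup_of_le_right]
    gcongr
  have hnear : ∀ (a b : E) (f : E →L[ℝ] ℝ), f = l • innerSL ℝ (a - b) →
      ‖b‖ ≤ 2 * ρ / θ → ‖f‖ ≤ ‖R‖ * (2 * ρ / θ) + ρ → ‖a‖ < min δ (min d₁ d₂) := by
    intro a b f hf hb hfn
    refine lt_of_le_of_lt ?_ hρ2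
    rw [hf, norm_smul, innerSL_apply_norm, Real.norm_of_nonneg hl.le] at hfn
    have h3 : ‖a - b‖ ≤ (‖R‖ * (2 * ρ / θ) + ρ) / l := by
      rw [le_div_iff₀ hl, mul_comm]; exact hfn
    calc ‖a‖ = ‖b + (a - b)‖ := by rw [add_sub_cancel]
      _ ≤ ‖b‖ + ‖a - b‖ := norm_add_le _ _
      _ ≤ _ := add_le_add hb h3
  have hxn := hnear x ξ.1 _ hx1 ((norm_fst_le ξ).trans hξρ) hw₁n
  have hyn := hnear y ξ.2 _ hy1 ((norm_snd_le ξ).trans hξρ) hw₂n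
  have hux := hd₁' x hx (hxn.trans_le ((min_le_right _ _).trans (min_le_left _ _)))
  have huy := hd₂' y hy (hyn.trans_le ((min_le_right _ _).trans (min_le_right _ _)))
  have hsum : -(δ / 2) < u₁ x + u₂ y := by
    have h3 := neg_le_of_abs_le (R.le_opNorm₂ ξ ξ)
    have h4 := neg_le_of_abs_le (p.le_opNorm ξ)
    have h5 : ‖R‖ * ‖ξ‖ * ‖ξ‖ ≤ ‖R‖ * (2 * ρ / θ) * (2 * ρ / θ) := by gcongr
    have h6 : ‖p‖ * ‖ξ‖ ≤ ρ * (2 * ρ / θ) := by gcongr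
    have h7 : 0 ≤ l / 2 * (‖x - ξ.1‖ ^ 2 + ‖y - ξ.2‖ ^ 2) := by positivity
    nlinarith
  refine ⟨x, hx, y, hy, w₁' ξ.1, w₂' ξ.2, X, Y, hxn.trans_le (min_le_left _ _),
    hyn.trans_le (min_le_left _ _), hw₁n.trans_lt hρ1, hw₂n.trans_lt hρ1,
    abs_lt.2 ⟨by linarith, by linarith⟩, abs_lt.2 ⟨by linarith, by linarith⟩,
    second_derivative_symmetric_of_eventually (Eventually.of_forall hder₁) hX,
    second_derivative_symmetric_of_eventually (Eventually.of_forall hder₂) hY,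
    fun ε hε => exists_superjet_of_translate hder₁ hX (fun x' hx' => ?_) hε,
    fun ε hε => exists_superjet_of_translate hder₂ hY (fun y' hy' => ?_) hε,
    hx2, hy2, fun h k => ?_⟩
  · have h3 := hlow₁ (ξ.1 + (x' - x)) x' hx'
    have h4 : x' - (ξ.1 + (x' - x)) = x - ξ.1 := by abel
    rw [h4] at h3
    linarith
  · have h3 := hlow₂ (ξ.2 + (y' - y)) y' hy'
    have h4 : y' - (ξ.2 + (y' - y)) = y - ξ.2 := by abel
    rw [h4] at h3
    linarith
  · have h3 := hsecond (h, k)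
    change J₁ (X h) (h, k) + J₂ (Y k) (h, k) ≤ _ at h3
    rwa [hJ₁, hJ₂] at h3

theorem EuclideanSpace.sum_smul_single {n : ℕ} (h : EuclideanSpace ℝ (Fin n)) :
    ∑ i, h i • EuclideanSpace.single i (1 : ℝ) = h := by
  ext j
  simp [Pi.single_apply]

theorem EuclideanSpace.apply_eq_sum {n : ℕ} (f : EuclideanSpace ℝ (Fin n) →L[ℝ] ℝ)
    (h : EuclideanSpace ℝ (Fin n)) :
    f h = ∑ i, f (EuclideanSpace.single i 1) * h i := by
  conv_lhs => rw [← EuclideanSpace.sum_smul_single h]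
  simp [map_sum, mul_comm]

theorem EuclideanSpace.apply_apply_eq_dotProduct {n : ℕ}
    (X : EuclideanSpace ℝ (Fin n) →L[ℝ] EuclideanSpace ℝ (Fin n) →L[ℝ] ℝ)
    (h : EuclideanSpace ℝ (Fin n)) :
    X h h = h ⬝ᵥ (Matrix.of fun i j =>
      X (EuclideanSpace.single i 1) (EuclideanSpace.single j 1)) *ᵥ h := by
  have h1 : X h h = ∑ i, h i * X (EuclideanSpace.single i 1) h := by
    refine (congrArg (fun v => X v h) (EuclideanSpace.sum_smul_single h).symm).trans ?_
    simp [map_sum]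
  rw [h1]
  refine Finset.sum_congr rfl fun i _ => ?_
  rw [EuclideanSpace.apply_eq_sum]
  rfl

theorem sum_smul_prodBasis {n : ℕ}
    (z : EuclideanSpace ℝ (Fin n) × EuclideanSpace ℝ (Fin n)) :
    ∑ a, Sum.elim z.1 z.2 a • prodBasis a = z := by
  rw [Fintype.sum_sum_type]
  ext j <;> simp [prodBasis, Prod.fst_sum, Prod.snd_sum, Pi.single_apply]

theorem apply_apply_eq_dotProduct_prodBasis {n : ℕ}
    (A : EuclideanSpace ℝ (Fin n) × EuclideanSpace ℝ (Fin n) →L[ℝ]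
      EuclideanSpace ℝ (Fin n) × EuclideanSpace ℝ (Fin n) →L[ℝ] ℝ)
    (z : EuclideanSpace ℝ (Fin n) × EuclideanSpace ℝ (Fin n)) :
    A z z = Sum.elim z.1 z.2 ⬝ᵥ
      (Matrix.of fun a b => A (prodBasis a) (prodBasis b)) *ᵥ Sum.elim z.1 z.2 := by
  have h1 : A z z = ∑ a, Sum.elim z.1 z.2 a * A (prodBasis a) z := by
    refine (congrArg (fun v => A v z) (sum_smul_prodBasis z).symm).trans ?_
    simp [map_sum]
  rw [h1]
  refine Finset.sum_congr rfl fun a _ => ?_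
  congr 1
  conv_lhs => rw [← sum_smul_prodBasis z]
  simp [map_sum, mulVec, dotProduct, mul_comm]

theorem dotProduct_self_sumElim {n : ℕ} (x y : EuclideanSpace ℝ (Fin n)) :
    Sum.elim x y ⬝ᵥ Sum.elim x y = ‖x‖ ^ 2 + ‖y‖ ^ 2 := by
  simp [dotProduct, EuclideanSpace.real_norm_sq_eq, ← sq]

/-- The continuous bilinear form on `ℝⁿ × ℝⁿ` given by a matrix. -/
theorem exists_bilinear_of_matrix {n : ℕ} (M : Matrix (Fin n ⊕ Fin n) (Fin n ⊕ Fin n) ℝ) :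
    ∃ R : EuclideanSpace ℝ (Fin n) × EuclideanSpace ℝ (Fin n) →L[ℝ]
      EuclideanSpace ℝ (Fin n) × EuclideanSpace ℝ (Fin n) →L[ℝ] ℝ,
      ∀ z w, R z w = Sum.elim z.1 z.2 ⬝ᵥ M *ᵥ Sum.elim w.1 w.2 := by
  obtain ⟨c, hc⟩ : ∃ c : Fin n ⊕ Fin n →
      EuclideanSpace ℝ (Fin n) × EuclideanSpace ℝ (Fin n) →L[ℝ] ℝ,
      ∀ a z, c a z = Sum.elim z.1 z.2 a :=
    ⟨Sum.elim (fun i => (EuclideanSpace.proj i).comp (ContinuousLinearMap.fst ℝ _ _))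
      (fun i => (EuclideanSpace.proj i).comp (ContinuousLinearMap.snd ℝ _ _)),
      by rintro (i | i) z <;> rfl⟩
  refine ⟨∑ a, (c a).smulRight (∑ b, M a b • c b), fun z w => ?_⟩
  simp [hc, dotProduct, mulVec, mul_add]

/-- The quadratic inequality behind the matrix bound in the theorem on sums. -/
theorem dotProduct_mulVec_le_of_symm {ι : Type*} [Fintype ι] {H : Matrix ι ι ℝ}
    (hH : H.IsSymm) {m μ : ℝ} (hμ : 0 < μ) (hm : ∀ s, s ⬝ᵥ H *ᵥ s ≤ m * (s ⬝ᵥ s)) (s t : ι → ℝ) :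
    s ⬝ᵥ H *ᵥ s ≤ t ⬝ᵥ (H + μ⁻¹ • (H * H)) *ᵥ t + (μ + m) * ((s - t) ⬝ᵥ (s - t)) := by
  obtain ⟨d, rfl⟩ : ∃ d, s = t + d := ⟨s - t, by abel⟩
  have h1 := hm d
  have h2 : t ⬝ᵥ H *ᵥ d = d ⬝ᵥ H *ᵥ t := by
    rw [dotProduct_mulVec, ← mulVec_transpose, hH.eq, dotProduct_comm]
  have h3 : t ⬝ᵥ (H * H) *ᵥ t = H *ᵥ t ⬝ᵥ H *ᵥ t := by
    rw [← mulVec_mulVec, dotProduct_mulVec, ← mulVec_transpose, hH.eq]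
  have h4 : 2 * (d ⬝ᵥ H *ᵥ t) ≤ μ * (d ⬝ᵥ d) + μ⁻¹ * (H *ᵥ t ⬝ᵥ H *ᵥ t) := by
    simp only [dotProduct, Finset.mul_sum, ← Finset.sum_add_distrib]
    refine Finset.sum_le_sum fun i _ => ?_
    have h5 : 0 ≤ μ * (d i - μ⁻¹ * (H *ᵥ t) i) ^ 2 := by positivity
    have h6 : μ * (d i - μ⁻¹ * (H *ᵥ t) i) ^ 2 = μ * (d i * d i) +
        μ⁻¹ * ((H *ᵥ t) i * (H *ᵥ t) i) - 2 * (d i * (H *ᵥ t) i) := by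
      field_simp
      ring
    linarith
  simp only [add_sub_cancel_left, mulVec_add, add_mulVec, add_dotProduct, dotProduct_add,
    smul_mulVec, dotProduct_smul, smul_eq_mul, h3, h2] at h1 ⊢
  linarith

/-- Translating a superjet given by linear forms, plus a linear term, to a superjet given by a
vector and a matrix. -/
theorem mem_secondOrderSuperjet_of_translate {n : ℕ} {Ω : Set (EuclideanSpace ℝ (Fin n))}
    {u u₁ : EuclideanSpace ℝ (Fin n) → ℝ} {xhat x : EuclideanSpace ℝ (Fin n)} {r : ℝ}
    {p L : EuclideanSpace ℝ (Fin n) →L[ℝ] ℝ}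
    {X : EuclideanSpace ℝ (Fin n) →L[ℝ] EuclideanSpace ℝ (Fin n) →L[ℝ] ℝ}
    (hu : ∀ y, u (xhat + y) = u₁ y + u xhat + L y) (hx : ‖x‖ < r) (hX : ∀ h k, X h k = X k h)
    (hjet : ∀ ε > 0, ∃ δ > 0, ∀ y ∈ Metric.closedBall (0 : EuclideanSpace ℝ (Fin n)) r,
      ‖y - x‖ < δ →
        u₁ y ≤ u₁ x + p (y - x) + 1 / 2 * X (y - x) (y - x) + ε * ‖y - x‖ ^ 2) :
    ((fun i => (p + L) (EuclideanSpace.single i 1)), Matrix.of fun i j =>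
      X (EuclideanSpace.single i 1) (EuclideanSpace.single j 1)) ∈
        secondOrderSuperjet Ω u (xhat + x) := by
  refine ⟨Matrix.IsSymm.ext fun i j => hX _ _, fun ε hε => ?_⟩
  obtain ⟨δ, hδ, hle⟩ := hjet ε hε
  refine ⟨min δ (r - ‖x‖), lt_min hδ (sub_pos.2 hx), fun y _ hy => ?_⟩
  obtain ⟨z, rfl⟩ : ∃ z, y = xhat + z := ⟨y - xhat, by abel⟩
  rw [add_sub_add_left_eq_sub] at hy ⊢
  have hz : z ∈ Metric.closedBall (0 : EuclideanSpace ℝ (Fin n)) r := by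
    rw [mem_closedBall_zero_iff]
    have h1 := norm_sub_norm_le z x
    have h2 := hy.trans_le (min_le_right _ _)
    linarith
  have h3 := hle z hz (hy.trans_le (min_le_left _ _))
  have h5 : (xhat + z).ofLp - (xhat + x).ofLp = (z - x).ofLp := by simp
  dsimp only
  rw [h5, ← EuclideanSpace.apply_eq_sum, dotProduct_comm,
    ← EuclideanSpace.apply_apply_eq_dotProduct, hu, hu]
  have h4 : L (z - x) = L z - L x := map_sub _ _ _
  simp only [FunLike.coe_add, Pi.add_apply]
  linarith

/-- The theorem on sums in approximate form. -/
theorem exists_approx_jets {n : ℕ} {Ω : Set (EuclideanSpace ℝ (Fin n))} (hΩ : IsOpen Ω)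
    {u v : EuclideanSpace ℝ (Fin n) → ℝ} (hu : UpperSemicontinuousOn u Ω)
    (hv : UpperSemicontinuousOn v Ω)
    {φ : EuclideanSpace ℝ (Fin n) × EuclideanSpace ℝ (Fin n) → ℝ}
    {φ' : EuclideanSpace ℝ (Fin n) × EuclideanSpace ℝ (Fin n) →
      EuclideanSpace ℝ (Fin n) × EuclideanSpace ℝ (Fin n) →L[ℝ] ℝ}
    {A : EuclideanSpace ℝ (Fin n) × EuclideanSpace ℝ (Fin n) →L[ℝ]
      EuclideanSpace ℝ (Fin n) × EuclideanSpace ℝ (Fin n) →L[ℝ] ℝ}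
    {xhat yhat : EuclideanSpace ℝ (Fin n)} (hx : xhat ∈ Ω) (hy : yhat ∈ Ω)
    (hφ : ∀ᶠ z in 𝓝 (xhat, yhat), HasFDerivAt φ (φ' z) z) (hφ' : HasFDerivAt φ' A (xhat, yhat))
    (hmax : ∀ x ∈ Ω, ∀ y ∈ Ω, u x + v y - φ (x, y) ≤ u xhat + v yhat - φ (xhat, yhat))
    {H : Matrix (Fin n ⊕ Fin n) (Fin n ⊕ Fin n) ℝ} (hH : H.IsSymm)
    (hA : ∀ z, A z z = Sum.elim z.1 z.2 ⬝ᵥ H *ᵥ Sum.elim z.1 z.2) {m μ ε : ℝ} (hm0 : 0 ≤ m)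
    (hm : ∀ s, s ⬝ᵥ H *ᵥ s ≤ m * (s ⬝ᵥ s)) (hμ : 0 < μ) (hε : 0 < ε) :
    ∃ x ∈ Ω, ∃ y ∈ Ω, ∃ (p q : Fin n → ℝ) (X Y : Matrix (Fin n) (Fin n) ℝ),
      ‖x - xhat‖ < ε ∧ ‖y - yhat‖ < ε ∧ |u x - u xhat| < ε ∧ |v y - v yhat| < ε ∧
      (∀ i, |p i - φ' (xhat, yhat) (prodBasis (Sum.inl i))| < ε) ∧
      (∀ i, |q i - φ' (xhat, yhat) (prodBasis (Sum.inr i))| < ε) ∧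
      (p, X) ∈ secondOrderSuperjet Ω u x ∧ (q, Y) ∈ secondOrderSuperjet Ω v y ∧
      (∀ h, -(μ + m + ε) * (h ⬝ᵥ h) ≤ h ⬝ᵥ X *ᵥ h) ∧
      (∀ h, -(μ + m + ε) * (h ⬝ᵥ h) ≤ h ⬝ᵥ Y *ᵥ h) ∧
      ∀ h k, h ⬝ᵥ X *ᵥ h + k ⬝ᵥ Y *ᵥ k ≤
        Sum.elim h k ⬝ᵥ (H + μ⁻¹ • (H * H)) *ᵥ Sum.elim h k +
          ε * (Sum.elim h k ⬝ᵥ Sum.elim h k) := by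
  obtain ⟨L₁, hL₁⟩ : ∃ L : EuclideanSpace ℝ (Fin n) →L[ℝ] ℝ,
      ∀ h, L h = φ' (xhat, yhat) (h, 0) :=
    ⟨(φ' (xhat, yhat)).comp (ContinuousLinearMap.inl ℝ _ _), fun _ => rfl⟩
  obtain ⟨L₂, hL₂⟩ : ∃ L : EuclideanSpace ℝ (Fin n) →L[ℝ] ℝ,
      ∀ h, L h = φ' (xhat, yhat) (0, h) :=
    ⟨(φ' (xhat, yhat)).comp (ContinuousLinearMap.inr ℝ _ _), fun _ => rfl⟩
  obtain ⟨r₀, hr₀, htaylor⟩ := exists_forall_abs_taylor_two_le hφ hφ' (ε := ε / 8) (by positivity)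
  obtain ⟨r₁, hr₁, hball₁⟩ := Metric.isOpen_iff.1 hΩ xhat hx
  obtain ⟨r₂, hr₂, hball₂⟩ := Metric.isOpen_iff.1 hΩ yhat hy
  obtain ⟨r, hr, hrlt⟩ := exists_between (lt_min hr₀ (lt_min hr₁ hr₂))
  obtain ⟨hrr₀, hrr₁, hrr₂⟩ : r < r₀ ∧ r < r₁ ∧ r < r₂ := by simpa only [lt_min_iff] using hrlt
  have hmem₁ : ∀ x ∈ Metric.closedBall (0 : EuclideanSpace ℝ (Fin n)) r, xhat + x ∈ Ω :=
    fun x hx => hball₁ (by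
      rw [mem_closedBall_zero_iff] at hx
      simpa [mem_ball_iff_norm] using hx.trans_lt hrr₁)
  have hmem₂ : ∀ y ∈ Metric.closedBall (0 : EuclideanSpace ℝ (Fin n)) r, yhat + y ∈ Ω :=
    fun y hy => hball₂ (by
      rw [mem_closedBall_zero_iff] at hy
      simpa [mem_ball_iff_norm] using hy.trans_lt hrr₂)
  have husc : ∀ (w : EuclideanSpace ℝ (Fin n) → ℝ) (a : EuclideanSpace ℝ (Fin n))
      (L : EuclideanSpace ℝ (Fin n) →L[ℝ] ℝ), UpperSemicontinuousOn w Ω →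
      (∀ x ∈ Metric.closedBall (0 : EuclideanSpace ℝ (Fin n)) r, a + x ∈ Ω) →
      UpperSemicontinuousOn (fun x => w (a + x) - w a - L x)
        (Metric.closedBall (0 : EuclideanSpace ℝ (Fin n)) r) := by
    intro w a L hw ha
    have h1 : UpperSemicontinuousOn (fun x => w (a + x))
        (Metric.closedBall (0 : EuclideanSpace ℝ (Fin n)) r) :=
      hw.comp (by fun_prop) ha
    have h2 : ContinuousOn (fun x => -w a - L x)
        (Metric.closedBall (0 : EuclideanSpace ℝ (Fin n)) r) := by fun_prop
    have h3 : (fun x => w (a + x) - w a - L x) = fun x => w (a + x) + (-w a - L x) := by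
      ext x
      ring
    rw [h3]
    exact h1.add h2.upperSemicontinuousOn
  obtain ⟨R, hR⟩ := exists_bilinear_of_matrix
    (H + μ⁻¹ • (H * H) + ε • (1 : Matrix (Fin n ⊕ Fin n) (Fin n ⊕ Fin n) ℝ))
  have hRsymm : ∀ z w, R z w = R w z := by
    intro z w
    have h1 : (H + μ⁻¹ • (H * H) + ε • (1 : Matrix (Fin n ⊕ Fin n) (Fin n ⊕ Fin n) ℝ))ᵀ =
        H + μ⁻¹ • (H * H) + ε • (1 : Matrix (Fin n ⊕ Fin n) (Fin n ⊕ Fin n) ℝ) := by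
      simp [transpose_mul, hH.eq]
    rw [hR, hR, dotProduct_mulVec, ← mulVec_transpose, h1, dotProduct_comm]
  have hRR : ∀ h k : EuclideanSpace ℝ (Fin n), R (h, k) (h, k) =
      Sum.elim h k ⬝ᵥ (H + μ⁻¹ • (H * H)) *ᵥ Sum.elim h k +
        ε * (Sum.elim h k ⬝ᵥ Sum.elim h k) := by
    intro h k
    rw [hR, add_mulVec, dotProduct_add, smul_mulVec, one_mulVec, dotProduct_smul, smul_eq_mul]
  have hδ : 0 < min r (ε / (1 + ‖φ' (xhat, yhat)‖)) := lt_min hr (by positivity)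
  have hdiag : ∀ a b : EuclideanSpace ℝ (Fin n),
      ε / 4 * ‖a‖ ^ 2 ≤ ε / 2 * ‖b‖ ^ 2 + ε / 2 * ‖a - b‖ ^ 2 := by
    intro a b
    have h1 : ‖a‖ ≤ ‖b‖ + ‖a - b‖ := by simpa using norm_add_le b (a - b)
    have h2 : ‖a‖ ^ 2 ≤ (‖b‖ + ‖a - b‖) ^ 2 := by gcongr
    nlinarith [mul_nonneg hε.le (sq_nonneg (‖b‖ - ‖a - b‖)), mul_le_mul_of_nonneg_left h2 hε.le]
  obtain ⟨x, hxr, y, hyr, p, q, X, Y, hxδ, hyδ, hpδ, hqδ, hux, hvy, hX, hY, hjx, hjy, hlx, hly,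
    hXY⟩ := exists_approx_jets_zero (isCompact_closedBall 0 r) (isCompact_closedBall 0 r)
      (Metric.mem_closedBall_self hr.le) (Metric.mem_closedBall_self hr.le)
      (husc u xhat L₁ hu hmem₁) (husc v yhat L₂ hv hmem₂) (by simp) (by simp) hRsymm
      (l := μ + m + ε / 2) (θ := ε / 2) (by positivity) (by positivity) (by
        intro x hx y hy ξ
        have h1 := hmax _ (hmem₁ x hx) _ (hmem₂ y hy)
        have hn : ‖((x, y) : EuclideanSpace ℝ (Fin n) × EuclideanSpace ℝ (Fin n))‖ < r₀ := by
          rw [mem_closedBall_zero_iff] at hx hy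
          exact (max_le hx hy).trans_lt hrr₀
        have h2 := le_of_abs_le (htaylor (x, y) hn)
        have h3 := dotProduct_mulVec_le_of_symm hH hμ hm (Sum.elim x y) (Sum.elim ξ.1 ξ.2)
        have h4 : Sum.elim x.ofLp y.ofLp - Sum.elim ξ.1.ofLp ξ.2.ofLp =
            Sum.elim (x - ξ.1).ofLp (y - ξ.2).ofLp := by
          ext (i | i) <;> simp
        have h5 := hRR ξ.1 ξ.2
        have h6 := norm_sq_le_norm_fst_sq_add_norm_snd_sq
          ((x, y) : EuclideanSpace ℝ (Fin n) × EuclideanSpace ℝ (Fin n))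
        have h7 : φ' (xhat, yhat) (x, y) = L₁ x + L₂ y := by
          rw [hL₁, hL₂, ← map_add]; simp
        rw [h4, dotProduct_self_sumElim] at h3
        rw [dotProduct_self_sumElim] at h5
        rw [hA, h7, Prod.mk_add_mk] at h2
        dsimp only at h2 h6
        have h8 := hdiag x ξ.1
        have h9 := hdiag y ξ.2
        have h10 := mul_le_mul_of_nonneg_left h6 hε.le
        rw [Prod.mk.eta] at h5
        linarith) hδ
  have hD : min r (ε / (1 + ‖φ' (xhat, yhat)‖)) * (1 + ‖φ' (xhat, yhat)‖) ≤ ε := by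
    rw [← le_div_iff₀ (by positivity)]
    exact min_le_right _ _
  have hδε : min r (ε / (1 + ‖φ' (xhat, yhat)‖)) ≤ ε := by
    nlinarith [norm_nonneg (φ' (xhat, yhat))]
  have hclose : ∀ (t : ℝ) (a : EuclideanSpace ℝ (Fin n) × EuclideanSpace ℝ (Fin n)),
      ‖a‖ < min r (ε / (1 + ‖φ' (xhat, yhat)‖)) →
      |t - φ' (xhat, yhat) a| < min r (ε / (1 + ‖φ' (xhat, yhat)‖)) → |t| < ε := by
    intro t a ha ht
    have h1 := (φ' (xhat, yhat)).le_opNorm a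
    rw [Real.norm_eq_abs] at h1
    have h2 := mul_le_mul_of_nonneg_left ha.le (norm_nonneg (φ' (xhat, yhat)))
    have h3 := abs_add_le (t - φ' (xhat, yhat) a) (φ' (xhat, yhat) a)
    rw [sub_add_cancel] at h3
    linarith
  have hcoord : ∀ f : EuclideanSpace ℝ (Fin n) →L[ℝ] ℝ, ∀ i,
      ‖f‖ < min r (ε / (1 + ‖φ' (xhat, yhat)‖)) → |f (EuclideanSpace.single i 1)| < ε := by
    intro f i hf
    have h1 := f.le_opNorm (EuclideanSpace.single i 1)
    rw [Real.norm_eq_abs, PiLp.norm_single, norm_one, mul_one] at h1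
    linarith
  refine ⟨xhat + x, hmem₁ x hxr, yhat + y, hmem₂ y hyr, _, _, _, _, ?_, ?_, ?_, ?_, ?_, ?_,
    mem_secondOrderSuperjet_of_translate (L := L₁) (fun y => by ring)
      (hxδ.trans_le (min_le_left _ _)) hX hjx,
    mem_secondOrderSuperjet_of_translate (L := L₂) (fun y => by ring)
      (hyδ.trans_le (min_le_left _ _)) hY hjy, ?_, ?_, ?_⟩
  · rw [add_sub_cancel_left]; exact hxδ.trans_le hδε
  · rw [add_sub_cancel_left]; exact hyδ.trans_le hδε
  · refine hclose _ (x, 0) ?_ (by rw [← hL₁]; exact hux)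
    simpa [Prod.norm_def] using hxδ
  · refine hclose _ (0, y) ?_ (by rw [← hL₂]; exact hvy)
    simpa [Prod.norm_def] using hyδ
  · intro i
    simpa [prodBasis, hL₁] using hcoord p i hpδ
  · intro i
    simpa [prodBasis, hL₂] using hcoord q i hqδ
  · intro h
    have h1 := hlx (WithLp.toLp 2 h)
    rw [EuclideanSpace.apply_apply_eq_dotProduct, EuclideanSpace.real_norm_sq_eq] at h1
    have h2 : h ⬝ᵥ h = ∑ i, h i ^ 2 := by simp [dotProduct, sq]
    have h3 : 0 ≤ ∑ i, h i ^ 2 := Finset.sum_nonneg fun i _ => sq_nonneg _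
    rw [h2]
    refine le_trans ?_ h1
    dsimp only
    nlinarith
  · intro h
    have h1 := hly (WithLp.toLp 2 h)
    rw [EuclideanSpace.apply_apply_eq_dotProduct, EuclideanSpace.real_norm_sq_eq] at h1
    have h2 : h ⬝ᵥ h = ∑ i, h i ^ 2 := by simp [dotProduct, sq]
    have h3 : 0 ≤ ∑ i, h i ^ 2 := Finset.sum_nonneg fun i _ => sq_nonneg _
    rw [h2]
    refine le_trans ?_ h1
    dsimp only
    nlinarith
  · intro h k
    have h1 := hXY (WithLp.toLp 2 h) (WithLp.toLp 2 k)
    rwa [EuclideanSpace.apply_apply_eq_dotProduct, EuclideanSpace.apply_apply_eq_dotProduct,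
      hRR] at h1

theorem maxAbsEigenvalue_nonneg {ι : Type*} [Fintype ι] (M : Matrix ι ι ℝ) :
    0 ≤ maxAbsEigenvalue M :=
  Real.sSup_nonneg (by rintro _ ⟨t, rfl, _⟩; exact abs_nonneg t)

theorem abs_le_maxAbsEigenvalue {ι : Type*} [Fintype ι] [DecidableEq ι] {M : Matrix ι ι ℝ}
    {t : ℝ} {w : ι → ℝ} (hw : w ≠ 0) (ht : M *ᵥ w = t • w) : |t| ≤ maxAbsEigenvalue M := by
  refine le_csSup ?_ ⟨t, rfl, w, hw, ht⟩
  refine (((Module.End.finite_hasEigenvalue (Matrix.toLin' M)).image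
    (fun t : ℝ => |t|)).subset ?_).bddAbove
  rintro _ ⟨t, rfl, w, hw, ht⟩
  exact ⟨t, Module.End.hasEigenvalue_of_hasEigenvector
    (x := w) ⟨Module.End.mem_eigenspace_iff.2 (by simpa using ht), hw⟩, rfl⟩

theorem dotProduct_mulVec_le_maxAbsEigenvalue {ι : Type*} [Fintype ι] [DecidableEq ι]
    {H : Matrix ι ι ℝ} (hH : H.IsSymm) (s : ι → ℝ) :
    s ⬝ᵥ H *ᵥ s ≤ maxAbsEigenvalue H * (s ⬝ᵥ s) := by
  have hM : (maxAbsEigenvalue H • (1 : Matrix ι ι ℝ) - H).IsHermitian := by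
    simp [Matrix.IsHermitian, conjTranspose_eq_transpose_of_trivial, hH.eq]
  have hpos : (maxAbsEigenvalue H • (1 : Matrix ι ι ℝ) - H).PosSemidef := by
    rw [hM.posSemidef_iff_eigenvalues_nonneg]
    intro i
    have h1 := hM.mulVec_eigenvectorBasis i
    have h2 : H *ᵥ (hM.eigenvectorBasis i).ofLp =
        (maxAbsEigenvalue H - hM.eigenvalues i) • (hM.eigenvectorBasis i).ofLp := by
      rw [sub_mulVec, smul_mulVec, one_mulVec] at h1
      rw [sub_smul, ← h1, sub_sub_cancel]
    have h3 := le_of_abs_le (abs_le_maxAbsEigenvalue (fun h0 =>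
      (hM.eigenvectorBasis.orthonormal.ne_zero i) (by ext j; simp [h0])) h2)
    simp only [Pi.zero_apply]
    linarith
  have h1 := hpos.dotProduct_mulVec_nonneg s
  rw [sub_mulVec, smul_mulVec, one_mulVec, dotProduct_sub, dotProduct_smul, smul_eq_mul,
    star_trivial] at h1
  linarith

theorem Matrix.IsSymm.abs_apply_le {ι : Type*} [Fintype ι] [DecidableEq ι] {M : Matrix ι ι ℝ}
    (hM : M.IsSymm) {c : ℝ} (h : ∀ s, |s ⬝ᵥ M *ᵥ s| ≤ c * (s ⬝ᵥ s)) (i j : ι) : |M i j| ≤ c := by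
  have h1 := h (Pi.single i 1 + Pi.single j 1)
  have h2 := h (Pi.single i 1 - Pi.single j 1)
  have h3 : (Pi.single j 1 : ι → ℝ) i = (Pi.single i 1 : ι → ℝ) j := Pi.single_comm _ _ _
  simp only [mulVec_add, mulVec_sub, dotProduct_add, dotProduct_sub, add_dotProduct,
    sub_dotProduct, mulVec_single_one, single_one_dotProduct, Matrix.col_apply,
    Pi.single_eq_same, h3] at h1 h2
  rw [hM.apply i j] at h1 h2
  rw [abs_le] at *
  constructor <;> linarith [h1.1, h1.2, h2.1, h2.2]

theorem isSymm_of_tendsto {ι : Type*} {M : ℕ → Matrix ι ι ℝ} {L : Matrix ι ι ℝ}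
    (h : Tendsto M atTop (𝓝 L)) (hM : ∀ k, (M k).IsSymm) : L.IsSymm := by
  refine tendsto_nhds_unique (f := M) ?_ h
  have h1 : Tendsto (fun k => (M k)ᵀ) atTop (𝓝 Lᵀ) := 
    (continuous_id.matrix_transpose.tendsto L).comp h
  simpa only [(hM _).eq] using h1

theorem exists_tendsto_subseq_of_abs_apply_le {n : ℕ} {X Y : ℕ → Matrix (Fin n) (Fin n) ℝ}
    {c : ℝ} (hX : ∀ k i j, |X k i j| ≤ c) (hY : ∀ k i j, |Y k i j| ≤ c) :
    ∃ (A B : Matrix (Fin n) (Fin n) ℝ) (σ : ℕ → ℕ), StrictMono σ ∧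
      Tendsto (fun k => X (σ k)) atTop (𝓝 A) ∧ Tendsto (fun k => Y (σ k)) atTop (𝓝 B) := by
  obtain ⟨K, hK, hmem⟩ : ∃ K : Set (Fin n → Fin n → ℝ), IsCompact K ∧
      ∀ M : Fin n → Fin n → ℝ, (∀ i j, |M i j| ≤ c) → M ∈ K :=
    ⟨Set.univ.pi fun _ => Set.univ.pi fun _ => Set.Icc (-c) c,
      isCompact_univ_pi fun _ => isCompact_univ_pi fun _ => isCompact_Icc,
      fun M hM i _ j _ => abs_le.1 (hM i j)⟩
  obtain ⟨⟨A, B⟩, -, σ, hσ, hlim⟩ := (hK.prod hK).tendsto_subseq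
    (X := (Fin n → Fin n → ℝ) × (Fin n → Fin n → ℝ)) (x := fun k => (X k, Y k))
    fun k => ⟨hmem _ (hX k), hmem _ (hY k)⟩
  exact ⟨A, B, σ, hσ, (continuous_fst.tendsto _).comp hlim, (continuous_snd.tendsto _).comp hlim⟩

theorem neg_mem_secondOrderSubjet {n : ℕ} {Ω : Set (EuclideanSpace ℝ (Fin n))}
    {v : EuclideanSpace ℝ (Fin n) → ℝ} {x : EuclideanSpace ℝ (Fin n)} {p : Fin n → ℝ}
    {X : Matrix (Fin n) (Fin n) ℝ} (h : (p, X) ∈ secondOrderSuperjet Ω (-v) x) :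
    (-p, -X) ∈ secondOrderSubjet Ω v x := by
  refine ⟨h.1.neg, fun ε hε => ?_⟩
  obtain ⟨δ, hδ, hle⟩ := h.2 ε hε
  refine ⟨δ, hδ, fun y hy hyx => ?_⟩
  have h1 := hle y hy hyx
  simp only [Pi.neg_apply, neg_mulVec, neg_dotProduct, neg_mul, Finset.sum_neg_distrib] at h1 ⊢
  linarith

theorem hessianProd_eq {n : ℕ} {φ : EuclideanSpace ℝ (Fin n) × EuclideanSpace ℝ (Fin n) → ℝ}
    {z : EuclideanSpace ℝ (Fin n) × EuclideanSpace ℝ (Fin n)}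
    (h : DifferentiableAt ℝ (fderiv ℝ φ) z) :
    hessianProd φ z =
      Matrix.of fun a b => fderiv ℝ (fderiv ℝ φ) z (prodBasis a) (prodBasis b) := by
  ext a b
  have h1 := (h.hasFDerivAt.clm_apply (hasFDerivAt_const (prodBasis b) z)).fderiv
  simp only [hessianProd, h1]
  simp

theorem tendsto_of_forall_norm_sub_lt {E : Type*} [SeminormedAddCommGroup E] {f : ℕ → E} {a : E}
    {σ : ℕ → ℕ} (hσ : StrictMono σ) (h : ∀ k : ℕ, ‖f k - a‖ < 1 / ((k : ℝ) + 1)) :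
    Tendsto (fun k => f (σ k)) atTop (𝓝 a) := by
  have h1 : Tendsto f atTop (𝓝 a) := tendsto_iff_norm_sub_tendsto_zero.2
    (squeeze_zero (fun _ => norm_nonneg _) (fun k => (h k).le)
      tendsto_one_div_add_atTop_nhds_zero_nat)
  exact h1.comp hσ.tendsto_atTop

theorem sumElim_dotProduct_fromBlocks_mulVec {n : ℕ} (A B : Matrix (Fin n) (Fin n) ℝ)
    (h k : Fin n → ℝ) :
    Sum.elim h k ⬝ᵥ fromBlocks A 0 0 B *ᵥ Sum.elim h k = h ⬝ᵥ A *ᵥ h + k ⬝ᵥ B *ᵥ k := by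
  simp [fromBlocks_mulVec]

/-- **Crandall–Ishii–Lions theorem on sums.**  Let `Ω ⊆ ℝⁿ` be open, `u`
upper semicontinuous and `v` lower semicontinuous on `closure Ω`, and `φ` a `C²`
function on an open set `W ⊇ Ω × Ω`.  If `u(xhat) − v(yhat) − φ(xhat,yhat)` is the maximum of
`u(x) − v(y) − φ(x,y)` over `closure Ω × closure Ω` with `(xhat,yhat) ∈ Ω × Ω`, then for
every `μ > 0` there are symmetric matrices `A, B` with
`(D_xφ(xhat,yhat), A) ∈ J̄^{2,+}u(xhat)`, `(−D_yφ(xhat,yhat), B) ∈ J̄^{2,−}v(yhat)`, and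
`−(μ + ‖D²φ(xhat,yhat)‖)·I ≤ [[A,0],[0,−B]] ≤ D²φ(xhat,yhat) + μ⁻¹(D²φ(xhat,yhat))²`
in the Loewner order, `‖·‖` being the maximal absolute value of the eigenvalues. -/
theorem theorem_on_sums (n : ℕ) (Ω : Set (EuclideanSpace ℝ (Fin n))) (hΩ : IsOpen Ω)
    (u v : EuclideanSpace ℝ (Fin n) → ℝ)
    (hu : UpperSemicontinuousOn u (closure Ω))
    (hv : LowerSemicontinuousOn v (closure Ω))
    (W : Set (EuclideanSpace ℝ (Fin n) × EuclideanSpace ℝ (Fin n)))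
    (hW : IsOpen W) (hΩW : Ω ×ˢ Ω ⊆ W)
    (φ : EuclideanSpace ℝ (Fin n) × EuclideanSpace ℝ (Fin n) → ℝ)
    (hφ : ContDiffOn ℝ 2 φ W)
    (xhat yhat : EuclideanSpace ℝ (Fin n)) (hxhat : xhat ∈ Ω) (hyhat : yhat ∈ Ω)
    (hmax : ∀ x ∈ closure Ω, ∀ y ∈ closure Ω,
      u x - v y - φ (x, y) ≤ u xhat - v yhat - φ (xhat, yhat)) :
    ∀ μ : ℝ, 0 < μ → ∃ A B : Matrix (Fin n) (Fin n) ℝ, A.IsSymm ∧ B.IsSymm ∧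
      (gradFst φ (xhat, yhat), A) ∈ closureSuperjet Ω u xhat ∧
      ((fun j => -gradSnd φ (xhat, yhat) j), B) ∈ closureSubjet Ω v yhat ∧
      (fromBlocks A 0 0 (-B) +
        (μ + maxAbsEigenvalue (hessianProd φ (xhat, yhat))) •
          (1 : Matrix (Fin n ⊕ Fin n) (Fin n ⊕ Fin n) ℝ)).PosSemidef ∧
      (hessianProd φ (xhat, yhat) +
        μ⁻¹ • (hessianProd φ (xhat, yhat) * hessianProd φ (xhat, yhat)) -
          fromBlocks A 0 0 (-B)).PosSemidef := by
  intro μ hμ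
  have hmemW : (xhat, yhat) ∈ W := hΩW ⟨hxhat, hyhat⟩
  have hC2 : ContDiffAt ℝ 2 φ (xhat, yhat) := hφ.contDiffAt (hW.mem_nhds hmemW)
  have hdφ : ∀ᶠ z in 𝓝 (xhat, yhat), HasFDerivAt φ (fderiv ℝ φ z) z := by
    filter_upwards [hW.mem_nhds hmemW] with z hz
    exact ((hφ.contDiffAt (hW.mem_nhds hz)).differentiableAt (by norm_num)).hasFDerivAt
  have hddφ : DifferentiableAt ℝ (fderiv ℝ φ) (xhat, yhat) :=
    (hC2.fderiv_right (m := 1) (by norm_num)).differentiableAt (by norm_num)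
  have hHess := hessianProd_eq hddφ
  have hA : ∀ z, fderiv ℝ (fderiv ℝ φ) (xhat, yhat) z z =
      Sum.elim z.1 z.2 ⬝ᵥ hessianProd φ (xhat, yhat) *ᵥ Sum.elim z.1 z.2 := fun z => by
    rw [hHess]; exact apply_apply_eq_dotProduct_prodBasis _ z
  have hHsymm : (hessianProd φ (xhat, yhat)).IsSymm := by
    rw [hHess]
    exact Matrix.IsSymm.ext fun a b =>
      second_derivative_symmetric_of_eventually hdφ hddφ.hasFDerivAt _ _
  generalize hessianProd φ (xhat, yhat) = H at hA hHsymm ⊢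
  have hm0 := maxAbsEigenvalue_nonneg H
  have hm := dotProduct_mulVec_le_maxAbsEigenvalue hHsymm
  generalize maxAbsEigenvalue H = m at hm0 hm ⊢
  have hGsymm : (H + μ⁻¹ • (H * H)).IsSymm := by
    simp [Matrix.IsSymm, transpose_mul, hHsymm.eq]
  have hg := dotProduct_mulVec_le_maxAbsEigenvalue hGsymm
  have hg0 := maxAbsEigenvalue_nonneg (H + μ⁻¹ • (H * H))
  generalize maxAbsEigenvalue (H + μ⁻¹ • (H * H)) = g at hg hg0
  have hstep := fun k : ℕ => exists_approx_jets hΩ (hu.mono subset_closure)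
    (hv.neg.mono subset_closure) hxhat hyhat hdφ hddφ.hasFDerivAt
    (fun x hx y hy => by
      have h1 := hmax x (subset_closure hx) y (subset_closure hy)
      simp only [Pi.neg_apply]
      linarith) hHsymm hA hm0 hm hμ (Nat.one_div_pos_of_nat (α := ℝ) (n := k))
  choose x hx y hy p q X Y hxe hye hue hve hpe hqe hpX hqY hXl hYl hXYu using hstep
  have hε1 : ∀ k : ℕ, 1 / ((k : ℝ) + 1) ≤ 1 := fun k => by
    rw [div_le_one (by positivity)]
    linarith [Nat.cast_nonneg (α := ℝ) k]
  have hself : ∀ h : Fin n → ℝ, 0 ≤ h ⬝ᵥ h := fun h =>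
    Finset.sum_nonneg fun i _ => mul_self_nonneg _
  have hlow : ∀ {a : ℝ} (k : ℕ) (h : Fin n → ℝ),
      -(μ + m + 1 / ((k : ℝ) + 1)) * (h ⬝ᵥ h) ≤ a → -((μ + m + 1 + g) * (h ⬝ᵥ h)) ≤ a := by
    intro a k h ha
    nlinarith [hself h, hε1 k, mul_nonneg hg0 (hself h),
      mul_le_mul_of_nonneg_right (hε1 k) (hself h)]
  have hup : ∀ {a : ℝ} (k : ℕ) (s : Fin n ⊕ Fin n → ℝ) (h : Fin n → ℝ), s ⬝ᵥ s = h ⬝ᵥ h →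
      a ≤ s ⬝ᵥ (H + μ⁻¹ • (H * H)) *ᵥ s + 1 / ((k : ℝ) + 1) * (s ⬝ᵥ s) →
      a ≤ (μ + m + 1 + g) * (h ⬝ᵥ h) := by
    intro a k s h hs ha
    have h1 := hg s
    rw [hs] at h1 ha
    nlinarith [hself h, mul_nonneg hm0 (hself h), mul_nonneg hμ.le (hself h),
      mul_le_mul_of_nonneg_right (hε1 k) (hself h)]
  have hXb : ∀ k i j, |X k i j| ≤ μ + m + 1 + g := fun k =>
    (hpX k).1.abs_apply_le fun h => abs_le.2 ⟨hlow k h (hXl k h),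
      hup k (Sum.elim h 0) h (by simp) (by simpa using hXYu k h 0)⟩
  have hYb : ∀ k i j, |Y k i j| ≤ μ + m + 1 + g := fun k =>
    (hqY k).1.abs_apply_le fun h => abs_le.2 ⟨hlow k h (hYl k h),
      hup k (Sum.elim 0 h) h (by simp) (by simpa using hXYu k 0 h)⟩
  obtain ⟨A, B, σ, hσ, hXA, hYB⟩ := exists_tendsto_subseq_of_abs_apply_le hXb hYb
  have hAsymm : A.IsSymm := isSymm_of_tendsto hXA fun k => (hpX _).1
  have hBsymm : B.IsSymm := isSymm_of_tendsto hYB fun k => (hqY _).1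
  have hε0 : Tendsto (fun k => 1 / ((σ k : ℝ) + 1)) atTop (𝓝 0) :=
    tendsto_one_div_add_atTop_nhds_zero_nat.comp hσ.tendsto_atTop
  have hquad : ∀ {M : ℕ → Matrix (Fin n) (Fin n) ℝ} {L : Matrix (Fin n) (Fin n) ℝ},
      Tendsto M atTop (𝓝 L) → ∀ h : Fin n → ℝ,
      Tendsto (fun k => h ⬝ᵥ M k *ᵥ h) atTop (𝓝 (h ⬝ᵥ L *ᵥ h)) := fun hM h =>
    ((continuous_const.dotProduct (continuous_id.matrix_mulVec continuous_const)).tendsto _).comp hM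
  have hlowlim : ∀ {M : ℕ → Matrix (Fin n) (Fin n) ℝ} {L : Matrix (Fin n) (Fin n) ℝ},
      Tendsto M atTop (𝓝 L) → (∀ k h, -(μ + m + 1 / ((σ k : ℝ) + 1)) * (h ⬝ᵥ h) ≤
        h ⬝ᵥ M k *ᵥ h) → ∀ h, -(μ + m) * (h ⬝ᵥ h) ≤ h ⬝ᵥ L *ᵥ h := by
    intro M L hML hM h
    have h1 : Tendsto (fun k => -(μ + m + 1 / ((σ k : ℝ) + 1)) * (h ⬝ᵥ h)) atTop
        (𝓝 (-(μ + m + 0) * (h ⬝ᵥ h))) := ((hε0.const_add (μ + m)).neg).mul_const _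
    rw [add_zero] at h1
    exact le_of_tendsto_of_tendsto' h1 (hquad hML h) fun k => hM k h
  have hAl := hlowlim hXA fun k => hXl (σ k)
  have hBl := hlowlim hYB fun k => hYl (σ k)
  have hABu : ∀ h k, h ⬝ᵥ A *ᵥ h + k ⬝ᵥ B *ᵥ k ≤
      Sum.elim h k ⬝ᵥ (H + μ⁻¹ • (H * H)) *ᵥ Sum.elim h k := by
    intro h k
    have h1 := (hε0.mul_const (Sum.elim h k ⬝ᵥ Sum.elim h k)).const_add
      (Sum.elim h k ⬝ᵥ (H + μ⁻¹ • (H * H)) *ᵥ Sum.elim h k)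
    rw [zero_mul, add_zero] at h1
    exact le_of_tendsto_of_tendsto' ((hquad hXA h).add (hquad hYB k)) h1 fun i => hXYu (σ i) h k
  have hblock : (fromBlocks A 0 0 B).IsSymm := hAsymm.fromBlocks (transpose_zero) hBsymm
  refine ⟨A, -B, hAsymm, hBsymm.neg, ⟨_, _, _, fun k => hx (σ k), fun k => hpX (σ k),
    tendsto_of_forall_norm_sub_lt hσ hxe,
    tendsto_of_forall_norm_sub_lt (f := fun k => u (x k)) hσ hue, ?_, hXA⟩,
    ⟨_, _, _, fun k => hy (σ k), fun k => neg_mem_secondOrderSubjet (hqY (σ k)),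
      tendsto_of_forall_norm_sub_lt hσ hye, ?_, ?_, hYB.neg⟩, ?_, ?_⟩
  · exact tendsto_pi_nhds.2 fun i => tendsto_of_forall_norm_sub_lt (f := fun k => p k i) hσ
      fun k => hpe k i
  · simpa using (tendsto_of_forall_norm_sub_lt (f := fun k => (-v) (y k)) hσ hve).neg
  · exact tendsto_pi_nhds.2 fun i => (tendsto_of_forall_norm_sub_lt (f := fun k => q k i) hσ
      fun k => hqe k i).neg
  · rw [neg_neg]
    refine Matrix.PosSemidef.of_dotProduct_mulVec_nonneg ?_ fun s => ?_
    · simp [Matrix.IsHermitian, conjTranspose_eq_transpose_of_trivial, hblock.eq]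
    · obtain ⟨h, k, rfl⟩ : ∃ h k, s = Sum.elim h k := ⟨_, _, (Sum.elim_comp_inl_inr s).symm⟩
      rw [star_trivial, add_mulVec, dotProduct_add, sumElim_dotProduct_fromBlocks_mulVec,
        smul_mulVec, one_mulVec, dotProduct_smul, smul_eq_mul, sumElim_dotProduct_sumElim]
      linarith [hAl h, hBl k]
  · rw [neg_neg]
    refine Matrix.PosSemidef.of_dotProduct_mulVec_nonneg ?_ fun s => ?_
    · rw [Matrix.IsHermitian, conjTranspose_eq_transpose_of_trivial, transpose_sub, hblock.eq,
        hGsymm.eq]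
    · obtain ⟨h, k, rfl⟩ : ∃ h k, s = Sum.elim h k := ⟨_, _, (Sum.elim_comp_inl_inr s).symm⟩
      rw [star_trivial, sub_mulVec, dotProduct_sub, sumElim_dotProduct_fromBlocks_mulVec]
      linarith [hABu h k]
end

section
/- Let A, B be n×n real symmetric matrices, k ≥ 0, and suppose that ⟨Aξ,ξ⟩ − ⟨Bη,η⟩ ≤ k|ξ−η|² for all ξ, η ∈ ℝⁿ (i.e., the block matrix [[A,0],[0,−B]] ≤ k·[[I,−I],[−I,I]] in the Loewner order on 2n×2n matrices). Then for any m×n real matrices σ₁, σ₂: Tr(σ₁Aσ₁ᵀ − σ₂Bσ₂ᵀ) ≤ k·Tr( (σ₁−σ₂)(σ₁−σ₂)ᵀ ). -/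
open Matrix

/-- The diagonal entries of `σ M σᵀ` are the values of the quadratic form of `M` on the rows
of `σ`. -/
theorem Matrix.mul_mul_transpose_apply_self {m n R : Type*} [Fintype n] [CommSemiring R]
    (σ : Matrix m n R) (M : Matrix n n R) (i : m) :
    (σ * M * σᵀ) i i = M.mulVec (σ i) ⬝ᵥ σ i := by
  rw [Matrix.mul_assoc, dotProduct_comm]
  rfl

/-- Let `A, B` be symmetric `n × n` real matrices, `k ≥ 0`, with
`⟨Aξ,ξ⟩ − ⟨Bη,η⟩ ≤ k|ξ−η|²` for all `ξ, η` (i.e. `[[A,0],[0,−B]] ≤ k·[[I,−I],[−I,I]]`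
in the Loewner order).  Then for any `m × n` real matrices `σ₁, σ₂`,
`Tr(σ₁Aσ₁ᵀ − σ₂Bσ₂ᵀ) ≤ k·Tr((σ₁−σ₂)(σ₁−σ₂)ᵀ)`. -/
theorem trace_estimate_of_loewner_block_bound (m n : ℕ)
    (A B : Matrix (Fin n) (Fin n) ℝ) (hA : A.IsSymm) (hB : B.IsSymm)
    (k : ℝ) (hk : 0 ≤ k)
    (h : ∀ ξ η : EuclideanSpace ℝ (Fin n),
      A.mulVec ξ ⬝ᵥ ξ - B.mulVec η ⬝ᵥ η ≤ k * ‖ξ - η‖ ^ 2)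
    (σ₁ σ₂ : Matrix (Fin m) (Fin n) ℝ) :
    (σ₁ * A * σ₁ᵀ - σ₂ * B * σ₂ᵀ).trace ≤ k * ((σ₁ - σ₂) * (σ₁ - σ₂)ᵀ).trace := by
  have row_bound (i : Fin m) :
      (σ₁ * A * σ₁ᵀ - σ₂ * B * σ₂ᵀ) i i ≤ k * ((σ₁ - σ₂) * (σ₁ - σ₂)ᵀ) i i := by
    have norm_row : ‖WithLp.toLp 2 (σ₁ i) - WithLp.toLp 2 (σ₂ i)‖ ^ 2
        = ((σ₁ - σ₂) * (σ₁ - σ₂)ᵀ) i i := by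
      simp [EuclideanSpace.real_norm_sq_eq, Matrix.mul_apply, ← pow_two]
    rw [Matrix.sub_apply, Matrix.mul_mul_transpose_apply_self,
      Matrix.mul_mul_transpose_apply_self, ← norm_row]
    exact h (WithLp.toLp 2 (σ₁ i)) (WithLp.toLp 2 (σ₂ i))
  simp only [Matrix.trace, Matrix.diag_apply, Finset.mul_sum]
  exact Finset.sum_le_sum fun i _ => row_bound i
end
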